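/- Let Γ be an icc countable group and let Γ↷(P₀ ⊆ P) be a compact extension of tracial von Neumann algebras. Then for any intermediate von Neumann subalgebra P₀⋊Γ ⊆ N ⊆ P⋊Γ there exists a Γ-invariant intermediate von Neumann subalgebra P₀ ⊆ Q ⊆ P such that N = Q⋊Γ. -/

import Mathlib

/-!
Common framework: we model tracial von Neumann algebras concretely, as von Neumann
algebras `M ⊆ B(H)` (Mathlib's `VonNeumannAlgebra H`, i.e. star-subalgebras equal to
their double commutant) equipped with a faithful tracial state, and we model the
crossed product `A ⋊ Γ` of a trace-preserving action axiomatically: `M` contains a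
copy of `A` and a group `(u γ)` of unitaries normalizing `A`, such that the canonical
trace-preserving conditional expectation `E_A` kills `u γ` for `γ ≠ 1`, and such that
an element of `M` all of whose Fourier coefficients `E_A (x (u γ)*)` vanish is `0`.
Probability-measure-preserving actions `Γ ↷ (X, μ)` are modelled via the associated
trace-preserving action on the abelian von Neumann algebra `A = L^∞(X)`.
-/

noncomputable section

open scoped Classical

namespace CD

/-- A group has infinite conjugacy classes (icc) if every nontrivial conjugacy
class is infinite. -/
def IsICC (Γ : Type) [Group Γ] : Prop :=
  ∀ γ : Γ, γ ≠ 1 → {g : Γ | ∃ h : Γ, g = h * γ * h⁻¹}.Infinite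

/-- A faithful tracial state on (the elements of) a set `M ⊆ B(H)` (in applications,
a von Neumann algebra), given as a globally defined linear functional whose
axioms are imposed on `M`. -/
structure TraceOn (H : Type) [NormedAddCommGroup H] [InnerProductSpace ℂ H] [CompleteSpace H]
    (M : Set (H →L[ℂ] H)) : Type where
  τ : (H →L[ℂ] H) →ₗ[ℂ] ℂ
  unital : τ 1 = 1
  tracial : ∀ x ∈ M, ∀ y ∈ M, τ (x * y) = τ (y * x)
  star_eq : ∀ x ∈ M, τ (star x) = starRingEnd ℂ (τ x)
  nonneg : ∀ x ∈ M, 0 ≤ (τ (star x * x)).re ∧ (τ (star x * x)).im = 0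
  faithful : ∀ x ∈ M, τ (star x * x) = 0 → x = 0

variable {H : Type} [NormedAddCommGroup H] [InnerProductSpace ℂ H] [CompleteSpace H]

/-- The 2-norm `‖x‖₂ = τ(x* x)^{1/2}` associated with a trace. -/
def TraceOn.norm2 {M : Set (H →L[ℂ] H)} (tr : TraceOn H M) (x : H →L[ℂ] H) : ℝ :=
  Real.sqrt (tr.τ (star x * x)).re

/-- The (unique) trace-preserving conditional expectation from `M` onto a
von Neumann subalgebra `N ⊆ M`. -/
structure CondExpOn (H : Type) [NormedAddCommGroup H] [InnerProductSpace ℂ H] [CompleteSpace H]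
    (M N : Set (H →L[ℂ] H)) (tr : TraceOn H M) : Type where
  E : (H →L[ℂ] H) →ₗ[ℂ] (H →L[ℂ] H)
  mem : ∀ x ∈ M, E x ∈ N
  fix : ∀ x ∈ N, E x = x
  bimod : ∀ a ∈ N, ∀ b ∈ N, ∀ x ∈ M, E (a * x * b) = a * E x * b
  star_map : ∀ x ∈ M, E (star x) = star (E x)
  trace_eq : ∀ x ∈ M, tr.τ (E x) = tr.τ x
  contractive : ∀ x ∈ M, tr.norm2 (E x) ≤ tr.norm2 x

/-- The double commutant of a subset of `B(H)`: the von Neumann algebra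
generated by `S` (for `S` a star-closed unital set). -/
def vnGen (S : Set (H →L[ℂ] H)) : Set (H →L[ℂ] H) :=
  Set.centralizer (Set.centralizer S)

/-- Model of the crossed product von Neumann algebra `M = A ⋊ Γ` of a
trace-preserving action `Γ ↷ (A, τ)`: `M` is generated by a copy of `A`
and canonical unitaries `(u γ)` implementing the action, with its canonical
conditional expectation `E_A` onto `A` (characterising the Fourier coefficients),
together with the group von Neumann algebra `L(Γ) = {u γ : γ}'' ⊆ M` and the
conditional expectation onto it. -/
structure CrossedProduct (Γ : Type) [Group Γ]
    (H : Type) [NormedAddCommGroup H] [InnerProductSpace ℂ H] [CompleteSpace H] : Type where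
  M : VonNeumannAlgebra H
  A : VonNeumannAlgebra H
  A_sub : (A : Set (H →L[ℂ] H)) ⊆ (M : Set (H →L[ℂ] H))
  tr : TraceOn H (M : Set (H →L[ℂ] H))
  u : Γ → (H →L[ℂ] H)
  u_mem : ∀ γ, u γ ∈ M
  u_one : u 1 = 1
  u_mul : ∀ γ δ, u γ * u δ = u (γ * δ)
  u_star : ∀ γ, star (u γ) = u γ⁻¹
  conj_mem : ∀ (γ : Γ), ∀ a ∈ A, u γ * a * star (u γ) ∈ A
  EA : CondExpOn H (M : Set (H →L[ℂ] H)) (A : Set (H →L[ℂ] H)) tr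
  EA_u : ∀ γ : Γ, γ ≠ 1 → EA.E (u γ) = 0
  fourier_sep : ∀ x ∈ M, (∀ γ : Γ, EA.E (x * star (u γ)) = 0) → x = 0
  Lg : VonNeumannAlgebra H
  Lg_eq : (Lg : Set (H →L[ℂ] H)) = vnGen (Set.range u)
  Lg_sub : (Lg : Set (H →L[ℂ] H)) ⊆ (M : Set (H →L[ℂ] H))
  EL : CondExpOn H (M : Set (H →L[ℂ] H)) (Lg : Set (H →L[ℂ] H)) tr

variable {Γ : Type} [Group Γ]

/-- The action `σ_γ = Ad(u γ)` of `Γ` on `B(H)`, restricting to the given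
action on `A`. -/
def CrossedProduct.σ (X : CrossedProduct Γ H) (γ : Γ) (x : H →L[ℂ] H) : H →L[ℂ] H :=
  X.u γ * x * star (X.u γ)

/-- The action is properly outer over the center of `P`; for abelian `P` this is
the usual freeness of the action. -/
def ProperlyOuterOn (X : CrossedProduct Γ H) (P : Set (H →L[ℂ] H)) : Prop :=
  ∀ γ : Γ, γ ≠ 1 → ∀ a ∈ P, (∀ b ∈ P, X.σ γ b * a = a * b) → a = 0

/-- Freeness of the action `Γ ↷ A`. -/
def IsFree (X : CrossedProduct Γ H) : Prop := ProperlyOuterOn X (X.A : Set (H →L[ℂ] H))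

/-- Ergodicity of the action `Γ ↷ A`: the fixed points are the scalars. -/
def IsErgodic (X : CrossedProduct Γ H) : Prop :=
  ∀ a ∈ X.A, (∀ γ : Γ, X.σ γ a = a) → ∃ c : ℂ, a = c • (1 : H →L[ℂ] H)

def IsAbelianSet (S : Set (H →L[ℂ] H)) : Prop := ∀ x ∈ S, ∀ y ∈ S, x * y = y * x

/-- `Q` is a `Γ`-invariant subset (in applications, subalgebra). -/
def InvariantUnder (X : CrossedProduct Γ H) (Q : Set (H →L[ℂ] H)) : Prop :=
  ∀ (γ : Γ), ∀ q ∈ Q, X.σ γ q ∈ Q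

/-- The intermediate crossed product `Q ⋊ Γ ⊆ A ⋊ Γ` of a (`Γ`-invariant)
subalgebra `Q ⊆ A`: those elements all of whose Fourier coefficients lie in `Q`. -/
def midCP (X : CrossedProduct Γ H) (Q : Set (H →L[ℂ] H)) : Set (H →L[ℂ] H) :=
  {x | x ∈ X.M ∧ ∀ γ : Γ, X.EA.E (x * star (X.u γ)) ∈ Q}

/-- The intermediate crossed product `A ⋊ K ⊆ A ⋊ Γ` of a subgroup `K ≤ Γ`:
those elements whose Fourier coefficients are supported on `K`. -/
def subgpCP (X : CrossedProduct Γ H) (K : Subgroup Γ) : Set (H →L[ℂ] H) :=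
  {x | x ∈ X.M ∧ ∀ γ : Γ, γ ∉ K → X.EA.E (x * star (X.u γ)) = 0}

/-- The quasinormalizer `QN_M(P)` of `P` inside `M`. -/
def QNset (M P : Set (H →L[ℂ] H)) : Set (H →L[ℂ] H) :=
  {x | x ∈ M ∧ ∃ (n : ℕ) (y : Fin n → (H →L[ℂ] H)), (∀ i, y i ∈ M) ∧
    (∀ p ∈ P, ∃ q : Fin n → (H →L[ℂ] H), (∀ i, q i ∈ P) ∧ p * x = ∑ i, y i * q i) ∧
    (∀ p ∈ P, ∃ q : Fin n → (H →L[ℂ] H), (∀ i, q i ∈ P) ∧ x * p = ∑ i, q i * y i)}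

def IsUnitaryIn (S : Set (H →L[ℂ] H)) (x : H →L[ℂ] H) : Prop :=
  x ∈ S ∧ star x * x = 1 ∧ x * star x = 1

def IsProjIn (S : Set (H →L[ℂ] H)) (p : H →L[ℂ] H) : Prop :=
  p ∈ S ∧ star p = p ∧ p * p = p

/-- The relative commutant `N' ∩ S`. -/
def commutantIn (N S : Set (H →L[ℂ] H)) : Set (H →L[ℂ] H) :=
  {x | x ∈ S ∧ ∀ y ∈ N, x * y = y * x}

/-- Conjugation `w ( · ) w*` applied to a set. -/
def conjSet (w : H →L[ℂ] H) (S : Set (H →L[ℂ] H)) : Set (H →L[ℂ] H) :=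
  (fun y => w * y * star w) '' S

/-- The scalars `ℂ 1 ⊆ B(H)`. -/
def scalars (H : Type) [NormedAddCommGroup H] [InnerProductSpace ℂ H] [CompleteSpace H] :
    Set (H →L[ℂ] H) :=
  Set.range (fun c : ℂ => c • (1 : H →L[ℂ] H))

/-- The extension `P₀ ⊆ P` of `Γ`-algebras is compact: there is a family `F ⊆ P`
with dense `‖·‖₂`-span in `P` such that the `Γ`-orbit of each `f ∈ F` can be
uniformly approximated by finitely many "`P₀`-finite rank modules". -/
def IsCompactExt (X : CrossedProduct Γ H) (P₀ P : Set (H →L[ℂ] H)) : Prop :=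
  ∃ F : Set (H →L[ℂ] H), F ⊆ P ∧
    (∀ p ∈ P, ∀ ε : ℝ, 0 < ε → ∃ (n : ℕ) (c : Fin n → ℂ) (f : Fin n → (H →L[ℂ] H)),
      (∀ i, f i ∈ F) ∧ X.tr.norm2 (p - ∑ i, c i • f i) ≤ ε) ∧
    (∀ f ∈ F, ∀ ε : ℝ, 0 < ε → ∃ (n : ℕ) (ξ : Fin n → (H →L[ℂ] H)) (C : ℝ),
      (∀ i, ξ i ∈ P) ∧
      ∀ γ : Γ, ∃ κ : Fin n → (H →L[ℂ] H), (∀ i, κ i ∈ P₀) ∧ (∀ i, ‖κ i‖ ≤ C) ∧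
        X.tr.norm2 (X.σ γ f - ∑ i, κ i * ξ i) ≤ ε)

/-- The action `Γ ↷ A` is compact: the extension over the scalars is compact. -/
def IsCompactAction (X : CrossedProduct Γ H) : Prop :=
  IsCompactExt X (scalars H) (X.A : Set (H →L[ℂ] H))

/-- The `Γ`-invariant subalgebra `B ⊆ A` gives a mixing extension: for
`t, z ∈ A ⊖ B` one has `‖E_B(t σ_γ(z))‖₂ → 0` as `γ → ∞`. -/
def IsMixingExt (X : CrossedProduct Γ H) (B : Set (H →L[ℂ] H))
    (EB : CondExpOn H (X.M : Set (H →L[ℂ] H)) B X.tr) : Prop :=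
  ∀ t ∈ X.A, ∀ z ∈ X.A, EB.E t = 0 → EB.E z = 0 →
    Filter.Tendsto (fun γ : Γ => X.tr.norm2 (EB.E (t * X.σ γ z))) Filter.cofinite (nhds 0)

/-- A `*`-isomorphism from (the von Neumann algebra with underlying set) `M ⊆ B(H₁)`
onto `N ⊆ B(H₂)`, given as a globally defined map with all axioms imposed on `M`. -/
structure StarIsoOn {H₁ : Type} [NormedAddCommGroup H₁] [InnerProductSpace ℂ H₁]
    [CompleteSpace H₁] {H₂ : Type} [NormedAddCommGroup H₂] [InnerProductSpace ℂ H₂]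
    [CompleteSpace H₂] (M : Set (H₁ →L[ℂ] H₁)) (N : Set (H₂ →L[ℂ] H₂)) : Type where
  Θ : (H₁ →L[ℂ] H₁) → (H₂ →L[ℂ] H₂)
  mem : ∀ x ∈ M, Θ x ∈ N
  map_one : Θ 1 = 1
  map_add : ∀ x ∈ M, ∀ y ∈ M, Θ (x + y) = Θ x + Θ y
  map_smul : ∀ (c : ℂ), ∀ x ∈ M, Θ (c • x) = c • Θ x
  map_mul : ∀ x ∈ M, ∀ y ∈ M, Θ (x * y) = Θ x * Θ y
  map_star : ∀ x ∈ M, Θ (star x) = star (Θ x)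
  inj : ∀ x ∈ M, ∀ y ∈ M, Θ x = Θ y → x = y
  surj : ∀ y ∈ N, ∃ x ∈ M, Θ x = y

/-- `r` is the (Pimsner–Popa/Jones) index of the inclusion `N ⊆ M`, witnessed by a
finite Pimsner–Popa basis `m₁, …, m_k` with `E_N (m_i m_j*) = δ_{ij} p_i`,
`x = ∑ᵢ E_N(x mᵢ*) mᵢ` for `x ∈ M`, and `r = ∑ᵢ τ(pᵢ)`. -/
def HasPPIndex {Mamb : Set (H →L[ℂ] H)} (tr : TraceOn H Mamb)
    (M N : Set (H →L[ℂ] H)) (r : ℝ) : Prop :=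
  ∃ E : (H →L[ℂ] H) →ₗ[ℂ] (H →L[ℂ] H),
    (∀ x ∈ M, E x ∈ N) ∧ (∀ x ∈ N, E x = x) ∧
    (∀ a ∈ N, ∀ b ∈ N, ∀ x ∈ M, E (a * x * b) = a * E x * b) ∧
    (∀ x ∈ M, tr.τ (E x) = tr.τ x) ∧
    ∃ (k : ℕ) (m p : Fin k → (H →L[ℂ] H)),
      (∀ i, m i ∈ M) ∧ (∀ i, p i ∈ N ∧ star (p i) = p i ∧ p i * p i = p i) ∧
      (∀ i j, E (m i * star (m j)) = if i = j then p i else 0) ∧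
      (∀ x ∈ M, x = ∑ i, E (x * star (m i)) * m i) ∧
      r = (∑ i, tr.τ (p i)).re

/-- The inclusion `N ⊆ M` has finite (Pimsner–Popa/Jones) index. -/
def FiniteIndexIn {Mamb : Set (H →L[ℂ] H)} (tr : TraceOn H Mamb)
    (M N : Set (H →L[ℂ] H)) : Prop :=
  ∃ r : ℝ, HasPPIndex tr M N r

/-- `S` (a von Neumann algebra) is a factor: trivial center. -/
def IsFactorSet (S : Set (H →L[ℂ] H)) : Prop :=
  ∀ x ∈ S, (∀ y ∈ S, x * y = y * x) → ∃ c : ℂ, x = c • (1 : H →L[ℂ] H)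

/-- `S` is a II₁ factor (with respect to the trace `tr`): a factor whose
projections realize every trace value in `[0,1]`. -/
def IsII1On {Mamb : Set (H →L[ℂ] H)} (tr : TraceOn H Mamb) (S : Set (H →L[ℂ] H)) : Prop :=
  IsFactorSet S ∧ ∀ r : ℝ, 0 ≤ r → r ≤ 1 →
    ∃ p ∈ S, star p = p ∧ p * p = p ∧ tr.τ p = (r : ℂ)

def IsFinDimSet (S : Set (H →L[ℂ] H)) : Prop :=
  ∃ (n : ℕ) (v : Fin n → (H →L[ℂ] H)), (∀ i, v i ∈ S) ∧
    ∀ x ∈ S, ∃ c : Fin n → ℂ, x = ∑ i, c i • v i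

def IsStarSubalgSet (S : Set (H →L[ℂ] H)) : Prop :=
  (1 : H →L[ℂ] H) ∈ S ∧ (∀ x ∈ S, ∀ y ∈ S, x + y ∈ S) ∧ (∀ x ∈ S, ∀ y ∈ S, x * y ∈ S) ∧
    (∀ (c : ℂ), ∀ x ∈ S, c • x ∈ S) ∧ (∀ x ∈ S, star x ∈ S)

/-- `S` is approximately finite dimensional (with respect to `‖·‖₂`); by Connes'
theorem this is equivalent to amenability for (separable, tracial) von Neumann
algebras. -/
def IsAFD {Mamb : Set (H →L[ℂ] H)} (tr : TraceOn H Mamb) (S : Set (H →L[ℂ] H)) : Prop :=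
  ∃ Q : ℕ → Set (H →L[ℂ] H), (∀ n, Q n ⊆ S) ∧ (∀ n, Q n ⊆ Q (n + 1)) ∧
    (∀ n, IsFinDimSet (Q n)) ∧ (∀ n, IsStarSubalgSet (Q n)) ∧
    ∀ x ∈ S, ∀ ε : ℝ, 0 < ε → ∃ n, ∃ y ∈ Q n, tr.norm2 (x - y) ≤ ε

/-- `S` is diffuse: it has no minimal projections. -/
def IsDiffuseSet (S : Set (H →L[ℂ] H)) : Prop :=
  ∀ p, IsProjIn S p → p ≠ 0 →
    ∃ q, IsProjIn S q ∧ q ≠ 0 ∧ q ≠ p ∧ q * p = q ∧ p * q = q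

/-- The (trace-preserving) action of `Γ` on the subalgebra `Q` is transitive:
`Q` is spanned by finitely many orthogonal minimal projections summing to `1`
which are permuted transitively by `Γ`. -/
def IsTransitiveOn (X : CrossedProduct Γ H) (Q : Set (H →L[ℂ] H)) : Prop :=
  ∃ (n : ℕ) (e : Fin n → (H →L[ℂ] H)),
    (∀ i, e i ∈ Q ∧ star (e i) = e i ∧ e i * e i = e i) ∧
    (∀ i j, i ≠ j → e i * e j = 0) ∧ (∑ i, e i = 1) ∧
    (∀ q ∈ Q, ∃ c : Fin n → ℂ, q = ∑ i, c i • e i) ∧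
    (∀ i j, ∃ γ : Γ, X.σ γ (e i) = e j)

/-- An abelian von Neumann algebra `S` is completely atomic: every nonzero
projection dominates a minimal projection. -/
def IsCompletelyAtomic (S : Set (H →L[ℂ] H)) : Prop :=
  ∀ p, IsProjIn S p → p ≠ 0 →
    ∃ q, IsProjIn S q ∧ q ≠ 0 ∧ q * p = q ∧
      ∀ r, IsProjIn S r → r * q = r → r = 0 ∨ r = q

end CD

namespace CDP

open scoped InnerProductSpace ComplexConjugate

variable {H : Type} [NormedAddCommGroup H] [InnerProductSpace ℂ H] [CompleteSpace H]

/-- faithful positive trace (not nec. unital) on a von Neumann algebra -/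
structure FT (M : VonNeumannAlgebra H) : Type where
  τ : (H →L[ℂ] H) →ₗ[ℂ] ℂ
  tracial : ∀ x ∈ M, ∀ y ∈ M, τ (x * y) = τ (y * x)
  star_eq : ∀ x ∈ M, τ (star x) = starRingEnd ℂ (τ x)
  nonneg : ∀ x ∈ M, 0 ≤ (τ (star x * x)).re ∧ (τ (star x * x)).im = 0
  faithful : ∀ x ∈ M, τ (star x * x) = 0 → x = 0

/-- The algebra as a type. -/
abbrev Alg (M : VonNeumannAlgebra H) : Type := ↥M.toStarSubalgebra

variable {M : VonNeumannAlgebra H}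

/-- pre-Hilbert space -/
def Pre (_t : FT M) : Type := Alg M

instance (t : FT M) : AddCommGroup (Pre t) := inferInstanceAs (AddCommGroup (Alg M))
instance (t : FT M) : Module ℂ (Pre t) := inferInstanceAs (Module ℂ (Alg M))

theorem mem_alg (x : Alg M) : (x : H →L[ℂ] H) ∈ M := x.2

def toPre (t : FT M) : Alg M →ₗ[ℂ] Pre t := LinearMap.id

def ofPre (t : FT M) : Pre t →ₗ[ℂ] Alg M := LinearMap.id

@[reducible]
def preCore (t : FT M) : InnerProductSpace.Core ℂ (Pre t) where
  inner x y := t.τ (star (ofPre t x : H →L[ℂ] H) * (ofPre t y : H →L[ℂ] H))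
  conj_inner_symm x y := by
    rw [← t.star_eq _ (mul_mem (star_mem (mem_alg _)) (mem_alg _))]
    simp
  re_inner_nonneg x := (t.nonneg _ (mem_alg _)).1
  add_left x y z := by simp [add_mul]
  smul_left x y r := by simp
  definite x h := by
    have := t.faithful _ (mem_alg (ofPre t x)) h
    exact Subtype.ext this

instance (t : FT M) : NormedAddCommGroup (Pre t) := (preCore t).toNormedAddCommGroup
instance (t : FT M) : InnerProductSpace ℂ (Pre t) := InnerProductSpace.ofCore (preCore t).toCore

/-- the L2 space -/
def K (t : FT M) : Type := UniformSpace.Completion (Pre t)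

instance (t : FT M) : NormedAddCommGroup (K t) :=
  inferInstanceAs (NormedAddCommGroup (UniformSpace.Completion (Pre t)))
instance (t : FT M) : InnerProductSpace ℂ (K t) :=
  inferInstanceAs (InnerProductSpace ℂ (UniformSpace.Completion (Pre t)))
instance (t : FT M) : CompleteSpace (K t) :=
  inferInstanceAs (CompleteSpace (UniformSpace.Completion (Pre t)))

def hat (t : FT M) : Alg M →ₗ[ℂ] K t :=
  ((UniformSpace.Completion.toComplL (𝕜 := ℂ) (E := Pre t)).toLinearMap).comp (toPre t)

theorem hat_dense (t : FT M) : DenseRange (hat t) := by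
  exact UniformSpace.Completion.denseRange_coe (α := Pre t)

theorem inner_hat (t : FT M) (x y : Alg M) :
    ⟪hat t x, hat t y⟫_ℂ = t.τ (star (x : H →L[ℂ] H) * y) := by
  exact UniformSpace.Completion.inner_coe (𝕜 := ℂ) (toPre t x) (toPre t y)

theorem norm_hat_sq (t : FT M) (x : Alg M) :
    ‖hat t x‖ ^ 2 = (t.τ (star (x : H →L[ℂ] H) * x)).re := by
  have := inner_self_eq_norm_sq (𝕜 := ℂ) (hat t x)
  rw [← this, inner_hat]; rfl

theorem hat_eq_zero (t : FT M) (x : Alg M) : hat t x = 0 ↔ x = 0 := by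
  constructor
  · intro h
    have h2 := inner_hat t x x
    rw [h, inner_zero_left] at h2
    exact Subtype.ext (t.faithful _ (mem_alg x) h2.symm)
  · rintro rfl; simp

/-- two continuous maps agreeing on hats agree -/
theorem ext_hat (t : FT M) {E : Type*} [TopologicalSpace E] [T2Space E] {f g : K t → E}
    (hf : Continuous f) (hg : Continuous g) (h : ∀ x, f (hat t x) = g (hat t x)) (a : K t) :
    f a = g a := by
  have := (hat_dense t).equalizer hf hg (by funext x; exact h x)
  exact congrFun this a

theorem cfc_mem {x : H →L[ℂ] H} (f : ℝ → ℝ) (hM : x ∈ M) :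
    cfc f x ∈ M := by
  rw [← M.commutant_commutant, VonNeumannAlgebra.mem_commutant_iff]
  intro g hg
  have : Commute x g := (VonNeumannAlgebra.mem_commutant_iff.1 hg x hM)
  exact ((Commute.cfc_real this f).eq).symm

theorem one_mem' : (1 : H →L[ℂ] H) ∈ M := one_mem M.toStarSubalgebra

theorem smul_mem' {x : H →L[ℂ] H} (c : ℂ) (h : x ∈ M) : c • x ∈ M :=
  M.toStarSubalgebra.smul_mem h c

theorem exists_sqrt {x : H →L[ℂ] H} (hM : x ∈ M) (h : 0 ≤ x) :
    ∃ r ∈ M, IsSelfAdjoint r ∧ 0 ≤ r ∧ r * r = x := by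
  have hx : IsSelfAdjoint x := IsSelfAdjoint.of_nonneg h
  refine ⟨cfc Real.sqrt x, cfc_mem _ hM, cfc_predicate _ _, cfc_nonneg (fun _ _ => Real.sqrt_nonneg _), ?_⟩
  rw [← cfc_mul _ _ x]
  conv_rhs => rw [← cfc_id ℝ x]
  refine cfc_congr ?_
  intro y hy
  exact Real.mul_self_sqrt (spectrum_nonneg_of_nonneg h hy)

theorem exists_bound_sqrt {x : H →L[ℂ] H} (hM : x ∈ M) :
    ∃ r ∈ M, IsSelfAdjoint r ∧ r * r = ((‖x‖ ^ 2 : ℝ) : ℂ) • (1 : H →L[ℂ] H) - star x * x := by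
  have h : 0 ≤ ((‖x‖ ^ 2 : ℝ) : ℂ) • (1 : H →L[ℂ] H) - star x * x := by
    rw [sub_nonneg]
    have := CStarAlgebra.star_mul_le_algebraMap_norm_sq (a := x)
    rw [Algebra.algebraMap_eq_smul_one] at this
    convert this using 1
    ext v; simp only [ContinuousLinearMap.smul_apply]; exact (Complex.coe_smul _ _)
  obtain ⟨r, a, b, c, e⟩ := exists_sqrt (M := M) (sub_mem (smul_mem' _ one_mem') (mul_mem (star_mem hM) hM)) h
  exact ⟨r, a, b, e⟩

theorem norm_hat_mul_le (t : FT M) (x y : Alg M) : ‖hat t (x * y)‖ ≤ ‖(x : H →L[ℂ] H)‖ * ‖hat t y‖ := by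
  obtain ⟨r, hr, hsa, he⟩ := exists_bound_sqrt (mem_alg x)
  have h1 := (t.nonneg (r * y) (mul_mem hr (mem_alg y))).1
  have h2 : star (r * (y : H →L[ℂ] H)) * (r * y) = ((‖(x : H →L[ℂ] H)‖ ^ 2 : ℝ) : ℂ) • (star (y : H →L[ℂ] H) * y)
      - star ((x : H →L[ℂ] H) * y) * (x * y) := by
    rw [star_mul, hsa.star_eq]
    calc star (y : H →L[ℂ] H) * r * (r * y) = star (y : H →L[ℂ] H) * (r * r) * y := by noncomm_ring
      _ = _ := by rw [he, mul_sub, sub_mul]; simp [mul_assoc]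
  rw [h2, map_sub, map_smul, Complex.sub_re, smul_eq_mul, Complex.re_ofReal_mul] at h1
  rw [← abs_of_nonneg (norm_nonneg (hat t (x*y))), ← abs_of_nonneg (mul_nonneg (norm_nonneg (x : H →L[ℂ] H)) (norm_nonneg (hat t y)))]
  apply sq_le_sq.1
  rw [mul_pow, norm_hat_sq, norm_hat_sq]
  simpa using h1

theorem norm_hat_star (t : FT M) (x : Alg M) : ‖hat t (star x)‖ = ‖hat t x‖ := by
  have : ‖hat t (star x)‖ ^ 2 = ‖hat t x‖ ^ 2 := by
    rw [norm_hat_sq, norm_hat_sq, t.tracial _ (star_mem (mem_alg _)) _ (mem_alg _)]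
    simp
  exact (sq_eq_sq₀ (norm_nonneg _) (norm_nonneg _)).1 this

theorem norm_hat_mul_le' (t : FT M) (x y : Alg M) : ‖hat t (y * x)‖ ≤ ‖(x : H →L[ℂ] H)‖ * ‖hat t y‖ := by
  rw [← norm_hat_star, star_mul, ← norm_hat_star t y]
  refine (norm_hat_mul_le t _ _).trans ?_
  simp

def π (t : FT M) (x : Alg M) : K t →L[ℂ] K t :=
  ((hat t).comp (LinearMap.mulLeft ℂ x)).extendOfNorm (hat t)

theorem π_hat (t : FT M) (x y : Alg M) : π t x (hat t y) = hat t (x * y) :=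
  LinearMap.extendOfNorm_eq (hat_dense t) ⟨_, fun y => norm_hat_mul_le t x y⟩ y

theorem norm_π_le (t : FT M) (x : Alg M) (a : K t) : ‖π t x a‖ ≤ ‖(x : H →L[ℂ] H)‖ * ‖a‖ :=
  LinearMap.norm_extendOfNorm_apply_le (hat_dense t) _ (fun y => norm_hat_mul_le t x y) a

def ρ (t : FT M) (x : Alg M) : K t →L[ℂ] K t :=
  ((hat t).comp (LinearMap.mulRight ℂ x)).extendOfNorm (hat t)

theorem ρ_hat (t : FT M) (x y : Alg M) : ρ t x (hat t y) = hat t (y * x) :=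
  LinearMap.extendOfNorm_eq (hat_dense t) ⟨_, fun y => norm_hat_mul_le' t x y⟩ y

theorem norm_ρ_le (t : FT M) (x : Alg M) (a : K t) : ‖ρ t x a‖ ≤ ‖(x : H →L[ℂ] H)‖ * ‖a‖ :=
  LinearMap.norm_extendOfNorm_apply_le (hat_dense t) _ (fun y => norm_hat_mul_le' t x y) a

def starLM (M : VonNeumannAlgebra H) : Alg M →ₗ⋆[ℂ] Alg M where
  toFun := star
  map_add' := star_add
  map_smul' c x := star_smul c x

def J (t : FT M) : K t →L⋆[ℂ] K t :=
  ((hat t).comp (starLM M)).extendOfNorm (hat t)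

theorem J_hat (t : FT M) (y : Alg M) : J t (hat t y) = hat t (star y) :=
  LinearMap.extendOfNorm_eq (hat_dense t) ⟨1, fun y => by rw [one_mul]; exact (norm_hat_star t y).le⟩ y

theorem J_J (t : FT M) (a : K t) : J t (J t a) = a :=
  ext_hat t (f := fun a => J t (J t a)) (g := fun a => a) (by fun_prop) (by fun_prop) (fun x => by simp [J_hat]) a

theorem inner_J (t : FT M) (a b : K t) : ⟪J t a, J t b⟫_ℂ = ⟪b, a⟫_ℂ := by
  refine ext_hat t (f := fun a => ⟪J t a, J t b⟫_ℂ) (g := fun a => ⟪b, a⟫_ℂ) (by fun_prop) (by fun_prop) (fun x => ?_) a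
  refine ext_hat t (f := fun b => ⟪J t (hat t x), J t b⟫_ℂ) (g := fun b => ⟪b, hat t x⟫_ℂ) (by fun_prop) (by fun_prop) (fun y => ?_) b
  simp only [J_hat, inner_hat]
  rw [t.tracial _ (star_mem (mem_alg _)) _ (mem_alg _)]; simp

theorem π_mul (t : FT M) (x y : Alg M) (a : K t) : π t (x * y) a = π t x (π t y a) :=
  ext_hat t (f := fun a => π t (x * y) a) (g := fun a => π t x (π t y a)) (by fun_prop) (by fun_prop) (fun z => by simp [π_hat, mul_assoc]) a

theorem π_add (t : FT M) (x y : Alg M) (a : K t) : π t (x + y) a = π t x a + π t y a :=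
  ext_hat t (f := fun a => π t (x + y) a) (g := fun a => π t x a + π t y a) (by fun_prop) (by fun_prop) (fun z => by simp [π_hat, add_mul]) a

theorem π_sub (t : FT M) (x y : Alg M) (a : K t) : π t (x - y) a = π t x a - π t y a :=
  ext_hat t (f := fun a => π t (x - y) a) (g := fun a => π t x a - π t y a) (by fun_prop) (by fun_prop) (fun z => by simp [π_hat, sub_mul]) a

theorem π_smul (t : FT M) (c : ℂ) (y : Alg M) (a : K t) : π t (c • y) a = c • π t y a :=
  ext_hat t (f := fun a => π t (c • y) a) (g := fun a => (c • π t y) a) (by fun_prop) (ContinuousLinearMap.continuous _) (fun z => by simp [π_hat]) a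

theorem π_one (t : FT M) (a : K t) : π t 1 a = a :=
  ext_hat t (f := fun a => π t 1 a) (g := fun a => a) (by fun_prop) (by fun_prop) (fun z => by simp [π_hat]) a

theorem ρ_mul (t : FT M) (x y : Alg M) (a : K t) : ρ t (x * y) a = ρ t y (ρ t x a) :=
  ext_hat t (f := fun a => ρ t (x * y) a) (g := fun a => ρ t y (ρ t x a)) (by fun_prop) (by fun_prop) (fun z => by simp [ρ_hat, mul_assoc]) a

theorem ρ_one (t : FT M) (a : K t) : ρ t 1 a = a :=
  ext_hat t (f := fun a => ρ t 1 a) (g := fun a => a) (by fun_prop) (by fun_prop) (fun z => by simp [ρ_hat]) a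

theorem π_ρ (t : FT M) (x y : Alg M) (a : K t) : π t x (ρ t y a) = ρ t y (π t x a) :=
  ext_hat t (f := fun a => π t x (ρ t y a)) (g := fun a => ρ t y (π t x a)) (by fun_prop) (by fun_prop)
    (fun z => by simp [ρ_hat, π_hat, mul_assoc]) a

theorem J_π (t : FT M) (x : Alg M) (a : K t) : J t (π t x a) = ρ t (star x) (J t a) :=
  ext_hat t (f := fun a => J t (π t x a)) (g := fun a => ρ t (star x) (J t a)) (by fun_prop) (by fun_prop)
    (fun z => by simp [ρ_hat, π_hat, J_hat]) a

theorem J_ρ (t : FT M) (x : Alg M) (a : K t) : J t (ρ t x a) = π t (star x) (J t a) :=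
  ext_hat t (f := fun a => J t (ρ t x a)) (g := fun a => π t (star x) (J t a)) (by fun_prop) (by fun_prop)
    (fun z => by simp [ρ_hat, π_hat, J_hat]) a

theorem inner_π (t : FT M) (x : Alg M) (a b : K t) : ⟪π t x a, b⟫_ℂ = ⟪a, π t (star x) b⟫_ℂ := by
  refine ext_hat t (f := fun a => ⟪π t x a, b⟫_ℂ) (g := fun a => ⟪a, π t (star x) b⟫_ℂ) (by fun_prop) (by fun_prop) (fun y => ?_) a
  refine ext_hat t (f := fun b => ⟪π t x (hat t y), b⟫_ℂ) (g := fun b => ⟪hat t y, π t (star x) b⟫_ℂ) (by fun_prop) (by fun_prop) (fun z => ?_) b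
  simp only [π_hat, inner_hat]
  simp [mul_assoc]

theorem inner_ρ (t : FT M) (x : Alg M) (a b : K t) : ⟪ρ t x a, b⟫_ℂ = ⟪a, ρ t (star x) b⟫_ℂ := by
  rw [← inner_J, ← inner_J t (ρ t (star x) b) a, J_ρ, J_ρ, star_star, inner_π]
end CDP

namespace CDP

open scoped InnerProductSpace ComplexConjugate

variable {H : Type} [NormedAddCommGroup H] [InnerProductSpace ℂ H] [CompleteSpace H]
variable {M : VonNeumannAlgebra H}

def evalL (M : VonNeumannAlgebra H) (ζ : H) : Alg M →ₗ[ℂ] H where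
  toFun x := (x : H →L[ℂ] H) ζ
  map_add' x y := by simp
  map_smul' c x := by simp

/-- bounded vectors -/
def Bdd (t : FT M) (ζ : H) : Prop := ∃ C : ℝ, ∀ x : Alg M, ‖(x : H →L[ℂ] H) ζ‖ ≤ C * ‖hat t x‖

def T (t : FT M) (ζ : H) : K t →L[ℂ] H := (evalL M ζ).extendOfNorm (hat t)

theorem T_hat {t : FT M} {ζ : H} (h : Bdd t ζ) (x : Alg M) : T t ζ (hat t x) = (x : H →L[ℂ] H) ζ :=
  LinearMap.extendOfNorm_eq (f := evalL M ζ) (hat_dense t) h x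

theorem Bdd_zero (t : FT M) : Bdd t 0 := ⟨0, fun x => by simp⟩

theorem Bdd_add {t : FT M} {ζ η : H} (h : Bdd t ζ) (h' : Bdd t η) : Bdd t (ζ + η) := by
  obtain ⟨C, hC⟩ := h
  obtain ⟨C', hC'⟩ := h'
  refine ⟨C + C', fun x => ?_⟩
  rw [map_add, add_mul]
  exact (norm_add_le _ _).trans (add_le_add (hC x) (hC' x))

theorem Bdd_smul {t : FT M} {ζ : H} (c : ℂ) (h : Bdd t ζ) : Bdd t (c • ζ) := by
  obtain ⟨C, hC⟩ := h
  refine ⟨‖c‖ * C, fun x => ?_⟩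
  rw [map_smul, norm_smul, mul_assoc]
  exact mul_le_mul_of_nonneg_left (hC x) (norm_nonneg _)

theorem Bdd_alg {t : FT M} {ζ : H} (x : Alg M) (h : Bdd t ζ) : Bdd t ((x : H →L[ℂ] H) ζ) := by
  obtain ⟨C, hC⟩ := h
  refine ⟨|C| * ‖(x : H →L[ℂ] H)‖, fun y => ?_⟩
  have h1 := hC (y * x)
  have h2 := norm_hat_mul_le' t x y
  have h3 : ((y * x : Alg M) : H →L[ℂ] H) ζ = (y : H →L[ℂ] H) ((x : H →L[ℂ] H) ζ) := rfl
  rw [h3] at h1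
  calc _ ≤ C * ‖hat t (y * x)‖ := h1
    _ ≤ |C| * ‖hat t (y * x)‖ := mul_le_mul_of_nonneg_right (le_abs_self C) (norm_nonneg _)
    _ ≤ |C| * (‖(x : H →L[ℂ] H)‖ * ‖hat t y‖) := mul_le_mul_of_nonneg_left h2 (abs_nonneg C)
    _ = _ := by ring

theorem comm_apply {b : H →L[ℂ] H} (hb : b ∈ M.commutant) (x : Alg M) (ζ : H) :
    (x : H →L[ℂ] H) (b ζ) = b ((x : H →L[ℂ] H) ζ) := by
  have := VonNeumannAlgebra.mem_commutant_iff.1 hb x (mem_alg x)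
  exact congrArg (fun f : H →L[ℂ] H => f ζ) this

theorem Bdd_comm {t : FT M} {ζ : H} {b : H →L[ℂ] H} (hb : b ∈ M.commutant) (h : Bdd t ζ) : Bdd t (b ζ) := by
  obtain ⟨C, hC⟩ := h
  refine ⟨‖b‖ * C, fun x => ?_⟩
  rw [comm_apply hb, mul_assoc]
  exact (b.le_opNorm _).trans (mul_le_mul_of_nonneg_left (hC x) (norm_nonneg _))

theorem T_π {t : FT M} {ζ : H} (h : Bdd t ζ) (x : Alg M) (a : K t) :
    T t ζ (π t x a) = (x : H →L[ℂ] H) (T t ζ a) :=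
  ext_hat t (f := fun a => T t ζ (π t x a)) (g := fun a => (x : H →L[ℂ] H) (T t ζ a)) (by fun_prop) (by fun_prop)
    (fun y => by simp [π_hat, T_hat h]) a

theorem T_ρ {t : FT M} {ζ : H} (h : Bdd t ζ) (x : Alg M) (a : K t) :
    T t ζ (ρ t x a) = T t ((x : H →L[ℂ] H) ζ) a :=
  ext_hat t (f := fun a => T t ζ (ρ t x a)) (g := fun a => T t ((x : H →L[ℂ] H) ζ) a) (by fun_prop) (by fun_prop)
    (fun y => by simp [ρ_hat, T_hat h, T_hat (Bdd_alg x h)]) a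

theorem T_comm {t : FT M} {ζ : H} (h : Bdd t ζ) {b : H →L[ℂ] H} (hb : b ∈ M.commutant) (a : K t) :
    T t (b ζ) a = b (T t ζ a) :=
  ext_hat t (f := fun a => T t (b ζ) a) (g := fun a => b (T t ζ a)) (by fun_prop) (by fun_prop)
    (fun y => by simp only [T_hat h, T_hat (Bdd_comm hb h), comm_apply hb]) a

theorem T_add {t : FT M} {ζ η : H} (h : Bdd t ζ) (h' : Bdd t η) (a : K t) :
    T t (ζ + η) a = T t ζ a + T t η a :=
  ext_hat t (f := fun a => T t (ζ + η) a) (g := fun a => T t ζ a + T t η a) (by fun_prop) (by fun_prop)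
    (fun y => by simp [T_hat h, T_hat h', T_hat (Bdd_add h h')]) a

theorem T_smul {t : FT M} {ζ : H} (c : ℂ) (h : Bdd t ζ) (a : K t) :
    T t (c • ζ) a = c • T t ζ a :=
  ext_hat t (f := fun a => T t (c • ζ) a) (g := fun a => (c • T t ζ) a) (by fun_prop) (ContinuousLinearMap.continuous _)
    (fun y => by simp [T_hat h, T_hat (Bdd_smul c h)]) a

/-- the singular subspace -/
def S (t : FT M) : Submodule ℂ (K t) where
  carrier := {a | ∀ ζ, Bdd t ζ → T t ζ a = 0}
  add_mem' ha hb ζ hζ := by rw [map_add, ha ζ hζ, hb ζ hζ, add_zero]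
  zero_mem' ζ _ := map_zero _
  smul_mem' c a ha ζ hζ := by rw [map_smul, ha ζ hζ, smul_zero]

theorem mem_S {t : FT M} {a : K t} : a ∈ S t ↔ ∀ ζ, Bdd t ζ → T t ζ a = 0 := Iff.rfl

theorem S_closed (t : FT M) : IsClosed (S t : Set (K t)) := by
  have : (S t : Set (K t)) = ⋂ ζ, ⋂ (_ : Bdd t ζ), {a | T t ζ a = 0} := by
    ext a; simp [mem_S]
  rw [this]
  refine isClosed_iInter fun ζ => isClosed_iInter fun _ => isClosed_eq (by fun_prop) continuous_const

instance (t : FT M) : CompleteSpace (S t) := (S_closed t).completeSpace_coe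

theorem S_π {t : FT M} {a : K t} (h : a ∈ S t) (x : Alg M) : π t x a ∈ S t := fun ζ hζ => by
  rw [T_π hζ, h ζ hζ, map_zero]

theorem S_ρ {t : FT M} {a : K t} (h : a ∈ S t) (x : Alg M) : ρ t x a ∈ S t := fun ζ hζ => by
  rw [T_ρ hζ, h _ (Bdd_alg x hζ)]

/-- the singular vector -/
def sv (t : FT M) : K t := (S t).starProjection (hat t 1)

theorem sv_mem (t : FT M) : sv t ∈ S t := Submodule.starProjection_apply_mem _ _

theorem sv_inner (t : FT M) {a : K t} (h : a ∈ S t) : ⟪hat t 1 - sv t, a⟫_ℂ = 0 :=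
  Submodule.starProjection_inner_eq_zero _ _ h

theorem π_sv (t : FT M) (x : Alg M) : (S t).starProjection (hat t x) = π t x (sv t) := by
  apply Submodule.eq_starProjection_of_mem_of_inner_eq_zero
  · exact S_π (sv_mem t) x
  · intro w hw
    have : hat t x - π t x (sv t) = π t x (hat t 1 - sv t) := by rw [map_sub, π_hat, mul_one]
    rw [this, inner_π]
    exact sv_inner t (S_π hw _)

theorem ρ_sv' (t : FT M) (x : Alg M) : (S t).starProjection (hat t x) = ρ t x (sv t) := by
  apply Submodule.eq_starProjection_of_mem_of_inner_eq_zero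
  · exact S_ρ (sv_mem t) x
  · intro w hw
    have : hat t x - ρ t x (sv t) = ρ t x (hat t 1 - sv t) := by rw [map_sub, ρ_hat, one_mul]
    rw [this, inner_ρ]
    exact sv_inner t (S_ρ hw _)

theorem ρ_sv (t : FT M) (x : Alg M) : ρ t x (sv t) = π t x (sv t) := by
  rw [← ρ_sv', π_sv]

theorem norm_π_star_sv (t : FT M) (x : Alg M) : ‖π t (star x) (sv t)‖ = ‖π t x (sv t)‖ := by
  have : ⟪π t (star x) (sv t), π t (star x) (sv t)⟫_ℂ = ⟪π t x (sv t), π t x (sv t)⟫_ℂ := by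
    rw [inner_π, star_star, ← ρ_sv t (star x), π_ρ, ← star_star x, ← inner_ρ, star_star, ρ_sv]
  have h2 : ‖π t (star x) (sv t)‖ ^ 2 = ‖π t x (sv t)‖ ^ 2 := by
    rw [← inner_self_eq_norm_sq (𝕜 := ℂ), ← inner_self_eq_norm_sq (𝕜 := ℂ), this]
  exact (sq_eq_sq₀ (norm_nonneg _) (norm_nonneg _)).1 h2

theorem norm_π_sub_sv (t : FT M) (x : Alg M) : ‖π t x (sv t) - sv t‖ ≤ ‖hat t x - sv t‖ := by
  have h : sv t = (S t).starProjection (sv t) := (Submodule.starProjection_eq_self_iff.2 (sv_mem t)).symm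
  calc ‖π t x (sv t) - sv t‖ = ‖(S t).starProjection (hat t x - sv t)‖ := by
        rw [map_sub, π_sv, ← h]
    _ ≤ ‖hat t x - sv t‖ := by
      refine ((S t).starProjection.le_opNorm _).trans ?_
      exact (mul_le_mul_of_nonneg_right (Submodule.starProjection_norm_le _) (norm_nonneg _)).trans (one_mul _).le

/-- graph -/
def graphL (t : FT M) (ζ : H) : Alg M →ₗ[ℂ] WithLp 2 (K t × H) :=
  ((WithLp.linearEquiv 2 ℂ (K t × H)).symm.toLinearMap).comp ((hat t).prod (evalL M ζ))

theorem graphL_apply (t : FT M) (ζ : H) (x : Alg M) :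
    graphL t ζ x = WithLp.toLp 2 (hat t x, (x : H →L[ℂ] H) ζ) := rfl

theorem mapL_aux (t : FT M) (x : Alg M) : Continuous (fun v : WithLp 2 (K t × H) =>
    (WithLp.toLp 2 (π t x v.fst, (x : H →L[ℂ] H) v.snd) : WithLp 2 (K t × H))) := by
  fun_prop

theorem exists_approx (t : FT M) (ζ : H) {ε : ℝ} (hε : 0 < ε) :
    ∃ x : Alg M, ‖hat t x - sv t‖ < ε ∧ ‖(x : H →L[ℂ] H) ζ‖ < ε := by
  set G : Submodule ℂ (WithLp 2 (K t × H)) := (LinearMap.range (graphL t ζ)).topologicalClosure with hG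
  have hGc : IsClosed (G : Set (WithLp 2 (K t × H))) := Submodule.isClosed_topologicalClosure _
  have : CompleteSpace G := hGc.completeSpace_coe
  have hgr : ∀ x, graphL t ζ x ∈ G := fun x => Submodule.le_topologicalClosure _ ⟨x, rfl⟩
  have hinv : ∀ (x : Alg M) (v : WithLp 2 (K t × H)), v ∈ G →
      (WithLp.toLp 2 (π t x v.fst, (x : H →L[ℂ] H) v.snd) : WithLp 2 (K t × H)) ∈ G := by
    intro x v hv
    have hcl : IsClosed ((fun v : WithLp 2 (K t × H) =>
      (WithLp.toLp 2 (π t x v.fst, (x : H →L[ℂ] H) v.snd) : WithLp 2 (K t × H))) ⁻¹' (G : Set _)) :=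
      hGc.preimage (mapL_aux t x)
    have : closure (LinearMap.range (graphL t ζ) : Set (WithLp 2 (K t × H))) ⊆ _ := closure_minimal (t := ((fun v : WithLp 2 (K t × H) =>
      (WithLp.toLp 2 (π t x v.fst, (x : H →L[ℂ] H) v.snd) : WithLp 2 (K t × H))) ⁻¹' (G : Set _))) (by
        rintro _ ⟨y, rfl⟩
        have := hgr (x * y)
        simpa [graphL_apply, π_hat] using this) hcl
    exact this hv
  set q := G.starProjection with hq
  let B : K t →L[ℂ] H := (WithLp.sndL 2 ℂ (K t) H).comp (q.comp
    (((WithLp.prodContinuousLinearEquiv 2 ℂ (K t) H).symm : (K t × H) →L[ℂ] WithLp 2 (K t × H)).comp (ContinuousLinearMap.inl ℂ (K t) H)))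
  have hB : ∀ a, B a = (q (WithLp.toLp 2 (a, 0))).snd := fun a => rfl
  have hBπ : ∀ (x : Alg M) a, B (π t x a) = (x : H →L[ℂ] H) (B a) := by
    intro x a
    rw [hB, hB]
    have : q (WithLp.toLp 2 (π t x a, 0)) = WithLp.toLp 2 (π t x (q (WithLp.toLp 2 (a, 0))).fst, (x : H →L[ℂ] H) (q (WithLp.toLp 2 (a, 0))).snd) := by
      apply Submodule.eq_starProjection_of_mem_of_inner_eq_zero
      · exact hinv x _ (Submodule.starProjection_apply_mem _ _)
      · intro w hw
        have h1 := Submodule.starProjection_inner_eq_zero (K := G) (WithLp.toLp 2 (a, (0 : H))) _ (hinv (star x) w hw)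
        rw [← hq] at h1
        simp only [WithLp.prod_inner_apply, inner_sub_left] at h1 ⊢
        rw [inner_π, inner_π]
        have h2 : ∀ v w : H, ⟪(x : H →L[ℂ] H) v, w⟫_ℂ = ⟪v, ((star x : Alg M) : H →L[ℂ] H) w⟫_ℂ := by
          intro v w
          rw [← ContinuousLinearMap.adjoint_inner_right]; rfl
        rw [h2]
        simpa using h1
    rw [this]
    rfl
  have hη : Bdd t (B (hat t 1)) := ⟨‖B‖, fun x => by
    rw [← hBπ, π_hat, mul_one]; exact B.le_opNorm _⟩
  have hBT : ∀ a, B a = T t (B (hat t 1)) a := fun a =>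
    ext_hat t (f := fun a => B a) (g := fun a => T t (B (hat t 1)) a) (by fun_prop) (by fun_prop)
      (fun x => by simp only [T_hat hη]; rw [← hBπ, π_hat, mul_one]) a
  have hBs : B (sv t) = 0 := by rw [hBT]; exact sv_mem t _ hη
  have hs : (q (WithLp.toLp 2 (sv t, 0))).fst = sv t := by
    have : ∀ x, ⟪sv t - (q (WithLp.toLp 2 (sv t, 0))).fst, hat t x⟫_ℂ = 0 := by
      intro x
      have h1 := Submodule.starProjection_inner_eq_zero (K := G) (WithLp.toLp 2 (sv t, (0 : H))) _ (hgr x)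
      rw [← hq] at h1
      have h3 : (q (WithLp.toLp 2 (sv t, 0))).snd = 0 := hBs
      rw [graphL_apply, WithLp.prod_inner_apply] at h1
      have h4 : (WithLp.toLp 2 (sv t, (0:H)) - q (WithLp.toLp 2 (sv t, 0))).snd = 0 := by
        rw [WithLp.sub_snd, h3]; simp
      have h5 : (WithLp.ofLp (WithLp.toLp 2 (sv t, (0:H)) - q (WithLp.toLp 2 (sv t, 0)))).2 = 0 := h4
      rw [h5, inner_zero_left, add_zero] at h1
      exact h1
    have h0 : sv t - (q (WithLp.toLp 2 (sv t, 0))).fst = 0 := by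
      rw [← inner_self_eq_zero (𝕜 := ℂ)]
      exact ext_hat t (f := fun a => ⟪sv t - (q (WithLp.toLp 2 (sv t, 0))).fst, a⟫_ℂ) (g := fun _ => 0) (by fun_prop) (by fun_prop) this _
    exact (sub_eq_zero.1 h0).symm
  have hmem : (WithLp.toLp 2 (sv t, (0:H)) : WithLp 2 (K t × H)) ∈ G := by
    have h1 : q (WithLp.toLp 2 (sv t, 0)) = WithLp.toLp 2 (sv t, 0) := by
      have h3 : (q (WithLp.toLp 2 (sv t, 0))).snd = 0 := hBs
      apply (WithLp.equiv 2 _).injective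
      exact Prod.ext hs h3
    rw [← h1]
    exact Submodule.starProjection_apply_mem _ _
  have hmem' : (WithLp.toLp 2 (sv t, (0:H)) : WithLp 2 (K t × H)) ∈ closure (LinearMap.range (graphL t ζ) : Set (WithLp 2 (K t × H))) := hmem
  obtain ⟨_, ⟨x, rfl⟩, hx⟩ := Metric.mem_closure_iff.1 hmem' ε hε
  rw [dist_comm, dist_eq_norm] at hx
  refine ⟨x, lt_of_le_of_lt ?_ hx, lt_of_le_of_lt ?_ hx⟩
  · have := WithLp.norm_fst_le (p := 2) (K t) (graphL t ζ x - WithLp.toLp 2 (sv t, (0:H)))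
    exact this
  · have := WithLp.norm_snd_le (p := 2) (K t) (graphL t ζ x - WithLp.toLp 2 (sv t, (0:H)))
    simpa [graphL_apply] using this

end CDP

namespace CDP

open scoped InnerProductSpace ComplexConjugate
open Filter Topology

variable {H : Type} [NormedAddCommGroup H] [InnerProductSpace ℂ H] [CompleteSpace H]
variable {M : VonNeumannAlgebra H}

theorem alg_star_apply (x : H →L[ℂ] H) (v w : H) : ⟪x v, w⟫_ℂ = ⟪v, star x w⟫_ℂ := by
  rw [ContinuousLinearMap.star_eq_adjoint, ContinuousLinearMap.adjoint_inner_right]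

theorem re_inner_nonneg {h : H →L[ℂ] H} (hh : 0 ≤ h) (v : H) : 0 ≤ (⟪h v, v⟫_ℂ).re :=
  ((ContinuousLinearMap.nonneg_iff_isPositive h).1 hh).re_inner_nonneg_left v

/-- strong limits of elements of M are in M -/
theorem exists_lim {T : ℕ → H →L[ℂ] H} (hM : ∀ n, T n ∈ M) (hT : ∀ v, CauchySeq fun n => T n v) :
    ∃ a ∈ M, ∀ v, Tendsto (fun n => T n v) atTop (𝓝 (a v)) := by
  choose f hf using fun v => cauchySeq_tendsto_of_complete (hT v)
  let a := continuousLinearMapOfTendsto T (f := f) (tendsto_pi_nhds.2 hf)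
  have ha : ∀ v, Tendsto (fun n => T n v) atTop (𝓝 (a v)) := hf
  refine ⟨a, ?_, ha⟩
  rw [← M.commutant_commutant, VonNeumannAlgebra.mem_commutant_iff]
  intro g hg
  ext v
  have h1 : Tendsto (fun n => T n (g v)) atTop (𝓝 (a (g v))) := ha (g v)
  have h2 : Tendsto (fun n => g (T n v)) atTop (𝓝 (g (a v))) := (g.continuous.tendsto _).comp (ha v)
  have h3 : (fun n => T n (g v)) = fun n => g (T n v) := by
    funext n
    exact comm_apply hg ⟨T n, hM n⟩ v
  rw [h3] at h1
  exact tendsto_nhds_unique h2 h1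

theorem norm_apply_sq_le {h : H →L[ℂ] H} (hh : 0 ≤ h) (v : H) : ‖h v‖ ^ 2 ≤ ‖h‖ * (⟪h v, v⟫_ℂ).re := by
  set r := cfc Real.sqrt h with hr
  have hsa : IsSelfAdjoint r := cfc_predicate _ _
  have hx : IsSelfAdjoint h := IsSelfAdjoint.of_nonneg hh
  have hrr : r * r = h := by
    rw [← cfc_mul _ _ h]
    conv_rhs => rw [← cfc_id ℝ h]
    refine cfc_congr ?_
    intro y hy
    exact Real.mul_self_sqrt (spectrum_nonneg_of_nonneg hh hy)
  have h1 : ∀ w, r (r w) = h w := fun w => congrArg (fun f : H →L[ℂ] H => f w) hrr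
  have h2 : (⟪h v, v⟫_ℂ).re = ‖r v‖ ^ 2 := by
    rw [← h1, alg_star_apply, hsa.star_eq]
    exact inner_self_eq_norm_sq (𝕜 := ℂ) _
  have h3 : ‖h‖ = ‖r‖ ^ 2 := by
    rw [← hrr, sq]
    have := CStarRing.norm_star_mul_self (x := r)
    rwa [hsa.star_eq] at this
  rw [h2, h3, ← h1, ← mul_pow]
  exact pow_le_pow_left₀ (norm_nonneg _) (r.le_opNorm _) 2

theorem exists_antitone_lim {T : ℕ → H →L[ℂ] H} (hM : ∀ n, T n ∈ M) (hT : ∀ n, T (n + 1) ≤ T n)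
    (h0 : ∀ n, 0 ≤ T n) (h1 : ∀ n, ‖T n‖ ≤ 1) :
    ∃ a ∈ M, 0 ≤ a ∧ (∀ n, a ≤ T n) ∧ ∀ v, Tendsto (fun n => T n v) atTop (𝓝 (a v)) := by
  have hanti : Antitone T := antitone_nat_of_succ_le hT
  have key : ∀ v, CauchySeq fun n => T n v := by
    intro v
    have hre : Antitone fun n => (⟪T n v, v⟫_ℂ).re := by
      intro n m hnm
      have := re_inner_nonneg (sub_nonneg.2 (hanti hnm)) v
      rw [sub_apply, inner_sub_left, Complex.sub_re] at this
      linarith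
    have hc : CauchySeq fun n => (⟪T n v, v⟫_ℂ).re := by
      refine (tendsto_atTop_ciInf hre ⟨0, ?_⟩).cauchySeq
      rintro _ ⟨n, rfl⟩
      exact re_inner_nonneg (h0 n) v
    rw [Metric.cauchySeq_iff'] at hc ⊢
    intro ε hε
    obtain ⟨N, hN⟩ := hc (ε ^ 2 / 2) (by positivity)
    refine ⟨N, fun n hn => ?_⟩
    have h2 := hN n hn
    rw [Real.dist_eq, abs_lt] at h2
    have h3 := norm_apply_sq_le (sub_nonneg.2 (hanti hn)) v
    have h4 : ‖T N - T n‖ ≤ 2 := (norm_sub_le _ _).trans (by linarith [h1 N, h1 n])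
    rw [sub_apply, inner_sub_left, Complex.sub_re] at h3
    have h5 : 0 ≤ (⟪T N v, v⟫_ℂ).re - (⟪T n v, v⟫_ℂ).re := sub_nonneg.2 (hre hn)
    rw [dist_eq_norm, norm_sub_rev]
    have h6 : ‖T N v - T n v‖ ^ 2 < ε ^ 2 := by
      nlinarith
    exact lt_of_pow_lt_pow_left₀ 2 hε.le h6
  obtain ⟨a, ha, hlim⟩ := exists_lim hM key
  have pos_lim : ∀ (U : ℕ → H →L[ℂ] H) (b : H →L[ℂ] H) , (∀ᶠ n in atTop, 0 ≤ U n) →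
      (∀ v, Tendsto (fun n => U n v) atTop (𝓝 (b v))) → 0 ≤ b := by
    intro U b hU hb
    rw [ContinuousLinearMap.nonneg_iff_isPositive, ContinuousLinearMap.isPositive_iff_complex]
    intro v
    have h1 : Tendsto (fun n => ⟪U n v, v⟫_ℂ) atTop (𝓝 ⟪b v, v⟫_ℂ) := (hb v).inner tendsto_const_nhds
    have hcl : IsClosed {z : ℂ | ((z.re : ℝ) : ℂ) = z ∧ 0 ≤ z.re} :=
      (isClosed_eq (Complex.continuous_ofReal.comp Complex.continuous_re) continuous_id).inter
        (isClosed_le continuous_const Complex.continuous_re)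
    refine hcl.mem_of_tendsto h1 ?_
    filter_upwards [hU] with n hn
    rw [ContinuousLinearMap.nonneg_iff_isPositive, ContinuousLinearMap.isPositive_iff_complex] at hn
    exact hn v
  refine ⟨a, ha, pos_lim T a (Eventually.of_forall h0) hlim, fun n => ?_, hlim⟩
  rw [← sub_nonneg]
  refine pos_lim (fun m => T n - T m) _ ?_ (fun v => ?_)
  · filter_upwards [eventually_ge_atTop n] with m hm
    exact sub_nonneg.2 (hanti hm)
  · exact tendsto_const_nhds.sub (hlim v)

theorem π_sv_sub (t : FT M) (x : Alg M) : ‖π t (star x) (sv t) - sv t‖ ≤ ‖hat t x - sv t‖ := by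
  have h1 := norm_π_star_sv t (x - 1)
  rw [star_sub, star_one, π_sub, π_sub, π_one] at h1
  rw [h1]
  exact norm_π_sub_sv t x

theorem exists_small (t : FT M) (ζ : H) {ε : ℝ} (hε : 0 < ε) :
    ∃ e : Alg M, star (e : H →L[ℂ] H) = e ∧ ‖(e : H →L[ℂ] H)‖ ≤ 1 ∧ (e : H →L[ℂ] H) * e ≤ 1 ∧
      ‖π t e (sv t)‖ < ε ∧ ‖(e : H →L[ℂ] H) ζ - ζ‖ < ε := by
  set m : ℝ := 2 * ‖sv t‖ / ε + 1 with hm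
  have hm1 : 1 ≤ m := by rw [hm]; have : 0 ≤ 2 * ‖sv t‖ / ε := by positivity
                         linarith
  have hm0 : 0 < m := by linarith
  have hms : ‖sv t‖ < m * (ε / 2) := by
    rw [hm]; field_simp; linarith
  obtain ⟨x, hx1, hx2⟩ := exists_approx t ζ (ε := ε / (2 * m)) (by positivity)
  set h : H →L[ℂ] H := star (x : H →L[ℂ] H) * x with hh
  have hh0 : 0 ≤ h := star_mul_self_nonneg _
  have hsa : IsSelfAdjoint h := IsSelfAdjoint.of_nonneg hh0
  have hspec : ∀ y ∈ spectrum ℝ h, 0 ≤ y := fun y hy => spectrum_nonneg_of_nonneg hh0 hy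
  have hpos : ∀ y ∈ spectrum ℝ h, 0 < 1 + m ^ 2 * y := fun y hy => by have := hspec y hy; positivity
  set f : ℝ → ℝ := fun y => (1 + m ^ 2 * y)⁻¹ with hf
  have hfc : ContinuousOn f (spectrum ℝ h) := by
    refine ContinuousOn.inv₀ (by fun_prop) (fun y hy => (hpos y hy).ne')
  set e := cfc f h with he
  have heM : e ∈ M := cfc_mem f (mul_mem (star_mem (mem_alg x)) (mem_alg x))
  have hesa : star e = e := (cfc_predicate f h : IsSelfAdjoint e).star_eq
  have hf1 : ∀ y ∈ spectrum ℝ h, f y ≤ 1 := fun y hy => by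
    have := hspec y hy
    exact inv_le_one_of_one_le₀ (by nlinarith [sq_nonneg m, mul_nonneg (sq_nonneg m) this])
  have hf0 : ∀ y ∈ spectrum ℝ h, 0 ≤ f y := fun y hy => (inv_pos.2 (hpos y hy)).le
  have hen : ‖e‖ ≤ 1 := norm_cfc_le zero_le_one fun y hy => by
    rw [Real.norm_eq_abs, abs_of_nonneg (hf0 y hy)]; exact hf1 y hy
  have hee : e * e ≤ 1 := by
    rw [he, ← cfc_mul f f h]
    refine cfc_le_one _ _ fun y hy => ?_
    nlinarith [hf1 y hy, hf0 y hy]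
  have hid : e + ((m ^ 2 : ℝ)) • (e * h) = 1 := by
    have h1 : e * h = cfc (fun y => f y * y) h := by
      rw [cfc_mul f (fun y => y) h, cfc_id' ℝ h]
    rw [h1, ← cfc_smul .., he, ← cfc_add .., ← cfc_one ℝ h]
    refine cfc_congr fun y hy => ?_
    have := (hpos y hy).ne'
    simp only [hf, smul_eq_mul, Pi.one_apply]
    field_simp
  have hex : ‖e * star (x : H →L[ℂ] H)‖ ≤ 1 / m := by
    have h1 : ‖e * star (x : H →L[ℂ] H)‖ * ‖e * star (x : H →L[ℂ] H)‖ ≤ (1 / m) * (1 / m) := by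
      rw [← CStarRing.norm_self_mul_star, star_mul, star_star, hesa]
      have : e * star (x : H →L[ℂ] H) * (x * e) = cfc (fun y => f y * y * f y) h := by
        rw [cfc_mul (fun y => f y * y) f h, cfc_mul f (fun y => y) h, cfc_id' ℝ h, ← he, hh]
        noncomm_ring
      rw [this]
      refine norm_cfc_le (by positivity) fun y hy => ?_
      have h0 := hspec y hy
      have hp := hpos y hy
      rw [Real.norm_eq_abs, abs_of_nonneg (by have := hf0 y hy; positivity)]
      simp only [hf]
      rw [inv_mul_eq_div, div_mul_eq_mul_div, ← div_eq_mul_inv, div_div, div_mul_div_comm, one_mul, div_le_div_iff₀ (by positivity) (by positivity)]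
      nlinarith [mul_nonneg (sq_nonneg m) h0, sq_nonneg (m ^ 2 * y)]
    exact abs_le_of_sq_le_sq' (by nlinarith) (by positivity) |>.2
  refine ⟨⟨e, heM⟩, hesa, hen, hee, ?_, ?_⟩
  · have h1 : π t ⟨e, heM⟩ (sv t) = π t (⟨e, heM⟩ * star x) (sv t) - π t ⟨e, heM⟩ (π t (star x) (sv t) - sv t) := by
      rw [map_sub, π_mul]; abel
    rw [h1]
    refine (norm_sub_le _ _).trans_lt ?_
    have h2 := norm_π_le t (⟨e, heM⟩ * star x) (sv t)
    have h3 := norm_π_le t ⟨e, heM⟩ (π t (star x) (sv t) - sv t)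
    have h4 := π_sv_sub t x
    have h5 : ‖((⟨e, heM⟩ * star x : Alg M) : H →L[ℂ] H)‖ ≤ 1 / m := hex
    have h6 : ‖π t (⟨e, heM⟩ * star x) (sv t)‖ < ε / 2 := by
      refine h2.trans_lt ((mul_le_mul_of_nonneg_right h5 (norm_nonneg _)).trans_lt ?_)
      rw [one_div, inv_mul_lt_iff₀ hm0]; exact hms
    have h7 : ‖π t ⟨e, heM⟩ (π t (star x) (sv t) - sv t)‖ ≤ ε / 2 := by
      refine h3.trans ?_
      have h8 : ‖((⟨e, heM⟩ : Alg M) : H →L[ℂ] H)‖ ≤ 1 := hen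
      have h9 : ε / (2 * m) ≤ ε / 2 := by
        apply div_le_div_of_nonneg_left hε.le (by norm_num); linarith
      calc _ ≤ 1 * ‖π t (star x) (sv t) - sv t‖ := mul_le_mul_of_nonneg_right h8 (norm_nonneg _)
        _ ≤ _ := by linarith
    linarith
  · have h1 : e ζ - ζ = - ((m ^ 2 : ℝ) • (e * star (x : H →L[ℂ] H)) ((x : H →L[ℂ] H) ζ)) := by
      have := congrArg (fun f : H →L[ℂ] H => f ζ) hid
      simp only [add_apply, smul_apply] at this
      have h2 : (1 : H →L[ℂ] H) ζ = ζ := rfl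
      rw [h2] at this
      nth_rewrite 2 [← this]
      rw [sub_add_cancel_left]
      rfl
    change ‖e ζ - ζ‖ < ε
    rw [h1, norm_neg, norm_smul, Real.norm_eq_abs, abs_of_pos (by positivity)]
    have h2 := ContinuousLinearMap.le_opNorm (e * star (x : H →L[ℂ] H)) ((x : H →L[ℂ] H) ζ)
    calc m ^ 2 * ‖(e * star (x : H →L[ℂ] H)) ((x : H →L[ℂ] H) ζ)‖ ≤ m ^ 2 * ((1 / m) * (ε / (2 * m))) := by
          gcongr
          exact h2.trans (mul_le_mul hex hx2.le (norm_nonneg _) (by positivity))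
      _ = ε / 2 := by field_simp
      _ < ε := by linarith

theorem inner_sv_sq (t : FT M) (r : Alg M) (hr : star r = r) :
    (⟪sv t, π t (r * r) (sv t)⟫_ℂ).re = ‖π t r (sv t)‖ ^ 2 := by
  have := inner_π t r (sv t) (π t r (sv t))
  rw [hr] at this
  rw [π_mul, ← this]
  exact inner_self_eq_norm_sq (𝕜 := ℂ) (π t r (sv t))

theorem norm_π_sv_sq (t : FT M) (r : Alg M) :
    ‖π t r (sv t)‖ ^ 2 = (⟪sv t, π t (star r * r) (sv t)⟫_ℂ).re := by
  have := inner_π t r (sv t) (π t r (sv t))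
  rw [π_mul, ← this]
  exact (inner_self_eq_norm_sq (𝕜 := ℂ) (π t r (sv t))).symm

theorem exists_ideal_elem (t : FT M) (ζ : H) (hζ : ζ ≠ 0) :
    ∃ a : Alg M, π t a (sv t) = 0 ∧ (a : H →L[ℂ] H) ζ ≠ 0 := by
  have hn : 0 < ‖ζ‖ := norm_pos_iff.2 hζ
  set ε : ℕ → ℝ := fun n => min (‖ζ‖ / 2 ^ (n + 2)) (1 / ((n : ℝ) + 1)) with hεd
  have hε : ∀ n, 0 < ε n := fun n => lt_min (by positivity) (by positivity)
  choose e he1 he2 he3 he4 he5 using fun (v : H) (n : ℕ) => exists_small t v (hε n)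
  let U : ℕ → Alg M := fun n => Nat.rec (motive := fun _ => Alg M) 1 (fun n u => e (Subtype.val u ζ) n * u) n
  have U0 : U 0 = 1 := rfl
  have US : ∀ n, U (n + 1) = e ((U n : H →L[ℂ] H) ζ) n * U n := fun n => rfl
  clear_value U
  have Unorm : ∀ n, ‖(U n : H →L[ℂ] H)‖ ≤ 1 := by
    intro n
    induction n with
    | zero => rw [U0]; exact ContinuousLinearMap.norm_id_le
    | succ n ih =>
      rw [US]
      refine (norm_mul_le _ _).trans ?_
      exact mul_le_one₀ (he2 _ _) (norm_nonneg _) ih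
  have Uζ : ∀ n, ‖ζ‖ * (1 / 2 + 1 / 2 ^ (n + 1)) ≤ ‖(U n : H →L[ℂ] H) ζ‖ := by
    intro n
    induction n with
    | zero => rw [U0]; change _ ≤ ‖ζ‖; norm_num
    | succ n ih =>
      have h1 : ((U (n + 1) : Alg M) : H →L[ℂ] H) ζ = (e ((U n : H →L[ℂ] H) ζ) n : H →L[ℂ] H) ((U n : H →L[ℂ] H) ζ) := by rw [US]; rfl
      have h2 := he5 ((U n : H →L[ℂ] H) ζ) n
      have h3 : ε n ≤ ‖ζ‖ / 2 ^ (n + 2) := min_le_left _ _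
      rw [← h1] at h2
      have h4 := norm_sub_norm_le ((U n : H →L[ℂ] H) ζ) ((U (n + 1) : H →L[ℂ] H) ζ)
      rw [norm_sub_rev] at h4
      have h5 : ‖ζ‖ * (1 / 2 + 1 / 2 ^ (n + 1)) - ‖ζ‖ / 2 ^ (n + 2) = ‖ζ‖ * (1 / 2 + 1 / 2 ^ (n + 1 + 1)) := by
        field_simp; ring
      rw [← h5]
      linarith
  set a : ℕ → H →L[ℂ] H := fun n => star (U n : H →L[ℂ] H) * U n with ha
  obtain ⟨b, hbM, hb0, hble, hlim⟩ := exists_antitone_lim (M := M) (T := a)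
    (fun n => mul_mem (star_mem (mem_alg _)) (mem_alg _)) (fun n => by
      have h1 : a (n + 1) = star (U n : H →L[ℂ] H) * ((e ((U n : H →L[ℂ] H) ζ) n : H →L[ℂ] H) * (e ((U n : H →L[ℂ] H) ζ) n : H →L[ℂ] H)) * U n := by
        have h3 : ((U (n + 1) : Alg M) : H →L[ℂ] H) = (e ((U n : H →L[ℂ] H) ζ) n : H →L[ℂ] H) * U n := by rw [US]; rfl
        simp only [ha]
        rw [h3, star_mul, he1]
        noncomm_ring
      have h2 : a n = star (U n : H →L[ℂ] H) * 1 * U n := by rw [mul_one]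
      rw [h1, h2]
      exact star_left_conjugate_le_conjugate (he3 _ _) _)
    (fun n => star_mul_self_nonneg _) (fun n => by
      rw [ha]; dsimp only
      rw [CStarRing.norm_star_mul_self]
      exact mul_le_one₀ (Unorm n) (norm_nonneg _) (Unorm n))
  refine ⟨⟨b, hbM⟩, ?_, ?_⟩
  · obtain ⟨r, hrM, hrsa, -, hrr⟩ := exists_sqrt hbM hb0
    have hb : (⟨b, hbM⟩ : Alg M) = ⟨r, hrM⟩ * ⟨r, hrM⟩ := Subtype.ext hrr.symm
    have key : ∀ n : ℕ, ‖π t ⟨r, hrM⟩ (sv t)‖ ^ 2 ≤ (1 / ((n : ℝ) + 1)) ^ 2 := by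
      intro n
      obtain ⟨q, hqM, hqsa, -, hqq⟩ := exists_sqrt (M := M) (sub_mem (mul_mem (star_mem (mem_alg (U (n+1)))) (mem_alg (U (n+1)))) hbM) (sub_nonneg.2 (hble (n + 1)))
      have h1 : star (U (n+1)) * U (n+1) = ⟨q, hqM⟩ * ⟨q, hqM⟩ + ⟨r, hrM⟩ * ⟨r, hrM⟩ := by
        apply Subtype.ext
        change star (U (n+1) : H →L[ℂ] H) * U (n+1) = q * q + r * r
        rw [hqq, hrr]; abel
      have h2 : ‖π t (U (n+1)) (sv t)‖ ^ 2 = ‖π t ⟨q, hqM⟩ (sv t)‖ ^ 2 + ‖π t ⟨r, hrM⟩ (sv t)‖ ^ 2 := by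
        rw [← inner_sv_sq t ⟨q, hqM⟩ (Subtype.ext hqsa.star_eq), ← inner_sv_sq t ⟨r, hrM⟩ (Subtype.ext hrsa.star_eq),
          ← Complex.add_re, ← inner_add_right, ← π_add, ← h1, ← norm_π_sv_sq]
      have h3 : ‖π t (U (n+1)) (sv t)‖ ≤ 1 / ((n : ℝ) + 1) := by
        rw [← norm_π_star_sv, US, star_mul, π_mul]
        have hst : star (e ((U n : H →L[ℂ] H) ζ) n) = e ((U n : H →L[ℂ] H) ζ) n := Subtype.ext (he1 _ _)
        rw [hst]
        refine (norm_π_le t _ _).trans ?_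
        have h4 : ‖((star (U n) : Alg M) : H →L[ℂ] H)‖ ≤ 1 := by
          change ‖star (U n : H →L[ℂ] H)‖ ≤ 1
          rw [norm_star]; exact Unorm n
        have h5 := he4 ((U n : H →L[ℂ] H) ζ) n
        have h6 : ε n ≤ 1 / ((n : ℝ) + 1) := min_le_right _ _
        calc _ ≤ 1 * ‖π t (e ((U n : H →L[ℂ] H) ζ) n) (sv t)‖ := mul_le_mul_of_nonneg_right h4 (norm_nonneg _)
          _ ≤ _ := by linarith
      have h4 := pow_le_pow_left₀ (norm_nonneg _) h3 2
      nlinarith [sq_nonneg ‖π t ⟨q, hqM⟩ (sv t)‖]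
    have h0 : ‖π t ⟨r, hrM⟩ (sv t)‖ ^ 2 ≤ 0 := by
      refine ge_of_tendsto' (x := atTop) (f := fun n : ℕ => (1 / ((n : ℝ) + 1)) ^ 2) ?_ key
      have := (tendsto_one_div_add_atTop_nhds_zero_nat (𝕜 := ℝ)).pow 2
      simpa using this
    have h1 : π t ⟨r, hrM⟩ (sv t) = 0 := by
      rw [← norm_eq_zero]
      exact pow_eq_zero_iff (two_ne_zero) |>.1 (le_antisymm h0 (sq_nonneg _))
    rw [hb, π_mul, h1, map_zero]
  · intro hb
    have h1 : Tendsto (fun n => (⟪a n ζ, ζ⟫_ℂ).re) atTop (𝓝 (⟪b ζ, ζ⟫_ℂ).re) :=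
      (Complex.continuous_re.tendsto _).comp ((hlim ζ).inner tendsto_const_nhds)
    have h2 : ∀ n, (‖ζ‖ / 2) ^ 2 ≤ (⟪a n ζ, ζ⟫_ℂ).re := by
      intro n
      have h3 : (⟪a n ζ, ζ⟫_ℂ).re = ‖(U n : H →L[ℂ] H) ζ‖ ^ 2 := by
        have : a n ζ = star (U n : H →L[ℂ] H) ((U n : H →L[ℂ] H) ζ) := rfl
        rw [this, alg_star_apply, star_star]
        exact inner_self_eq_norm_sq (𝕜 := ℂ) _
      rw [h3]
      refine pow_le_pow_left₀ (by positivity) (le_trans ?_ (Uζ n)) 2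
      have : (0:ℝ) ≤ 1 / 2 ^ (n + 1) := by positivity
      nlinarith
    have h3 := ge_of_tendsto' h1 h2
    have hb' : b ζ = 0 := hb
    rw [hb', inner_zero_left, Complex.zero_re] at h3
    nlinarith [sq_pos_of_pos hn]

end CDP

namespace CDP

open scoped InnerProductSpace ComplexConjugate
open Filter Topology

variable {H : Type} [NormedAddCommGroup H] [InnerProductSpace ℂ H] [CompleteSpace H]
variable {M : VonNeumannAlgebra H}

/-- a star-projection -/
def IsP (p : H →L[ℂ] H) : Prop := star p = p ∧ p * p = p

/-- partial isometry -/
def IsPI (v : H →L[ℂ] H) : Prop := v * star v * v = v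

theorem IsPI.star_mul {v : H →L[ℂ] H} (h : IsPI v) : star v * v * star v = star v := by
  have := congrArg star h
  rw [StarMul.star_mul, StarMul.star_mul, star_star] at this
  rw [mul_assoc]; exact this

theorem IsPI.P1 {v : H →L[ℂ] H} (h : IsPI v) : IsP (star v * v) := by
  refine ⟨by rw [StarMul.star_mul, star_star], ?_⟩
  rw [← mul_assoc, h.star_mul]

theorem IsPI.P2 {v : H →L[ℂ] H} (h : IsPI v) : IsP (v * star v) := by
  refine ⟨by rw [StarMul.star_mul, star_star], ?_⟩
  rw [← mul_assoc, h]

theorem IsP.one_sub {p : H →L[ℂ] H} (h : IsP p) : IsP (1 - p) := by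
  refine ⟨by rw [star_sub, star_one, h.1], ?_⟩
  rw [mul_sub, sub_mul, sub_mul, h.2]; simp

theorem IsP.add {p q : H →L[ℂ] H} (h : IsP p) (h' : IsP q) (hpq : p * q = 0) : IsP (p + q) := by
  have hqp : q * p = 0 := by
    have := congrArg star hpq
    rwa [StarMul.star_mul, h.1, h'.1, star_zero] at this
  refine ⟨by rw [star_add, h.1, h'.1], ?_⟩
  rw [mul_add, add_mul, add_mul, h.2, h'.2, hpq, hqp]; simp

theorem IsP.star_mul_self {p : H →L[ℂ] H} (h : IsP p) : star p * p = p := by rw [h.1, h.2]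

theorem IsP.norm_le {p : H →L[ℂ] H} (h : IsP p) : ‖p‖ ≤ 1 := by
  have h1 := CStarRing.norm_star_mul_self (x := p)
  rw [h.star_mul_self] at h1
  by_contra hc
  push Not at hc
  nlinarith

theorem trace_P_nonneg (t : FT M) {p : H →L[ℂ] H} (hM : p ∈ M) (h : IsP p) : 0 ≤ (t.τ p).re := by
  have := (t.nonneg p hM).1
  rwa [h.star_mul_self] at this

theorem trace_P_le (t : FT M) {p : H →L[ℂ] H} (hM : p ∈ M) (h : IsP p) : (t.τ p).re ≤ (t.τ 1).re := by
  have := trace_P_nonneg t (sub_mem one_mem' hM) h.one_sub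
  rw [map_sub, Complex.sub_re] at this
  linarith

theorem trace_eq_zero (t : FT M) {v : H →L[ℂ] H} (hM : v ∈ M) (h : (t.τ (star v * v)).re ≤ 0) : v = 0 := by
  have h1 := t.nonneg v hM
  exact t.faithful v hM (Complex.ext (le_antisymm h h1.1) h1.2)

theorem trace_pos (t : FT M) {v : H →L[ℂ] H} (hM : v ∈ M) (h : v ≠ 0) : 0 < (t.τ (star v * v)).re := by
  by_contra hc
  exact h (trace_eq_zero t hM (not_lt.1 hc))

/-- projection onto an invariant closed subspace commutes -/
theorem proj_comm (N : VonNeumannAlgebra H) (V : Submodule ℂ H) [CompleteSpace V]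
    (h : ∀ b ∈ N, ∀ v ∈ V, b v ∈ V) {b : H →L[ℂ] H} (hb : b ∈ N) :
    b * V.starProjection = V.starProjection * b := by
  ext v
  change b (V.starProjection v) = V.starProjection (b v)
  symm
  apply Submodule.eq_starProjection_of_mem_of_inner_eq_zero
  · exact h b hb _ (Submodule.starProjection_apply_mem _ _)
  · intro w hw
    rw [← map_sub, alg_star_apply]
    exact Submodule.starProjection_inner_eq_zero _ _ (h _ (star_mem hb) w hw)

theorem proj_mem_commutant (N : VonNeumannAlgebra H) (V : Submodule ℂ H) [CompleteSpace V]
    (h : ∀ b ∈ N, ∀ v ∈ V, b v ∈ V) : V.starProjection ∈ N.commutant :=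
  VonNeumannAlgebra.mem_commutant_iff.2 fun _ hb => proj_comm N V h hb

theorem proj_mem (V : Submodule ℂ H) [CompleteSpace V]
    (h : ∀ b ∈ M.commutant, ∀ v ∈ V, b v ∈ V) : V.starProjection ∈ M := by
  rw [← M.commutant_commutant]
  exact proj_mem_commutant _ V h

theorem proj_isP (V : Submodule ℂ H) [CompleteSpace V] : IsP V.starProjection := by
  have := isStarProjection_starProjection (U := V)
  exact ⟨this.isSelfAdjoint.star_eq, this.isIdempotentElem⟩

theorem closure_inv (V : Submodule ℂ H) {b : H →L[ℂ] H} (h : ∀ v ∈ V, b v ∈ V) :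
    ∀ v ∈ V.topologicalClosure, b v ∈ V.topologicalClosure := by
  intro v hv
  exact map_mem_closure b.continuous (s := (V : Set H)) (t := (V : Set H)) hv (fun w hw => h w hw)

instance (V : Submodule ℂ H) : CompleteSpace V.topologicalClosure :=
  V.isClosed_topologicalClosure.completeSpace_coe

theorem clm_ext_closure (V : Submodule ℂ H) {b : H →L[ℂ] H} (h : ∀ v ∈ V, b v = v) :
    b * V.topologicalClosure.starProjection = V.topologicalClosure.starProjection := by
  ext w
  have hcl : IsClosed {v | b v = v} := isClosed_eq b.continuous continuous_id
  have : (V.topologicalClosure : Set H) ⊆ {v | b v = v} := closure_minimal (fun v hv => h v hv) hcl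
  exact this (Submodule.starProjection_apply_mem _ _)

theorem clm_zero_closure (V : Submodule ℂ H) {b : H →L[ℂ] H} (h : ∀ v ∈ V, b v = 0) :
    b * V.topologicalClosure.starProjection = 0 := by
  ext w
  have hcl : IsClosed {v | b v = 0} := isClosed_eq b.continuous continuous_const
  have : (V.topologicalClosure : Set H) ⊆ {v | b v = 0} := closure_minimal (fun v hv => h v hv) hcl
  exact this (Submodule.starProjection_apply_mem _ _)

theorem exists_PI {x : H →L[ℂ] H} (hM : x ∈ M) (hx : x ≠ 0) :
    ∃ m ∈ M, IsPI (x * m) ∧ x * m ≠ 0 ∧ ∀ c, x * c = 0 → x * m * c = 0 := by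
  set h := star x * x with hh
  have hhM : h ∈ M := mul_mem (star_mem hM) hM
  have hh0 : 0 ≤ h := star_mul_self_nonneg _
  have hsa : IsSelfAdjoint h := IsSelfAdjoint.of_nonneg hh0
  have hhn : 0 < ‖h‖ := by
    rw [hh, CStarRing.norm_star_mul_self]; exact mul_pos (norm_pos_iff.2 hx) (norm_pos_iff.2 hx)
  set δ := ‖h‖ / 2 with hδ
  have hδ0 : 0 < δ := by positivity
  have hmax : ∀ y : ℝ, 0 < max y δ := fun y => lt_max_of_lt_right hδ0
  obtain ⟨k, hkc, hky⟩ : ∃ k : ℝ → ℝ, Continuous k ∧ ∀ y, k y * y = max (y - δ) 0 := by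
    refine ⟨fun y => max (y - δ) 0 / max y δ,
      Continuous.div (by fun_prop) (by fun_prop) fun y => (hmax y).ne', ?_⟩
    intro y
    rcases le_total y δ with h1 | h1
    · simp only
      rw [max_eq_right (by linarith : y - δ ≤ 0)]; simp
    · simp only
      rw [max_eq_left h1, div_mul_cancel₀]; linarith
  obtain ⟨f, hfc, hfy⟩ : ∃ f : ℝ → ℝ, Continuous f ∧ ∀ y, δ ≤ y → f y * y * f y = 1 := by
    refine ⟨fun y => (Real.sqrt (max y δ))⁻¹,
      Continuous.inv₀ (by fun_prop) fun y => (Real.sqrt_pos.2 (hmax y)).ne', ?_⟩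
    intro y h1
    simp only
    rw [max_eq_left h1]
    have hy : 0 < y := by linarith
    have := Real.mul_self_sqrt hy.le
    have h3 := (Real.sqrt_pos.2 hy).ne'
    field_simp
    nlinarith
  clear_value δ
  set b := cfc (fun y => k y * y) h with hb
  have hbk : b = cfc k h * h := by
    rw [hb, cfc_mul k (fun y => y) h hkc.continuousOn continuousOn_id, cfc_id' ℝ h]
  have hbM : b ∈ M := cfc_mem _ hhM
  have hbsa : star b = b := (cfc_predicate _ h : IsSelfAdjoint b).star_eq
  have hb0 : b ≠ 0 := by
    intro hb0
    have h1 : ∀ y ∈ spectrum ℝ h, y ≤ δ := by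
      intro y hy
      have := norm_apply_le_norm_cfc (fun y => k y * y) h hy
        (hkc.mul continuous_id).continuousOn
      rw [← hb, hb0, norm_zero, hky, Real.norm_eq_abs] at this
      have h2 := abs_nonpos_iff.1 this
      have h3 := le_max_left (y - δ) 0
      linarith
    have h2 : ‖h‖ ≤ δ := by
      conv_lhs => rw [← cfc_id ℝ h]
      refine norm_cfc_le hδ0.le fun y hy => ?_
      rw [id, Real.norm_eq_abs, abs_of_nonneg (spectrum_nonneg_of_nonneg hh0 hy)]
      exact h1 y hy
    linarith
  set V : Submodule ℂ H := b.range with hV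
  set e := V.topologicalClosure.starProjection with he
  have heP : IsP e := proj_isP _
  have heM : e ∈ M := by
    refine proj_mem _ fun c hc => closure_inv _ ?_
    rintro _ ⟨w, rfl⟩
    exact ⟨c w, (comm_apply hc ⟨b, hbM⟩ w)⟩
  have heb : e * b = b := by
    ext w
    exact Submodule.starProjection_eq_self_iff.2 (V.le_topologicalClosure ⟨w, rfl⟩)
  set F := cfc f h with hF
  have hFsa : star F = F := (cfc_predicate _ h : IsSelfAdjoint F).star_eq
  have hFM : F ∈ M := cfc_mem _ hhM
  have hgb : F * h * F * b = b := by
    have : F * h * F * b = cfc (fun y => f y * y * f y * (k y * y)) h := by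
      rw [cfc_mul (fun y => f y * y * f y) (fun y => k y * y) h
          ((hfc.mul continuous_id).mul hfc).continuousOn (hkc.mul continuous_id).continuousOn,
        cfc_mul (fun y => f y * y) f h (hfc.mul continuous_id).continuousOn hfc.continuousOn,
        cfc_mul f (fun y => y) h hfc.continuousOn continuousOn_id, cfc_id' ℝ h]
    rw [this, hb]
    refine cfc_congr fun y hy => ?_
    simp only [hky]
    rcases le_total y δ with h1 | h1
    · rw [max_eq_right (by linarith : y - δ ≤ 0)]; simp
    · rw [hfy y h1, one_mul]
  have hge : F * h * F * e = e := by
    refine clm_ext_closure _ ?_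
    rintro _ ⟨w, rfl⟩
    exact congrArg (fun f : H →L[ℂ] H => f w) hgb
  have hvv : star (x * (F * e)) * (x * (F * e)) = e := by
    rw [star_mul, star_mul, hFsa, heP.1]
    calc e * F * star x * (x * (F * e)) = e * (F * h * F * e) := by rw [hh]; noncomm_ring
      _ = e := by rw [hge, heP.2]
  refine ⟨F * e, mul_mem hFM heM, ?_, ?_, ?_⟩
  · rw [IsPI, mul_assoc, hvv, mul_assoc, mul_assoc, heP.2]
  · intro h0
    rw [h0, mul_zero] at hvv
    rw [← hvv, zero_mul] at heb
    exact hb0 heb.symm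
  · intro c hc
    have hbc : b * c = 0 := by rw [hbk, hh, mul_assoc, mul_assoc, hc]; simp
    have : star c * e = 0 := by
      refine clm_zero_closure _ ?_
      rintro _ ⟨w, rfl⟩
      have h1 := congrArg star hbc
      rw [star_mul, hbsa, star_zero] at h1
      exact congrArg (fun f : H →L[ℂ] H => f w) h1
    have h2 := congrArg star this
    rw [star_mul, star_star, heP.1, star_zero] at h2
    rw [mul_assoc, mul_assoc, h2]; simp

end CDP

namespace CDP

open scoped InnerProductSpace ComplexConjugate
open Filter Topology

variable {H : Type} [NormedAddCommGroup H] [InnerProductSpace ℂ H] [CompleteSpace H]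
variable {M : VonNeumannAlgebra H}

theorem cauchy_of_orth (a : ℕ → H) (C : ℝ) (hC : ∀ n, ‖a n‖ ≤ C)
    (h : ∀ n m, n ≤ m → ⟪a n, a m - a n⟫_ℂ = 0) : CauchySeq a := by
  have key : ∀ n m, n ≤ m → ‖a m‖ ^ 2 = ‖a n‖ ^ 2 + ‖a m - a n‖ ^ 2 := by
    intro n m hnm
    have := norm_add_sq_eq_norm_sq_add_norm_sq_of_inner_eq_zero (a n) (a m - a n) (h n m hnm)
    rw [add_sub_cancel] at this
    nlinarith
  have hmono : Monotone fun n => ‖a n‖ ^ 2 := by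
    intro n m hnm
    have := key n m hnm
    simp only
    nlinarith [sq_nonneg ‖a m - a n‖]
  have hbdd : BddAbove (Set.range fun n => ‖a n‖ ^ 2) := by
    refine ⟨C ^ 2, ?_⟩
    rintro _ ⟨n, rfl⟩
    exact pow_le_pow_left₀ (norm_nonneg _) (hC n) 2
  have hcs := (tendsto_atTop_ciSup hmono hbdd).cauchySeq
  rw [Metric.cauchySeq_iff'] at hcs ⊢
  intro ε hε
  obtain ⟨n, hn⟩ := hcs (ε ^ 2) (by positivity)
  refine ⟨n, fun m hm => ?_⟩
  have h1 := hn m hm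
  rw [Real.dist_eq, key n m hm, add_sub_cancel_left, abs_of_nonneg (sq_nonneg _)] at h1
  rw [dist_eq_norm]
  exact lt_of_pow_lt_pow_left₀ 2 hε.le h1

/-- good partial isometries below `r` and `q` -/
def Gd (M : VonNeumannAlgebra H) (r q w : H →L[ℂ] H) : Prop :=
  w ∈ M ∧ IsPI w ∧ r * w = w ∧ w * q = w

/-- admissible increments -/
def Ad (M : VonNeumannAlgebra H) (r q w v : H →L[ℂ] H) : Prop :=
  Gd M r q v ∧ star w * v = 0 ∧ v * star w = 0

theorem Ad.star1 {r q w v : H →L[ℂ] H} (h : Ad M r q w v) : star v * w = 0 := by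
  have := congrArg star h.2.1
  rwa [star_mul, star_star, star_zero] at this

theorem Ad.star2 {r q w v : H →L[ℂ] H} (h : Ad M r q w v) : w * star v = 0 := by
  have := congrArg star h.2.2
  rwa [star_mul, star_star, star_zero] at this

theorem Ad.sq {r q w v : H →L[ℂ] H} (h : Ad M r q w v) :
    star (w + v) * (w + v) = star w * w + star v * v := by
  rw [star_add, add_mul, mul_add, mul_add, h.2.1, h.star1]; simp

theorem Gd.add {r q w v : H →L[ℂ] H} (hw : Gd M r q w) (h : Ad M r q w v) : Gd M r q (w + v) := by
  refine ⟨add_mem hw.1 h.1.1, ?_, ?_, ?_⟩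
  · rw [IsPI, mul_assoc, h.sq, add_mul, mul_add, mul_add, ← mul_assoc, ← mul_assoc, ← mul_assoc,
      ← mul_assoc, h.star2, h.2.2, hw.2.1, h.1.2.1]; simp
  · rw [mul_add, hw.2.2.1, h.1.2.2.1]
  · rw [add_mul, hw.2.2.2, h.1.2.2.2]

theorem Gd_zero (r q : H →L[ℂ] H) : Gd M r q 0 :=
  ⟨zero_mem _, by simp [IsPI], by simp, by simp⟩

theorem greedy (t : FT M) (r q w : H →L[ℂ] H) : ∃ v, Ad M r q w v ∧
    ∀ v', Ad M r q w v' → (t.τ (star v' * v')).re ≤ 2 * (t.τ (star v * v)).re := by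
  set s : Set ℝ := {c | ∃ v, Ad M r q w v ∧ c = (t.τ (star v * v)).re} with hs
  have hbdd : BddAbove s := by
    refine ⟨(t.τ 1).re, ?_⟩
    rintro _ ⟨v, hv, rfl⟩
    exact trace_P_le t (mul_mem (star_mem hv.1.1) hv.1.1) hv.1.2.1.P1
  have hA0 : Ad M r q w 0 := ⟨Gd_zero r q, by simp, by simp⟩
  by_cases h : ∃ c ∈ s, 0 < c
  · obtain ⟨c, hc, hc0⟩ := h
    have hpos : 0 < sSup s := lt_of_lt_of_le hc0 (le_csSup hbdd hc)
    obtain ⟨_, ⟨v, hv, rfl⟩, hv2⟩ := exists_lt_of_lt_csSup ⟨c, hc⟩ (half_lt_self hpos)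
    refine ⟨v, hv, fun v' hv' => ?_⟩
    have := le_csSup hbdd ⟨v', hv', rfl⟩
    linarith
  · push Not at h
    refine ⟨0, hA0, fun v' hv' => ?_⟩
    have := h _ ⟨v', hv', rfl⟩
    simpa using this

theorem comparison (t : FT M) {r q : H →L[ℂ] H} (hr : r ∈ M) (hq : q ∈ M) (hrP : IsP r)
    (hqP : IsP q) : ∃ w, Gd M r q w ∧
      ∀ m ∈ M, (r - w * star w) * m * (q - star w * w) = 0 := by
  choose g hgA hg using greedy t r q
  obtain ⟨w, hw0, hws⟩ : ∃ w : ℕ → (H →L[ℂ] H), w 0 = 0 ∧ ∀ n, w (n + 1) = w n + g (w n) :=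
    ⟨fun n => Nat.rec 0 (fun _ x => x + g x) n, rfl, fun _ => rfl⟩
  have hwG : ∀ n, Gd M r q (w n) := by
    intro n
    induction n with
    | zero => rw [hw0]; exact Gd_zero r q
    | succ n ih => rw [hws]; exact ih.add (hgA _)
  have h12 : ∀ n m, n ≤ m → star (w n) * w m = star (w n) * w n ∧
      w m * star (w n) = w n * star (w n) := by
    intro n m hnm
    induction m, hnm using Nat.le_induction with
    | base => exact ⟨rfl, rfl⟩
    | succ m hnm ih =>
      have e1 : w n = w m * star (w n) * w n := by rw [ih.2]; exact (hwG n).2.1.symm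
      have e2 : star (w n) = star (w n) * w n * star (w m) := by
        have := congrArg star e1
        rwa [star_mul, star_mul, star_star, ← mul_assoc] at this
      have e3 : w n = w n * star (w n) * w m := by
        rw [mul_assoc, ih.1, ← mul_assoc]; exact (hwG n).2.1.symm
      have e4 : star (w n) = star (w m) * w n * star (w n) := by
        have := congrArg star e3
        rwa [star_mul, star_mul, star_star, ← mul_assoc] at this
      constructor
      · have z : star (w n) * g (w m) = 0 := by
          rw [e2, mul_assoc (star (w n) * w n), (hgA (w m)).2.1, mul_zero]
        rw [hws, mul_add, ih.1, z, add_zero]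
      · have z : g (w m) * star (w n) = 0 := by
          rw [e4, ← mul_assoc (g (w m)), ← mul_assoc (g (w m)), (hgA (w m)).2.2]; simp
        rw [hws, add_mul, ih.2, z, add_zero]
  have hnorm : ∀ n, ‖w n‖ ≤ 1 := by
    intro n
    have h1 := CStarRing.norm_star_mul_self (x := w n)
    have h2 := (hwG n).2.1.P1.norm_le
    by_contra hc
    push Not at hc
    nlinarith
  have hcs : ∀ v, CauchySeq fun n => w n v := by
    intro v
    refine cauchy_of_orth _ ‖v‖ ?_ ?_
    · intro n
      calc ‖w n v‖ ≤ ‖w n‖ * ‖v‖ := (w n).le_opNorm v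
        _ ≤ 1 * ‖v‖ := by gcongr; exact hnorm n
        _ = ‖v‖ := one_mul _
    · intro n m hnm
      rw [alg_star_apply, map_sub]
      have := congrArg (fun f : H →L[ℂ] H => f v) (h12 n m hnm).1
      have h2 : star (w n) (w m v) = star (w n) (w n v) := this
      rw [h2, sub_self, inner_zero_right]
  obtain ⟨W, hWM, hW⟩ := exists_lim (fun n => (hwG n).1) hcs
  have hW1 : ∀ n, star (w n) * W = star (w n) * w n := by
    intro n
    ext v
    have h1 : Tendsto (fun m => star (w n) (w m v)) atTop (𝓝 (star (w n) (W v))) :=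
      ((star (w n)).continuous.tendsto _).comp (hW v)
    refine tendsto_nhds_unique h1 (tendsto_const_nhds.congr' ?_)
    filter_upwards [eventually_ge_atTop n] with m hm
    exact (congrArg (fun f : H →L[ℂ] H => f v) (h12 n m hm).1).symm
  have hW2 : ∀ n, W * star (w n) = w n * star (w n) := by
    intro n
    ext v
    refine tendsto_nhds_unique (hW (star (w n) v)) (tendsto_const_nhds.congr' ?_)
    filter_upwards [eventually_ge_atTop n] with m hm
    exact (congrArg (fun f : H →L[ℂ] H => f v) (h12 n m hm).2).symm
  have hW3 : ∀ n, W * star (w n) * W = w n := by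
    intro n
    rw [mul_assoc, hW1, ← mul_assoc, hW2]; exact (hwG n).2.1
  have hWP : IsPI W := by
    rw [IsPI]
    ext v
    refine ext_inner_right ℂ fun η => ?_
    have e1 : ⟪(W * star W * W) v, η⟫_ℂ = ⟪W v, W (star W η)⟫_ℂ := by
      change ⟪W (star W (W v)), η⟫_ℂ = _
      rw [alg_star_apply, alg_star_apply, star_star]
    have e2 : ∀ n, ⟪w n v, η⟫_ℂ = ⟪W v, w n (star W η)⟫_ℂ := by
      intro n
      conv_lhs => rw [← hW3 n]
      change ⟪W (star (w n) (W v)), η⟫_ℂ = _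
      rw [alg_star_apply, alg_star_apply, star_star]
    rw [e1]
    have l1 : Tendsto (fun n => ⟪w n v, η⟫_ℂ) atTop (𝓝 ⟪W v, η⟫_ℂ) :=
      (hW v).inner tendsto_const_nhds
    have l2 : Tendsto (fun n => ⟪w n v, η⟫_ℂ) atTop (𝓝 ⟪W v, W (star W η)⟫_ℂ) := by
      simp_rw [e2]
      exact tendsto_const_nhds.inner (hW _)
    exact tendsto_nhds_unique l2 l1
  have hWr : r * W = W := by
    ext v
    have h1 : Tendsto (fun m => r (w m v)) atTop (𝓝 (r (W v))) :=
      (r.continuous.tendsto _).comp (hW v)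
    refine tendsto_nhds_unique h1 ((hW v).congr fun m => ?_)
    exact (congrArg (fun f : H →L[ℂ] H => f v) (hwG m).2.2.1).symm
  have hWq : W * q = W := by
    ext v
    refine tendsto_nhds_unique (hW (q v)) ((hW v).congr fun m => ?_)
    exact (congrArg (fun f : H →L[ℂ] H => f v) (hwG m).2.2.2).symm
  have hGW : Gd M r q W := ⟨hWM, hWP, hWr, hWq⟩
  have hsub : ∀ v, Ad M r q W v → ∀ n, Ad M r q (w n) v := by
    intro v hv n
    have e : star (w n) = star W * w n * star W := by
      conv_lhs => rw [← hW3 n]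
      rw [star_mul, star_mul, star_star, ← mul_assoc]
    refine ⟨hv.1, ?_, ?_⟩
    · rw [e, mul_assoc, hv.2.1, mul_zero]
    · rw [e, ← mul_assoc, ← mul_assoc, hv.2.2]; simp
  have hA0 : ∀ v, Ad M r q W v → v = 0 := by
    intro v hv
    by_contra hne
    have hpos := trace_pos t hv.1.1 hne
    set c := (t.τ (star v * v)).re
    have hlow : ∀ n : ℕ, n * (c / 2) ≤ (t.τ (star (w n) * w n)).re := by
      intro n
      induction n with
      | zero => simp [hw0]
      | succ n ih =>
        rw [hws, (hgA (w n)).sq, map_add, Complex.add_re]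
        have := hg (w n) v (hsub v hv n)
        push_cast
        linarith
    obtain ⟨n, hn⟩ := exists_nat_gt ((t.τ 1).re / (c / 2))
    rw [div_lt_iff₀ (by positivity)] at hn
    have := trace_P_le t (mul_mem (star_mem (hwG n).1) (hwG n).1) (hwG n).2.1.P1
    linarith [hlow n]
  refine ⟨W, hGW, fun m hm => ?_⟩
  by_contra hne
  set x := (r - W * star W) * m * (q - star W * W) with hx
  have hxM : x ∈ M := mul_mem (mul_mem (sub_mem hr (mul_mem hWM (star_mem hWM))) hm)
    (sub_mem hq (mul_mem (star_mem hWM) hWM))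
  obtain ⟨m', hm', hPI, hne', hc⟩ := exists_PI hxM hne
  apply hne'
  apply hA0
  have hsW : star W * r = star W := by
    have := congrArg star hWr
    rwa [star_mul, hrP.1] at this
  have hqW : q * star W = star W := by
    have := congrArg star hWq
    rwa [star_mul, hqP.1] at this
  have k1 : r * (r - W * star W) = r - W * star W := by
    rw [mul_sub, hrP.2, ← mul_assoc, hWr]
  have k2 : star W * (r - W * star W) = 0 := by
    rw [mul_sub, hsW, ← mul_assoc, hWP.star_mul, sub_self]
  have k3 : (q - star W * W) * (1 - q) = 0 := by
    rw [mul_sub, sub_mul, sub_mul, hqP.2, mul_assoc _ W q, hWq]; simp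
  have k4 : (q - star W * W) * star W = 0 := by
    rw [sub_mul, hqW, hWP.star_mul, sub_self]
  have hrx : r * x = x := by
    rw [hx, ← mul_assoc, ← mul_assoc, k1]
  refine ⟨⟨mul_mem hxM hm', hPI, by rw [← mul_assoc, hrx], ?_⟩, ?_, ?_⟩
  · have h1 : x * (1 - q) = 0 := by
      rw [hx, mul_assoc, k3, mul_zero]
    have := hc _ h1
    rw [mul_sub, mul_one, sub_eq_zero] at this
    exact this.symm
  · have h1 : star W * x = 0 := by
      rw [hx, ← mul_assoc, ← mul_assoc, k2]; simp
    rw [← mul_assoc, h1, zero_mul]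
  · apply hc
    rw [hx, mul_assoc, k4, mul_zero]

end CDP

namespace CDP

open scoped InnerProductSpace ComplexConjugate
open Filter Topology

variable {H : Type} [NormedAddCommGroup H] [InnerProductSpace ℂ H] [CompleteSpace H]
variable {M : VonNeumannAlgebra H}

/-- large closed two-sided ideals -/
structure LI (M : VonNeumannAlgebra H) (I : Set (H →L[ℂ] H)) : Prop where
  sub : ∀ a ∈ I, a ∈ M
  zero : (0 : H →L[ℂ] H) ∈ I
  add : ∀ a ∈ I, ∀ b ∈ I, a + b ∈ I
  mul_left : ∀ m ∈ M, ∀ a ∈ I, m * a ∈ I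
  mul_right : ∀ m ∈ M, ∀ a ∈ I, a * m ∈ I
  closed : ∀ (a : ℕ → (H →L[ℂ] H)) (b : H →L[ℂ] H), (∀ n, a n ∈ I) → b ∈ M →
    Tendsto a atTop (𝓝 b) → b ∈ I
  large : ∀ ζ : H, ζ ≠ 0 → ∃ a ∈ I, a ζ ≠ 0

theorem isClosed_vN (N : VonNeumannAlgebra H) : IsClosed (N : Set (H →L[ℂ] H)) := by
  rw [← N.centralizer_centralizer]
  exact Set.isClosed_centralizer _

theorem LI_singular (t : FT M) :
    LI M {a | ∃ h : a ∈ M, π t ⟨a, h⟩ (sv t) = 0} where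
  sub := fun a h => h.1
  zero := ⟨zero_mem _, by
    have : (⟨0, zero_mem _⟩ : Alg M) = (0 : ℂ) • (0 : Alg M) := by rw [smul_zero]; rfl
    rw [this, π_smul, zero_smul]⟩
  add := by
    rintro a ⟨ha, ha'⟩ b ⟨hb, hb'⟩
    refine ⟨add_mem ha hb, ?_⟩
    have : (⟨a + b, add_mem ha hb⟩ : Alg M) = ⟨a, ha⟩ + ⟨b, hb⟩ := rfl
    rw [this, π_add, ha', hb', add_zero]
  mul_left := by
    rintro m hm a ⟨ha, ha'⟩
    refine ⟨mul_mem hm ha, ?_⟩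
    have : (⟨m * a, mul_mem hm ha⟩ : Alg M) = ⟨m, hm⟩ * ⟨a, ha⟩ := rfl
    rw [this, π_mul, ha', map_zero]
  mul_right := by
    rintro m hm a ⟨ha, ha'⟩
    refine ⟨mul_mem ha hm, ?_⟩
    have : (⟨a * m, mul_mem ha hm⟩ : Alg M) = ⟨a, ha⟩ * ⟨m, hm⟩ := rfl
    rw [this, π_mul, ← ρ_sv, π_ρ, ha', map_zero]
  closed := by
    intro a b ha hb hlim
    refine ⟨hb, ?_⟩
    choose hM hz using ha
    have key : ∀ n, ‖π t ⟨b, hb⟩ (sv t)‖ ≤ ‖b - a n‖ * ‖sv t‖ := by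
      intro n
      have : π t (⟨b, hb⟩ - ⟨a n, hM n⟩) (sv t) = π t ⟨b, hb⟩ (sv t) := by
        rw [π_sub, hz n, sub_zero]
      rw [← this]
      exact norm_π_le t _ _
    have hl : Tendsto (fun n => ‖b - a n‖ * ‖sv t‖) atTop (𝓝 0) := by
      have h1 : Tendsto (fun n => b - a n) atTop (𝓝 (b - b)) := tendsto_const_nhds.sub hlim
      rw [sub_self] at h1
      simpa using h1.norm.mul_const ‖sv t‖
    have := ge_of_tendsto' hl key
    exact norm_le_zero_iff.1 this
  large := by
    intro ζ hζ
    obtain ⟨a, h1, h2⟩ := exists_ideal_elem t ζ hζ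
    exact ⟨a, ⟨mem_alg a, h1⟩, h2⟩

theorem span_inv {s : Set H} {b : H →L[ℂ] H} (h : ∀ v ∈ s, b v ∈ s) :
    ∀ v ∈ Submodule.span ℂ s, b v ∈ Submodule.span ℂ s := by
  intro v hv
  induction hv using Submodule.span_induction with
  | mem x hx => exact Submodule.subset_span (h x hx)
  | zero => simp
  | add x y _ _ hx hy => rw [map_add]; exact add_mem hx hy
  | smul c x _ hx => rw [map_smul]; exact Submodule.smul_mem _ _ hx

theorem span_eq {s : Set H} {b c : H →L[ℂ] H} (h : ∀ v ∈ s, b v = c v) :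
    ∀ v ∈ Submodule.span ℂ s, b v = c v := by
  intro v hv
  induction hv using Submodule.span_induction with
  | mem x hx => exact h x hx
  | zero => simp
  | add x y _ _ hx hy => rw [map_add, map_add, hx, hy]
  | smul c x _ hx => rw [map_smul, map_smul, hx]

variable {I : Set (H →L[ℂ] H)}

theorem LI.pi_mem (hI : LI M I) {v : H →L[ℂ] H} (hv : v ∈ M) (hP : IsPI v)
    (h : star v * v ∈ I) : v * star v ∈ I := by
  have : v * star v = v * (star v * v * star v) := by rw [hP.star_mul]
  rw [this]
  exact hI.mul_left _ hv _ (hI.mul_right _ (star_mem hv) _ h)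

theorem exists_big (t : FT M) (hI : LI M I) {q : H →L[ℂ] H} (hq : q ∈ I) (hqP : IsP q)
    (hq0 : q ≠ 0) : ∃ p ∈ I, IsP p ∧ ¬ ∃ v ∈ M, IsPI v ∧ star v * v = q ∧ p * v = 0 := by
  by_contra hc
  push Not at hc
  have hpos : 0 < (t.τ q).re := by
    have := trace_pos t (hI.sub q hq) hq0
    rwa [hqP.star_mul_self] at this
  have key : ∀ n : ℕ, ∃ p ∈ I, IsP p ∧ (t.τ p).re = n * (t.τ q).re := by
    intro n
    induction n with
    | zero => exact ⟨0, hI.zero, ⟨by simp, by simp⟩, by simp⟩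
    | succ n ih =>
      obtain ⟨p, hp, hpP, hpt⟩ := ih
      obtain ⟨v, hv, hvP, hvq, hpv⟩ := hc p hp hpP
      refine ⟨p + v * star v, hI.add _ hp _ (hI.pi_mem hv hvP (hvq ▸ hq)),
        hpP.add hvP.P2 (by rw [← mul_assoc, hpv, zero_mul]), ?_⟩
      rw [map_add, t.tracial v hv _ (star_mem hv), hvq, Complex.add_re, hpt]
      push_cast; ring
  obtain ⟨n, hn⟩ := exists_nat_gt ((t.τ 1).re / (t.τ q).re)
  rw [div_lt_iff₀ hpos] at hn
  obtain ⟨p, hp, hpP, hpt⟩ := key n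
  have := trace_P_le t (hI.sub p hp) hpP
  linarith

theorem lemmaZ (t : FT M) (hI : LI M I) {y : H →L[ℂ] H} (hyM : y ∈ M) (hyc : y ∈ M.commutant)
    (hyP : IsP y) (hy0 : y ≠ 0) :
    ∃ z ∈ I, z ∈ M.commutant ∧ IsP z ∧ z ≠ 0 ∧ z * y = z := by
  obtain ⟨ζ, hζ⟩ : ∃ ζ, y ζ ≠ 0 := by
    by_contra hc
    push Not at hc
    exact hy0 (by ext v; simpa using hc v)
  obtain ⟨a, ha, haζ⟩ := hI.large _ hζ
  have hayI : a * y ∈ I := hI.mul_right _ hyM _ ha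
  have hay0 : a * y ≠ 0 := by
    intro h
    exact haζ (by simpa using congrArg (fun f : H →L[ℂ] H => f ζ) h)
  obtain ⟨m, hm, hvP, hv0, hvc⟩ := exists_PI (hI.sub _ hayI) hay0
  set v := a * y * m with hv
  have hvI : v ∈ I := hI.mul_right _ hm _ hayI
  have hvM := hI.sub _ hvI
  have hvy : v * y = v := by
    have := hvc (1 - y) (by rw [mul_assoc, mul_sub, hyP.2]; simp)
    rw [mul_sub, mul_one, sub_eq_zero] at this
    exact this.symm
  clear_value v
  set q := star v * v with hq
  have hqI : q ∈ I := hI.mul_left _ (star_mem hvM) _ hvI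
  have hqM := hI.sub _ hqI
  have hqP : IsP q := hvP.P1
  have hq0 : q ≠ 0 := by
    intro h0
    have := trace_pos t hvM hv0
    rw [← hq, h0] at this
    simp at this
  have hqy : q * y = q := by rw [hq, mul_assoc, hvy]
  clear_value q
  obtain ⟨p, hp, hpP, hpn⟩ := exists_big t hI hqI hqP hq0
  have hpM := hI.sub _ hp
  obtain ⟨w, ⟨hwM, hwP, hrw, hwq⟩, hw⟩ := comparison t (sub_mem one_mem' hpM) hqM hpP.one_sub hqP
  have hq'0 : q - star w * w ≠ 0 := by
    intro h0
    refine hpn ⟨w, hwM, hwP, (sub_eq_zero.1 h0).symm, ?_⟩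
    rw [← hrw, ← mul_assoc, mul_sub, hpP.2]; simp
  set q' := q - star w * w with hq'
  have hq'M : q' ∈ M := sub_mem hqM (mul_mem (star_mem hwM) hwM)
  have hq'y : q' * y = q' := by
    have : star w * w * y = star w * w := by
      have hwy : w * y = w := by
        calc w * y = w * (q * y) := by rw [← mul_assoc, hwq]
          _ = w := by rw [hqy, hwq]
      rw [mul_assoc, hwy]
    rw [hq', sub_mul, hqy, this]
  clear_value q'
  set s : Set H := {η | ∃ m ∈ M, ∃ ζ, η = m (q' ζ)} with hs
  set V := Submodule.span ℂ s with hV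
  set z := V.topologicalClosure.starProjection with hz
  have hzM : z ∈ M := by
    refine proj_mem _ fun b hb => closure_inv _ (span_inv ?_)
    rintro _ ⟨m, hm, ζ, rfl⟩
    refine ⟨m, hm, b ζ, ?_⟩
    have e1 := comm_apply hb ⟨m, hm⟩ (q' ζ)
    have e2 := comm_apply hb ⟨q', hq'M⟩ ζ
    simp only at e1 e2
    rw [← e1, ← e2]
  have hzc : z ∈ M.commutant := by
    refine proj_mem_commutant _ _ fun b hb => closure_inv _ (span_inv ?_)
    rintro _ ⟨m, hm, ζ, rfl⟩
    exact ⟨b * m, mul_mem hb hm, ζ, rfl⟩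
  have hzP : IsP z := proj_isP _
  have hrz : (1 - p - w * star w) * z = 0 := by
    refine clm_zero_closure _ fun v hv => ?_
    refine span_eq (c := 0) ?_ v hv
    rintro _ ⟨m, hm, ζ, rfl⟩
    exact congrArg (fun f : H →L[ℂ] H => f ζ) (hw m hm)
  have hzI : z ∈ I := by
    have h1 : (p + w * star w) * z = z := by
      rw [sub_mul, sub_mul, one_mul, sub_sub, sub_eq_zero, ← add_mul] at hrz
      exact hrz.symm
    rw [← h1]
    refine hI.mul_right _ hzM _ (hI.add _ hp _ (hI.pi_mem hwM hwP ?_))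
    rw [← hwq, ← mul_assoc]
    refine hI.mul_left _ (mul_mem (star_mem ?_) hwM) _ hqI
    rw [hwq]; exact hwM
  refine ⟨z, hzI, hzc, hzP, ?_, ?_⟩
  · intro h0
    apply hq'0
    ext ζ
    have h1 : z (q' ζ) = q' ζ :=
      Submodule.starProjection_eq_self_iff.2 (V.le_topologicalClosure
        (Submodule.subset_span ⟨1, one_mem', ζ, rfl⟩))
    rw [h0] at h1
    simpa using h1.symm
  · have h1 : y * z = z := by
      refine clm_ext_closure _ fun v hv => ?_
      refine span_eq (c := 1) ?_ v hv
      rintro _ ⟨m, hm, ζ, rfl⟩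
      have e1 := comm_apply hyc ⟨m, hm⟩ (q' ζ)
      have e2 := comm_apply hyc ⟨q', hq'M⟩ ζ
      simp only at e1 e2
      have e3 : q' (y ζ) = q' ζ := congrArg (fun f : H →L[ℂ] H => f ζ) hq'y
      rw [← e1, ← e2, e3]; rfl
    rw [← VonNeumannAlgebra.mem_commutant_iff.1 hzc y hyM, h1]

theorem exists_d (t : FT M) (hI : LI M I) :
    ∃ d ∈ I, d ∈ M.commutant ∧ star d = d ∧ ∀ ζ, d ζ = 0 → ζ = 0 := by
  set s : Set ℝ := {c | ∃ z ∈ I, z ∈ M.commutant ∧ IsP z ∧ c = (t.τ z).re} with hs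
  have hbdd : BddAbove s := by
    refine ⟨(t.τ 1).re, ?_⟩
    rintro _ ⟨z, hz, -, hzP, rfl⟩
    exact trace_P_le t (hI.sub z hz) hzP
  have hne : s.Nonempty := ⟨_, 0, hI.zero, zero_mem _, ⟨by simp, by simp⟩, rfl⟩
  have hk : ∀ k : ℕ, ∃ z ∈ I, z ∈ M.commutant ∧ IsP z ∧ sSup s - 1 / ((k : ℝ) + 1) < (t.τ z).re := by
    intro k
    have : sSup s - 1 / ((k : ℝ) + 1) < sSup s := by
      have : 0 < 1 / ((k : ℝ) + 1) := by positivity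
      linarith
    obtain ⟨_, ⟨z, h1, h2, h3, rfl⟩, h4⟩ := exists_lt_of_lt_csSup hne this
    exact ⟨z, h1, h2, h3, h4⟩
  choose z hzI hzc hzP hzt using hk
  have hsum : Summable fun k : ℕ => ((1 / 2 : ℝ) ^ k : ℂ) • z k := by
    refine Summable.of_norm_bounded summable_geometric_two fun k => ?_
    rw [norm_smul]
    have h1 := (hzP k).norm_le
    have : ‖((1 / 2 : ℝ) ^ k : ℂ)‖ = (1 / 2 : ℝ) ^ k := by
      rw [norm_pow, Complex.norm_real]; norm_num
    rw [this]
    have h2 : 0 ≤ (1 / 2 : ℝ) ^ k := by positivity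
    nlinarith
  obtain ⟨d, hd⟩ := hsum
  have htd := hd.tendsto_sum_nat
  have hsmI : ∀ (c : ℂ), ∀ a ∈ I, c • a ∈ I := by
    intro c a ha
    have := hI.mul_left _ (smul_mem' c one_mem') a ha
    rwa [smul_mul_assoc, one_mul] at this
  have hpI : ∀ n, ∑ i ∈ Finset.range n, ((1 / 2 : ℝ) ^ i : ℂ) • z i ∈ I := by
    intro n
    induction n with
    | zero => simpa using hI.zero
    | succ n ih => rw [Finset.sum_range_succ]; exact hI.add _ ih _ (hsmI _ _ (hzI n))
  have hdM : d ∈ M := (isClosed_vN M).mem_of_tendsto htd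
    (Eventually.of_forall fun n => hI.sub _ (hpI n))
  have hdI : d ∈ I := hI.closed _ d hpI hdM htd
  have hdc : d ∈ M.commutant := by
    refine (isClosed_vN M.commutant).mem_of_tendsto htd (Eventually.of_forall fun n => ?_)
    exact sum_mem fun i _ => smul_mem' _ (hzc i)
  have hds : star d = d := by
    have h1 := hd.star
    refine h1.unique (hd.congr_fun ?_)
    intro k
    rw [star_smul, (hzP k).1]
    congr 1
    simp
  refine ⟨d, hdI, hdc, hds, ?_⟩
  -- injectivity
  have hker : ∀ ζ, d ζ = 0 → ∀ k, z k ζ = 0 := by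
    intro ζ hζ k
    have h1 : HasSum (fun k : ℕ => (1 / 2 : ℝ) ^ k * ‖z k ζ‖ ^ 2) 0 := by
      have h2 := ((innerSL ℂ ζ).comp (ContinuousLinearMap.apply ℂ H ζ)).hasSum hd
      have h3 := Complex.reCLM.hasSum h2
      have e0 : Complex.reCLM (((innerSL ℂ ζ).comp (ContinuousLinearMap.apply ℂ H ζ)) d) = 0 := by
        simp [hζ]
      rw [e0] at h3
      refine h3.congr_fun ?_
      intro j
      have e1 : ⟪ζ, z j ζ⟫_ℂ = ⟪z j ζ, z j ζ⟫_ℂ := by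
        rw [alg_star_apply, (hzP j).1]
        exact congrArg (fun f : H →L[ℂ] H => ⟪ζ, f ζ⟫_ℂ) (hzP j).2.symm
      have e2 : Complex.reCLM (((innerSL ℂ ζ).comp (ContinuousLinearMap.apply ℂ H ζ))
          (((1 / 2 : ℝ) ^ j : ℂ) • z j)) = (((1 / 2 : ℝ) ^ j : ℝ) * ⟪ζ, z j ζ⟫_ℂ).re := by
        simp [inner_smul_right]
      rw [e2, e1, Complex.re_ofReal_mul]
      congr 1
      exact (inner_self_eq_norm_sq (𝕜 := ℂ) (z j ζ)).symm
    have h4 := (hasSum_zero_iff_of_nonneg (fun j => by positivity)).1 h1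
    have h5 := congrFun h4 k
    simp only [Pi.zero_apply, mul_eq_zero] at h5
    rcases h5 with h5 | h5
    · have : (0:ℝ) < (1 / 2 : ℝ) ^ k := by positivity
      linarith
    · simpa using h5
  intro ζ hζ
  by_contra hζ0
  set V : Submodule ℂ H := ⨅ k, (z k).ker with hV
  have hVm : ∀ v, v ∈ V ↔ ∀ k, z k v = 0 := by
    intro v; simp [hV, Submodule.mem_iInf]
  have hVc : IsClosed (V : Set H) := by
    have : (V : Set H) = ⋂ k, {v | z k v = 0} := by
      ext v; simp [hVm]
    rw [this]
    exact isClosed_iInter fun k => isClosed_eq (z k).continuous continuous_const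
  have : CompleteSpace V := hVc.completeSpace_coe
  have hyM : V.starProjection ∈ M := by
    refine proj_mem _ fun b hb v hv => (hVm _).2 fun k => ?_
    have := comm_apply hb ⟨z k, hI.sub _ (hzI k)⟩ v
    simp only at this
    rw [this, (hVm v).1 hv k, map_zero]
  have hyc : V.starProjection ∈ M.commutant := by
    refine proj_mem_commutant _ _ fun b hb v hv => (hVm _).2 fun k => ?_
    have := comm_apply (hzc k) ⟨b, hb⟩ v
    simp only at this
    rw [← this, (hVm v).1 hv k, map_zero]
  have hy0 : V.starProjection ≠ 0 := by
    intro h0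
    have h1 : V.starProjection ζ = ζ :=
      Submodule.starProjection_eq_self_iff.2 ((hVm ζ).2 (hker ζ hζ))
    rw [h0] at h1
    exact hζ0 (by simpa using h1.symm)
  obtain ⟨x, hxI, hxc, hxP, hx0, hxy⟩ := lemmaZ t hI hyM hyc (proj_isP V) hy0
  have hxz : ∀ k, z k * x = 0 := by
    intro k
    have h1 : z k * V.starProjection = 0 := by
      ext v
      exact (hVm _).1 (Submodule.starProjection_apply_mem V v) k
    rw [← hxy, ← mul_assoc, VonNeumannAlgebra.mem_commutant_iff.1 hxc _ (hI.sub _ (hzI k)),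
      mul_assoc, h1, mul_zero]
  have hpos : 0 < (t.τ x).re := by
    have := trace_pos t (hI.sub _ hxI) hx0
    rwa [hxP.star_mul_self] at this
  obtain ⟨k, hk⟩ := exists_nat_one_div_lt hpos
  have h1 : (t.τ (z k + x)).re ≤ sSup s :=
    le_csSup hbdd ⟨_, hI.add _ (hzI k) _ hxI, add_mem (hzc k) hxc, (hzP k).add hxP (hxz k), rfl⟩
  rw [map_add, Complex.add_re] at h1
  linarith [hzt k]

end CDP

namespace CDP

open scoped InnerProductSpace ComplexConjugate
open Filter Topology

variable {H : Type} [NormedAddCommGroup H] [InnerProductSpace ℂ H] [CompleteSpace H]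
variable {M : VonNeumannAlgebra H}

theorem dd_eq {d x : H →L[ℂ] H} (hdc : d ∈ M.commutant) (hds : star d = d) (hx : x ∈ M) :
    d * d * (star x * x) = star (d * x) * (d * x) := by
  have hc : ∀ x ∈ M, x * d = d * x := VonNeumannAlgebra.mem_commutant_iff.1 hdc
  have h1 : star x * (d * d) = d * d * star x := by
    rw [← mul_assoc, hc _ (star_mem hx), mul_assoc, hc _ (star_mem hx), ← mul_assoc]
  rw [star_mul, hds, mul_assoc (star x), ← mul_assoc d d x, ← mul_assoc (star x), h1, mul_assoc (d * d)]

/-- the weighted trace -/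
def wt (t : FT M) (d : H →L[ℂ] H) (hd : d ∈ M) (hdc : d ∈ M.commutant) (hds : star d = d)
    (hinj : ∀ ζ, d ζ = 0 → ζ = 0) : FT M where
  τ := t.τ.comp (LinearMap.mulLeft ℂ (d * d))
  tracial x hx y hy := by
    have hc : ∀ x ∈ M, x * d = d * x := VonNeumannAlgebra.mem_commutant_iff.1 hdc
    change t.τ (d * d * (x * y)) = t.τ (d * d * (y * x))
    rw [← mul_assoc, t.tracial _ (mul_mem (mul_mem hd hd) hx) _ hy]
    congr 1
    rw [← mul_assoc, ← mul_assoc, hc y hy, mul_assoc d y d, hc y hy]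
    noncomm_ring
  star_eq x hx := by
    change t.τ (d * d * star x) = starRingEnd ℂ (t.τ (d * d * x))
    rw [← t.star_eq _ (mul_mem (mul_mem hd hd) hx), star_mul, star_mul, hds,
      t.tracial _ (mul_mem hd hd) _ (star_mem hx)]
  nonneg x hx := by
    have hc : ∀ x ∈ M, x * d = d * x := VonNeumannAlgebra.mem_commutant_iff.1 hdc
    have : d * d * (star x * x) = star (d * x) * (d * x) := dd_eq hdc hds hx
    change 0 ≤ (t.τ (d * d * (star x * x))).re ∧ (t.τ (d * d * (star x * x))).im = 0
    rw [this]
    exact t.nonneg _ (mul_mem hd hx)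
  faithful x hx h := by
    have hc : ∀ x ∈ M, x * d = d * x := VonNeumannAlgebra.mem_commutant_iff.1 hdc
    have : d * d * (star x * x) = star (d * x) * (d * x) := dd_eq hdc hds hx
    change t.τ (d * d * (star x * x)) = 0 at h
    rw [this] at h
    have h2 := t.faithful _ (mul_mem hd hx) h
    ext v
    exact hinj _ (congrArg (fun f : H →L[ℂ] H => f v) h2)

theorem wt_normal (t : FT M) (d : H →L[ℂ] H) (hd : d ∈ M) (hdc : d ∈ M.commutant)
    (hds : star d = d) (hinj : ∀ ζ, d ζ = 0 → ζ = 0) (hsv : π t ⟨d, hd⟩ (sv t) = 0) :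
    ∀ ξ ∈ S (wt t d hd hdc hds hinj), ξ = 0 := by
  set t' := wt t d hd hdc hds hinj with ht'
  set D : Alg M := ⟨d, hd⟩ with hD
  have hDc : ∀ x : Alg M, x * D = D * x := fun x =>
    Subtype.ext (VonNeumannAlgebra.mem_commutant_iff.1 hdc x (mem_alg x))
  have hDs : star D = D := Subtype.ext hds
  have hn : ∀ x : Alg M, ‖hat t (D * x)‖ = ‖hat t' x‖ := by
    intro x
    have : ‖hat t (D * x)‖ ^ 2 = ‖hat t' x‖ ^ 2 := by
      rw [norm_hat_sq, norm_hat_sq]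
      change _ = (t.τ (d * d * (star (x : H →L[ℂ] H) * x))).re
      congr 2
      have e : star (D * x) * (D * x) = D * D * (star x * x) := by
        rw [star_mul, hDs, hDc (star x), ← mul_assoc, mul_assoc D, hDc (star x)]
        noncomm_ring
      exact congrArg Subtype.val e
    exact (sq_eq_sq₀ (norm_nonneg _) (norm_nonneg _)).1 this
  let U : K t' →L[ℂ] K t := ((hat t).comp (LinearMap.mulLeft ℂ D)).extendOfNorm (hat t')
  have hU : ∀ x, U (hat t' x) = hat t (D * x) := fun x =>
    LinearMap.extendOfNorm_eq (hat_dense t') ⟨1, fun y => by rw [one_mul]; exact (hn y).le⟩ x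
  clear_value U
  have hUn : ∀ a, ‖U a‖ = ‖a‖ := fun a =>
    ext_hat t' (f := fun a => ‖U a‖) (g := fun a => ‖a‖) (by fun_prop) (by fun_prop)
      (fun x => by simp only [hU, hn]) a
  have hUS : ∀ a, (S t).starProjection (U a) = 0 := fun a =>
    ext_hat t' (f := fun a => (S t).starProjection (U a)) (g := fun _ => 0) (by fun_prop)
      (by fun_prop) (fun x => by simp only [hU, π_sv]; rw [← hDc, π_mul, hsv, map_zero]) a
  have hB : ∀ ζ, Bdd t ζ → Bdd t' (d ζ) := by
    rintro ζ ⟨C, hC⟩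
    refine ⟨C, fun x => ?_⟩
    have h1 := hC (D * x)
    rw [hn, ← hDc] at h1
    exact h1
  have hT : ∀ ζ, Bdd t ζ → ∀ a, T t ζ (U a) = T t' (d ζ) a := fun ζ hζ a =>
    ext_hat t' (f := fun a => T t ζ (U a)) (g := fun a => T t' (d ζ) a) (by fun_prop) (by fun_prop)
      (fun x => by
        simp only [hU]
        rw [T_hat hζ, T_hat (hB ζ hζ), ← hDc]; rfl) a
  intro ξ hξ
  have h1 : U ξ ∈ S t := fun ζ hζ => by rw [hT ζ hζ]; exact hξ _ (hB ζ hζ)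
  have h2 := Submodule.starProjection_eq_self_iff.2 h1
  rw [hUS] at h2
  have h3 := hUn ξ
  rw [← h2, norm_zero] at h3
  exact norm_eq_zero.1 h3.symm

/-- the space of bounded vectors -/
def BV (t : FT M) : Submodule ℂ H where
  carrier := {ζ | Bdd t ζ}
  add_mem' ha hb := Bdd_add ha hb
  zero_mem' := Bdd_zero t
  smul_mem' c _ h := Bdd_smul c h

theorem BV_dense (t : FT M) (hS : ∀ ξ ∈ S t, ξ = 0) : Dense (BV t : Set H) := by
  set V := (BV t).topologicalClosure with hV
  have hyM : (1 - V.starProjection : H →L[ℂ] H) ∈ M :=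
    sub_mem one_mem' (proj_mem _ fun b hb => closure_inv _ fun v hv => Bdd_comm hb hv)
  have h0 : hat t ⟨_, hyM⟩ = 0 := by
    refine hS _ fun ζ hζ => ?_
    rw [T_hat hζ]
    change ζ - V.starProjection ζ = 0
    rw [Submodule.starProjection_eq_self_iff.2 ((BV t).le_topologicalClosure hζ), sub_self]
  rw [hat_eq_zero] at h0
  have h1 : (1 - V.starProjection : H →L[ℂ] H) = 0 := congrArg Subtype.val h0
  intro v
  have h2 : v - V.starProjection v = 0 := congrArg (fun f : H →L[ℂ] H => f v) h1
  rw [sub_eq_zero] at h2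
  have h3 : v ∈ V := by rw [h2]; exact Submodule.starProjection_apply_mem _ _
  exact h3

theorem exists_elem (t : FT M) (hS : ∀ ξ ∈ S t, ξ = 0) (ξ : K t) (C : ℝ)
    (h : ∀ ζ, Bdd t ζ → ‖T t ζ ξ‖ ≤ C * ‖ζ‖) : ∃ y : Alg M, hat t y = ξ := by
  let f : BV t →ₗ[ℂ] H :=
    { toFun := fun ζ => T t ζ ξ
      map_add' := fun a b => T_add a.2 b.2 ξ
      map_smul' := fun c a => T_smul c a.2 ξ }
  have hd : DenseRange (BV t).subtype := by
    have := BV_dense t hS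
    rw [DenseRange]
    simpa using this
  let y : H →L[ℂ] H := f.extendOfNorm (BV t).subtype
  have hy : ∀ ζ, Bdd t ζ → y ζ = T t ζ ξ := fun ζ hζ =>
    LinearMap.extendOfNorm_eq (f := f) hd ⟨C, fun a => h a a.2⟩ ⟨ζ, hζ⟩
  clear_value y
  have hyM : y ∈ M := by
    rw [← M.commutant_commutant, VonNeumannAlgebra.mem_commutant_iff]
    intro b hb
    ext v
    have hcl : IsClosed {v | b (y v) = y (b v)} :=
      isClosed_eq (b.continuous.comp y.continuous) (y.continuous.comp b.continuous)
    have hsub : (BV t : Set H) ⊆ {v | b (y v) = y (b v)} := by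
      intro ζ hζ
      change b (y ζ) = y (b ζ)
      rw [hy ζ hζ, hy _ (Bdd_comm hb hζ), T_comm hζ hb]
    exact (closure_minimal hsub hcl) (BV_dense t hS v)
  refine ⟨⟨y, hyM⟩, ?_⟩
  rw [← sub_eq_zero]
  refine hS _ fun ζ hζ => ?_
  rw [map_sub, T_hat hζ, sub_eq_zero]
  exact hy ζ hζ

/-- the image of the subalgebra -/
def NS (t : FT M) (N : VonNeumannAlgebra H) : Submodule ℂ (K t) :=
  Submodule.map (hat t) (Submodule.comap (M.toStarSubalgebra.subtype.toAlgHom.toLinearMap)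
    N.toStarSubalgebra.toSubalgebra.toSubmodule)

theorem mem_NS (t : FT M) (N : VonNeumannAlgebra H) (a : K t) :
    a ∈ NS t N ↔ ∃ n : Alg M, (n : H →L[ℂ] H) ∈ N ∧ hat t n = a := Iff.rfl

def W (t : FT M) (N : VonNeumannAlgebra H) : Submodule ℂ (K t) := (NS t N).topologicalClosure

instance (t : FT M) (N : VonNeumannAlgebra H) : CompleteSpace (W t N) :=
  (NS t N).isClosed_topologicalClosure.completeSpace_coe

theorem hat_mem_W (t : FT M) {N : VonNeumannAlgebra H} {n : Alg M} (h : (n : H →L[ℂ] H) ∈ N) :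
    hat t n ∈ W t N := (NS t N).le_topologicalClosure ⟨n, h, rfl⟩

theorem W_inv (t : FT M) (N : VonNeumannAlgebra H) (f : K t → K t) (hf : Continuous f)
    (h : ∀ n : Alg M, (n : H →L[ℂ] H) ∈ N → f (hat t n) ∈ W t N) : ∀ a ∈ W t N, f a ∈ W t N := by
  intro a ha
  have hcl : IsClosed (f ⁻¹' (W t N : Set (K t))) :=
    ((NS t N).isClosed_topologicalClosure).preimage hf
  refine closure_minimal ?_ hcl ha
  rintro _ ⟨n, hn, rfl⟩
  exact h n hn

theorem W_ext (t : FT M) (N : VonNeumannAlgebra H) {E : Type*} [TopologicalSpace E] [T2Space E]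
    (f g : K t → E) (hf : Continuous f) (hg : Continuous g)
    (h : ∀ n : Alg M, (n : H →L[ℂ] H) ∈ N → f (hat t n) = g (hat t n)) :
    ∀ a ∈ W t N, f a = g a := by
  intro a ha
  refine closure_minimal (t := {a | f a = g a}) ?_ (isClosed_eq hf hg) ha
  rintro _ ⟨n, hn, rfl⟩
  exact h n hn

theorem mem_N_of_hat (t : FT M) (hS : ∀ ξ ∈ S t, ξ = 0) (N : VonNeumannAlgebra H) (y : Alg M)
    (hy : hat t y ∈ W t N) : (y : H →L[ℂ] H) ∈ N := by
  rw [← N.commutant_commutant, VonNeumannAlgebra.mem_commutant_iff]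
  intro b hb
  have hbN := VonNeumannAlgebra.mem_commutant_iff.1 hb
  have hDn := BV_dense t hS
  have key : ∀ ζ, Bdd t ζ → ∀ η, Bdd t η →
      ⟪b ((y : H →L[ℂ] H) ζ), η⟫_ℂ = ⟪(y : H →L[ℂ] H) (b ζ), η⟫_ℂ := by
    intro ζ hζ η hη
    have e := W_ext t N (fun a => ⟪b (T t ζ a), η⟫_ℂ) (fun a => ⟪b ζ, T t η (J t a)⟫_ℂ)
      (by fun_prop) (by fun_prop) (fun n hn => by
        simp only [T_hat hζ, J_hat, T_hat hη]
        have h1 : b ((n : H →L[ℂ] H) ζ) = (n : H →L[ℂ] H) (b ζ) :=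
          (congrArg (fun f : H →L[ℂ] H => f ζ) (hbN n hn)).symm
        rw [h1, alg_star_apply]; rfl) _ hy
    simp only [T_hat hζ, J_hat, T_hat hη] at e
    rw [e, alg_star_apply (y : H →L[ℂ] H)]; rfl
  ext v
  have hcl : IsClosed {v | b ((y : H →L[ℂ] H) v) = (y : H →L[ℂ] H) (b v)} :=
    isClosed_eq (by fun_prop) (by fun_prop)
  refine closure_minimal ?_ hcl (hDn v)
  intro ζ hζ
  change b ((y : H →L[ℂ] H) ζ) = (y : H →L[ℂ] H) (b ζ)
  refine ext_inner_right ℂ fun η => ?_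
  have hcl2 : IsClosed {η | ⟪b ((y : H →L[ℂ] H) ζ), η⟫_ℂ = ⟪(y : H →L[ℂ] H) (b ζ), η⟫_ℂ} :=
    isClosed_eq (by fun_prop) (by fun_prop)
  exact closure_minimal (fun η hη => key ζ hζ η hη) hcl2 (hDn η)

end CDP

namespace CDP

open scoped InnerProductSpace ComplexConjugate
open Filter Topology

variable {H : Type} [NormedAddCommGroup H] [InnerProductSpace ℂ H] [CompleteSpace H]
variable {M : VonNeumannAlgebra H}

def Pr (t : FT M) (N : VonNeumannAlgebra H) : K t →L[ℂ] K t := (W t N).starProjection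

theorem Pr_mem (t : FT M) (N : VonNeumannAlgebra H) (a : K t) : Pr t N a ∈ W t N :=
  Submodule.starProjection_apply_mem _ _

theorem Pr_fix (t : FT M) (N : VonNeumannAlgebra H) {a : K t} (h : a ∈ W t N) : Pr t N a = a :=
  Submodule.starProjection_eq_self_iff.2 h

theorem Pr_inner (t : FT M) (N : VonNeumannAlgebra H) (a : K t) {w : K t} (h : w ∈ W t N) :
    ⟪a - Pr t N a, w⟫_ℂ = 0 := Submodule.starProjection_inner_eq_zero _ _ h

theorem Pr_eq (t : FT M) (N : VonNeumannAlgebra H) {a b : K t} (h : b ∈ W t N)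
    (h2 : ∀ w ∈ W t N, ⟪a - b, w⟫_ℂ = 0) : Pr t N a = b :=
  Submodule.eq_starProjection_of_mem_of_inner_eq_zero h h2

theorem Pr_sa (t : FT M) (N : VonNeumannAlgebra H) (a b : K t) :
    ⟪Pr t N a, b⟫_ℂ = ⟪a, Pr t N b⟫_ℂ := by
  have h1 := Pr_inner t N a (Pr_mem t N b)
  have h2 := Pr_inner t N b (Pr_mem t N a)
  rw [inner_sub_left, sub_eq_zero] at h1 h2
  rw [h1, ← inner_conj_symm, h2, inner_conj_symm]

theorem norm_Pr (t : FT M) (N : VonNeumannAlgebra H) (a : K t) : ‖Pr t N a‖ ≤ ‖a‖ := by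
  have := (Pr t N).le_opNorm a
  have h2 : ‖Pr t N‖ ≤ 1 := Submodule.starProjection_norm_le _
  nlinarith [norm_nonneg a]

theorem Pr_comm (t : FT M) (N : VonNeumannAlgebra H) (f g : K t →L[ℂ] K t)
    (hf : ∀ a ∈ W t N, f a ∈ W t N) (hg : ∀ a ∈ W t N, g a ∈ W t N)
    (h : ∀ a b, ⟪f a, b⟫_ℂ = ⟪a, g b⟫_ℂ) (a : K t) : Pr t N (f a) = f (Pr t N a) := by
  refine Pr_eq t N (hf _ (Pr_mem t N a)) fun w hw => ?_
  rw [← map_sub, h]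
  exact Pr_inner t N a (hg w hw)

theorem W_π (t : FT M) (N : VonNeumannAlgebra H) {n : Alg M} (hn : (n : H →L[ℂ] H) ∈ N) :
    ∀ a ∈ W t N, π t n a ∈ W t N :=
  W_inv t N _ (by fun_prop) fun m hm => by rw [π_hat]; exact hat_mem_W t (mul_mem hn hm)

theorem W_ρ (t : FT M) (N : VonNeumannAlgebra H) {n : Alg M} (hn : (n : H →L[ℂ] H) ∈ N) :
    ∀ a ∈ W t N, ρ t n a ∈ W t N :=
  W_inv t N _ (by fun_prop) fun m hm => by rw [ρ_hat]; exact hat_mem_W t (mul_mem hm hn)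

theorem W_J (t : FT M) (N : VonNeumannAlgebra H) : ∀ a ∈ W t N, J t a ∈ W t N :=
  W_inv t N _ (by fun_prop) fun m hm => by rw [J_hat]; exact hat_mem_W t (star_mem hm)

theorem Pr_π (t : FT M) (N : VonNeumannAlgebra H) {n : Alg M} (hn : (n : H →L[ℂ] H) ∈ N) (a : K t) :
    Pr t N (π t n a) = π t n (Pr t N a) :=
  Pr_comm t N _ (π t (star n)) (W_π t N hn) (W_π t N (n := star n) (star_mem hn)) (inner_π t n) a

theorem Pr_ρ (t : FT M) (N : VonNeumannAlgebra H) {n : Alg M} (hn : (n : H →L[ℂ] H) ∈ N) (a : K t) :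
    Pr t N (ρ t n a) = ρ t n (Pr t N a) :=
  Pr_comm t N _ (ρ t (star n)) (W_ρ t N hn) (W_ρ t N (n := star n) (star_mem hn)) (inner_ρ t n) a

theorem Pr_J (t : FT M) (N : VonNeumannAlgebra H) (a : K t) :
    Pr t N (J t a) = J t (Pr t N a) := by
  refine Pr_eq t N (W_J t N _ (Pr_mem t N a)) fun w hw => ?_
  rw [← map_sub, ← J_J t w, inner_J, ← inner_conj_symm, Pr_inner t N a (W_J t N w hw), map_zero]

theorem W_eq (t : FT M) (N : VonNeumannAlgebra H) {a b : K t} (ha : a ∈ W t N) (hb : b ∈ W t N)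
    (h : ∀ n : Alg M, (n : H →L[ℂ] H) ∈ N → ⟪a, hat t n⟫_ℂ = ⟪b, hat t n⟫_ℂ) : a = b := by
  have h1 := W_ext t N (fun w => ⟪a, w⟫_ℂ) (fun w => ⟪b, w⟫_ℂ) (by fun_prop) (by fun_prop) h
    (a - b) (sub_mem ha hb)
  rw [← sub_eq_zero, ← inner_sub_left, inner_self_eq_zero, sub_eq_zero] at h1
  exact h1

/-- sqrt commuting trick -/
theorem sqrt_bound {E : Type} [NormedAddCommGroup E] [InnerProductSpace ℂ E] [CompleteSpace E]
    (R L : E →L[ℂ] E) (hR : 0 ≤ R) (hc : Commute R L) (v : E) :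
    (⟪R (L v), L v⟫_ℂ).re ≤ ‖L‖ ^ 2 * (⟪R v, v⟫_ℂ).re := by
  have hx : IsSelfAdjoint R := IsSelfAdjoint.of_nonneg hR
  obtain ⟨q, hq, hqq, hqc⟩ : ∃ q : E →L[ℂ] E, star q = q ∧ q * q = R ∧ Commute q L := by
    refine ⟨cfc Real.sqrt R, (cfc_predicate Real.sqrt R : IsSelfAdjoint _).star_eq, ?_,
      Commute.cfc_real hc _⟩
    rw [← cfc_mul _ _ R]
    conv_rhs => rw [← cfc_id ℝ R]
    refine cfc_congr ?_
    intro y hy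
    exact Real.mul_self_sqrt (spectrum_nonneg_of_nonneg hR hy)
  have h1 : ∀ w, (⟪R w, w⟫_ℂ).re = ‖q w‖ ^ 2 := by
    intro w
    rw [← hqq]
    change (⟪q (q w), w⟫_ℂ).re = _
    rw [alg_star_apply, hq]
    exact inner_self_eq_norm_sq (𝕜 := ℂ) (q w)
  rw [h1, h1]
  have h2 : q (L v) = L (q v) := congrArg (fun f : E →L[ℂ] E => f v) hqc.eq
  rw [h2, ← mul_pow]
  exact pow_le_pow_left₀ (norm_nonneg _) (L.le_opNorm _) 2

theorem T_Pr_bound (t : FT M) (N : VonNeumannAlgebra H) (x : Alg M) {ζ : H}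
    (hζ : Bdd t ζ) : ‖T t ζ (Pr t N (hat t x))‖ ≤ ‖(x : H →L[ℂ] H)‖ * ‖ζ‖ := by
  set P := Pr t N with hP
  set A : K t →L[ℂ] H := (T t ζ).comp P with hA
  set R : K t →L[ℂ] K t := A.adjoint.comp A with hR
  set L : K t →L[ℂ] K t := P.comp ((π t x).comp P) with hL
  have hR0 : 0 ≤ R := by
    rw [ContinuousLinearMap.nonneg_iff_isPositive]
    exact ContinuousLinearMap.isPositive_adjoint_comp_self A
  have hRi : ∀ a b, ⟪R a, b⟫_ℂ = ⟪T t ζ (P a), T t ζ (P b)⟫_ℂ := by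
    intro a b
    exact ContinuousLinearMap.adjoint_inner_left A b (A a)
  have hRs : ∀ a b, ⟪R a, b⟫_ℂ = ⟪a, R b⟫_ℂ := by
    intro a b
    rw [hRi, ← inner_conj_symm a, hRi, inner_conj_symm]
  have hRW : ∀ a, R a ∈ W t N := by
    intro a
    have : R a = P (R a) := by
      refine ext_inner_right ℂ fun b => ?_
      rw [Pr_sa, hRi, hRi, Pr_fix t N (Pr_mem t N b)]
    rw [this]; exact Pr_mem t N _
  have hPP : ∀ a, P (P a) = P a := fun a => Pr_fix t N (Pr_mem t N a)
  have hLW : ∀ a, L a ∈ W t N := fun a => Pr_mem t N _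
  have hRP : ∀ a, R (P a) = R a := by
    intro a
    refine ext_inner_right ℂ fun b => ?_
    rw [hRi, hRi, hPP]
  have hLP : ∀ a, L (P a) = L a := by
    intro a
    change P (π t x (P (P a))) = P (π t x (P a))
    rw [hPP]
  have h1W : hat t 1 ∈ W t N := hat_mem_W t (n := 1) one_mem'
  have hL1 : L (hat t 1) = P (hat t x) := by
    change P (π t x (P (hat t 1))) = _
    rw [hP, Pr_fix t N h1W, π_hat, mul_one]
  set α := P (hat t x) with hα
  set γ := R (hat t 1) with hγ
  have hRn : ∀ n : Alg M, (n : H →L[ℂ] H) ∈ N → R (hat t n) = π t n γ := by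
    intro n hn
    refine W_eq t N (hRW _) (W_π t N hn _ (hRW _)) fun m hm => ?_
    rw [inner_π, hRi, π_hat, hγ, hRi, hP, Pr_fix t N (hat_mem_W t hn),
      Pr_fix t N (hat_mem_W t hm), Pr_fix t N h1W, 
      Pr_fix t N (hat_mem_W t (n := star n * m) (mul_mem (star_mem hn) hm)),
      T_hat hζ, T_hat hζ, T_hat hζ, T_hat hζ]
    change ⟪(n : H →L[ℂ] H) ζ, (m : H →L[ℂ] H) ζ⟫_ℂ = ⟪ζ, star (n : H →L[ℂ] H) ((m : H →L[ℂ] H) ζ)⟫_ℂ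
    rw [alg_star_apply]
  have hLn : ∀ n : Alg M, (n : H →L[ℂ] H) ∈ N → L (hat t n) = ρ t n α := by
    intro n hn
    change P (π t x (P (hat t n))) = _
    rw [hα, hP, ← Pr_ρ t N hn, Pr_fix t N (hat_mem_W t hn), π_hat, ρ_hat]
  have hLadj : ∀ a (n : Alg M), (n : H →L[ℂ] H) ∈ N →
      ⟪L a, hat t n⟫_ℂ = ⟪P a, ρ t n (J t α)⟫_ℂ := by
    intro a n hn
    change ⟪P (π t x (P a)), hat t n⟫_ℂ = _
    rw [hP, Pr_sa, Pr_fix t N (hat_mem_W t hn), inner_π, π_hat, hα, hP, ← Pr_J, J_hat,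
      ← Pr_ρ t N hn, ρ_hat, ← Pr_sa, Pr_fix t N (Pr_mem t N a)]
  have hJγ : J t γ = γ := by
    refine W_eq t N (W_J t N _ (hRW _)) (hRW _) fun n hn => ?_
    have e1 : ⟪J t γ, hat t n⟫_ℂ = ⟪hat t (star n), γ⟫_ℂ := by
      rw [← J_hat, ← inner_J, J_J]
    rw [e1, ← hRs, hRi, hγ, hRi, hP, Pr_fix t N (hat_mem_W t hn), Pr_fix t N h1W,
      Pr_fix t N (hat_mem_W t (n := star n) (star_mem hn)), T_hat hζ, T_hat hζ, T_hat hζ]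
    change ⟪star (n : H →L[ℂ] H) ζ, ζ⟫_ℂ = ⟪ζ, (n : H →L[ℂ] H) ζ⟫_ℂ
    rw [alg_star_apply, star_star]
  have hcomm : ∀ n : Alg M, (n : H →L[ℂ] H) ∈ N → R (L (hat t n)) = L (R (hat t n)) := by
    intro w hw
    refine W_eq t N (hRW _) (hLW _) fun y hy => ?_
    rw [hRs, hLn w hw, hRn y hy, hLadj _ y hy, hP, Pr_fix t N (hRW _), hRn w hw]
    rw [← inner_J, J_π, J_ρ, hJγ, inner_ρ, star_star, ← π_ρ, inner_π]
  have hc : Commute R L := by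
    change R * L = L * R
    ext a
    change R (L a) = L (R a)
    rw [← hLP, ← hRP a]
    exact W_ext t N (fun a => R (L a)) (fun a => L (R a)) (by fun_prop) (by fun_prop) hcomm _
      (Pr_mem t N a)
  have hb := sqrt_bound R L hR0 hc (hat t 1)
  rw [hL1, hRi, hRi, hα, hPP, hP, Pr_fix t N h1W, T_hat hζ] at hb
  have hLn' : ‖L‖ ≤ ‖(x : H →L[ℂ] H)‖ := by
    refine ContinuousLinearMap.opNorm_le_bound _ (norm_nonneg _) fun a => ?_
    calc ‖P (π t x (P a))‖ ≤ ‖π t x (P a)‖ := norm_Pr t N _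
      _ ≤ ‖(x : H →L[ℂ] H)‖ * ‖P a‖ := norm_π_le t x _
      _ ≤ _ := mul_le_mul_of_nonneg_left (norm_Pr t N a) (norm_nonneg _)
  have e1 := inner_self_eq_norm_sq (𝕜 := ℂ) (T t ζ (Pr t N (hat t x)))
  have e2 := inner_self_eq_norm_sq (𝕜 := ℂ) (((1 : Alg M) : H →L[ℂ] H) ζ)
  have e3 : ((1 : Alg M) : H →L[ℂ] H) ζ = ζ := rfl
  simp only [RCLike.re_eq_complex_re] at e1 e2
  rw [e1, e2, e3] at hb
  refine (sq_le_sq₀ (norm_nonneg _) (by positivity)).1 ?_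
  rw [mul_pow]
  refine hb.trans (mul_le_mul_of_nonneg_right ?_ (sq_nonneg _))
  exact pow_le_pow_left₀ (norm_nonneg _) hLn' 2

theorem exists_EN (t : FT M) (hS : ∀ ξ ∈ S t, ξ = 0) (N : VonNeumannAlgebra H) (x : Alg M) :
    ∃ y : Alg M, (y : H →L[ℂ] H) ∈ N ∧ hat t y = Pr t N (hat t x) := by
  obtain ⟨y, hy⟩ := exists_elem t hS (Pr t N (hat t x)) _ fun ζ hζ => T_Pr_bound t N x hζ
  exact ⟨y, mem_N_of_hat t hS N y (by rw [hy]; exact Pr_mem t N _), hy⟩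

/-- summary of the normal trace and conditional expectation -/
theorem exists_normal (t : FT M) : ∃ (d : H →L[ℂ] H) (t' : FT M),
    d ∈ M ∧ d ∈ M.commutant ∧ star d = d ∧
    (∀ x, t'.τ x = t.τ (d * d * x)) ∧
    ∀ N : VonNeumannAlgebra H, (∀ n ∈ N, n ∈ M) → ∀ x ∈ M, ∃ y ∈ N,
      (∀ n ∈ N, t'.τ (n * y) = t'.τ (n * x)) ∧
      (t'.τ (star y * y)).re ≤ (t'.τ (star x * x)).re := by
  obtain ⟨d, ⟨hdM, hsv⟩, hdc, hds, hinj⟩ := exists_d t (LI_singular t)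
  refine ⟨d, wt t d hdM hdc hds hinj, hdM, hdc, hds, fun x => rfl, ?_⟩
  intro N hNM x hx
  have hS := wt_normal t d hdM hdc hds hinj hsv
  set t' := wt t d hdM hdc hds hinj
  obtain ⟨y, hyN, hy⟩ := exists_EN t' hS N ⟨x, hx⟩
  refine ⟨y, hyN, ?_, ?_⟩
  · intro n hn
    have h1 := Pr_inner t' N (hat t' ⟨x, hx⟩)
      (hat_mem_W t' (n := ⟨star n, star_mem (hNM n hn)⟩) (star_mem hn))
    rw [← hy, inner_sub_left, sub_eq_zero, ← inner_conj_symm, ← inner_conj_symm (hat t' y),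
      inner_hat, inner_hat] at h1
    have h2 := (starRingEnd ℂ).injective h1
    simp only [star_star] at h2
    exact h2.symm
  · have h1 := norm_Pr t' N (hat t' ⟨x, hx⟩)
    rw [← hy] at h1
    have h2 := pow_le_pow_left₀ (norm_nonneg _) h1 2
    rwa [norm_hat_sq, norm_hat_sq] at h2

end CDP

namespace CDP

open CD

variable {H : Type} [NormedAddCommGroup H] [InnerProductSpace ℂ H] [CompleteSpace H]
variable {M : VonNeumannAlgebra H}

/-- the 2-norm of a trace -/
def nt (t : FT M) (x : H →L[ℂ] H) : ℝ := Real.sqrt (t.τ (star x * x)).re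

theorem nt_eq (t : FT M) {x : H →L[ℂ] H} (hx : x ∈ M) : nt t x = ‖hat t ⟨x, hx⟩‖ := by
  unfold nt
  rw [← norm_hat_sq t ⟨x, hx⟩, Real.sqrt_sq (norm_nonneg _)]

theorem nt_nonneg (t : FT M) (x : H →L[ℂ] H) : 0 ≤ nt t x := Real.sqrt_nonneg _

theorem nt_sq (t : FT M) {x : H →L[ℂ] H} (hx : x ∈ M) : nt t x ^ 2 = (t.τ (star x * x)).re :=
  Real.sq_sqrt (t.nonneg x hx).1

theorem nt_add_le (t : FT M) {x y : H →L[ℂ] H} (hx : x ∈ M) (hy : y ∈ M) :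
    nt t (x + y) ≤ nt t x + nt t y := by
  rw [nt_eq t hx, nt_eq t hy, nt_eq t (add_mem hx hy)]
  have : hat t ⟨x + y, add_mem hx hy⟩ = hat t ⟨x, hx⟩ + hat t ⟨y, hy⟩ := by
    rw [← map_add]; rfl
  rw [this]
  exact norm_add_le _ _

theorem nt_neg (t : FT M) (x : H →L[ℂ] H) : nt t (-x) = nt t x := by
  unfold nt
  rw [star_neg, neg_mul_neg]

theorem nt_sub_le (t : FT M) {x y : H →L[ℂ] H} (hx : x ∈ M) (hy : y ∈ M) :
    nt t (x - y) ≤ nt t x + nt t y := by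
  rw [sub_eq_add_neg, ← nt_neg t y]
  exact nt_add_le t hx (neg_mem hy)

theorem nt_zero (t : FT M) : nt t 0 = 0 := by simp [nt]

theorem nt_mul_le (t : FT M) {x y : H →L[ℂ] H} (hx : x ∈ M) (hy : y ∈ M) :
    nt t (x * y) ≤ ‖x‖ * nt t y := by
  rw [nt_eq t hy, nt_eq t (mul_mem hx hy)]
  exact norm_hat_mul_le t ⟨x, hx⟩ ⟨y, hy⟩

theorem nt_eq_zero (t : FT M) {x : H →L[ℂ] H} (hx : x ∈ M) (h : nt t x ≤ 0) : x = 0 := by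
  refine trace_eq_zero t hx ?_
  rw [← nt_sq t hx, le_antisymm h (nt_nonneg t x)]
  simp

theorem nt_sum_le (t : FT M) {ι : Type} (s : Finset ι) (x : ι → (H →L[ℂ] H))
    (hx : ∀ i ∈ s, x i ∈ M) : nt t (∑ i ∈ s, x i) ≤ ∑ i ∈ s, nt t (x i) := by
  induction s using Finset.induction_on with
  | empty => simp [nt_zero]
  | insert a s ha ih =>
    rw [Finset.sum_insert ha, Finset.sum_insert ha]
    have h1 := ih fun i hi => hx i (Finset.mem_insert_of_mem hi)
    have h2 := nt_add_le t (hx a (Finset.mem_insert_self _ _))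
      (show ∑ i ∈ s, x i ∈ M from sum_mem fun i hi => hx i (Finset.mem_insert_of_mem hi))
    linarith

variable {Γ : Type} [Group Γ]

theorem A_M (X : CrossedProduct Γ H) {a : H →L[ℂ] H} (h : a ∈ X.A) : a ∈ X.M := X.A_sub h

theorem E_A (X : CrossedProduct Γ H) {x : H →L[ℂ] H} (h : x ∈ X.M) : X.EA.E x ∈ X.A :=
  X.EA.mem x h

theorem E_M (X : CrossedProduct Γ H) {x : H →L[ℂ] H} (h : x ∈ X.M) : X.EA.E x ∈ X.M :=
  A_M X (E_A X h)

theorem E_fix (X : CrossedProduct Γ H) {a : H →L[ℂ] H} (h : a ∈ X.A) : X.EA.E a = a :=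
  X.EA.fix a h

theorem E_left (X : CrossedProduct Γ H) {a x : H →L[ℂ] H} (h : a ∈ X.A) (hx : x ∈ X.M) :
    X.EA.E (a * x) = a * X.EA.E x := by
  have := X.EA.bimod a h 1 (one_mem' (M := X.A)) x hx
  simpa using this

theorem u_inv_mul (X : CrossedProduct Γ H) (g : Γ) : star (X.u g) * X.u g = 1 := by
  rw [X.u_star, X.u_mul, inv_mul_cancel, X.u_one]

theorem u_mul_inv (X : CrossedProduct Γ H) (g : Γ) : X.u g * star (X.u g) = 1 := by
  rw [X.u_star, X.u_mul, mul_inv_cancel, X.u_one]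

theorem su_mem (X : CrossedProduct Γ H) (g : Γ) : star (X.u g) ∈ X.M := star_mem (X.u_mem g)

theorem conj_mem' (X : CrossedProduct Γ H) (g : Γ) {a : H →L[ℂ] H} (h : a ∈ X.A) :
    star (X.u g) * a * X.u g ∈ X.A := by
  have := X.conj_mem g⁻¹ a h
  rwa [X.u_star g⁻¹, inv_inv, ← X.u_star g] at this

/-- the given trace -/
def tr0 (X : CrossedProduct Γ H) : FT X.M where
  τ := X.tr.τ
  tracial := X.tr.tracial
  star_eq := X.tr.star_eq
  nonneg := X.tr.nonneg
  faithful := X.tr.faithful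

/-- E preserves t -/
def Pres (X : CrossedProduct Γ H) (t : FT X.M) : Prop := ∀ x ∈ X.M, t.τ (X.EA.E x) = t.τ x

theorem pres0 (X : CrossedProduct Γ H) : Pres X (tr0 X) := X.EA.trace_eq

theorem pres_left {X : CrossedProduct Γ H} {t : FT X.M} (hE : Pres X t) {a x : H →L[ℂ] H}
    (h : a ∈ X.A) (hx : x ∈ X.M) : t.τ (a * X.EA.E x) = t.τ (a * x) := by
  rw [← E_left X h hx, hE _ (mul_mem (A_M X h) hx)]

theorem E_conj (X : CrossedProduct Γ H) (g : Γ) {x : H →L[ℂ] H} (hx : x ∈ X.M) :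
    X.EA.E (X.u g * x * star (X.u g)) = X.u g * X.EA.E x * star (X.u g) := by
  have hum := X.u_mem g
  have hsm := su_mem X g
  have hm : X.u g * x * star (X.u g) ∈ X.M := mul_mem (mul_mem hum hx) hsm
  have hA : X.EA.E (X.u g * x * star (X.u g)) - X.u g * X.EA.E x * star (X.u g) ∈ X.A :=
    sub_mem (E_A X hm) (X.conj_mem g _ (E_A X hx))
  set z := X.EA.E (X.u g * x * star (X.u g)) - X.u g * X.EA.E x * star (X.u g) with hz
  have key : ∀ w ∈ X.M, (tr0 X).τ (star z * (X.u g * w * star (X.u g))) =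
      (tr0 X).τ ((star (X.u g) * star z * X.u g) * w) := by
    intro w hw
    rw [← mul_assoc, (tr0 X).tracial _ (mul_mem (star_mem (A_M X hA)) (mul_mem hum hw)) _ hsm]
    simp only [mul_assoc]
  have h0 : (tr0 X).τ (star z * z) = 0 := by
    have : star z * z = star z * X.EA.E (X.u g * x * star (X.u g)) -
        star z * (X.u g * X.EA.E x * star (X.u g)) := by
      rw [← mul_sub]
    rw [this, map_sub, pres_left (pres0 X) (star_mem hA) hm, key _ hx, key _ (E_M X hx),
      pres_left (pres0 X) (conj_mem' X g (star_mem hA)) hx, sub_self]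
  exact sub_eq_zero.1 ((tr0 X).faithful z (A_M X hA) h0)

theorem E_u_star (X : CrossedProduct Γ H) (g : Γ) (h : g ≠ 1) : X.EA.E (star (X.u g)) = 0 := by
  rw [X.u_star]
  exact X.EA_u _ (inv_ne_one.2 h)

theorem E_contr {X : CrossedProduct Γ H} {t : FT X.M} (hE : Pres X t) {x : H →L[ℂ] H}
    (hx : x ∈ X.M) : nt t (X.EA.E x) ≤ nt t x := by
  have hEx := E_A X hx
  have h1 := (t.nonneg (x - X.EA.E x) (sub_mem hx (E_M X hx))).1
  have e1 : t.τ (star (X.EA.E x) * x) = t.τ (star (X.EA.E x) * X.EA.E x) :=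
    (pres_left hE (star_mem hEx) hx).symm
  have e2 : t.τ (star x * X.EA.E x) = t.τ (star (X.EA.E x) * X.EA.E x) := by
    have h := t.star_eq _ (mul_mem (star_mem (A_M X hEx)) hx)
    rw [star_mul, star_star, e1, ← t.star_eq _ (mul_mem (star_mem (A_M X hEx)) (A_M X hEx)),
      star_mul, star_star] at h
    exact h
  have e3 : star (x - X.EA.E x) * (x - X.EA.E x) = star x * x - star x * X.EA.E x -
      (star (X.EA.E x) * x - star (X.EA.E x) * X.EA.E x) := by
    rw [star_sub]; noncomm_ring
  rw [e3, map_sub, map_sub, map_sub, e1, e2, sub_self, sub_zero, Complex.sub_re] at h1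
  exact Real.sqrt_le_sqrt (by linarith)

/-- Fourier coefficient -/
def cf (X : CrossedProduct Γ H) (x : H →L[ℂ] H) (g : Γ) : H →L[ℂ] H := X.EA.E (x * star (X.u g))

theorem cf_A (X : CrossedProduct Γ H) {x : H →L[ℂ] H} (hx : x ∈ X.M) (g : Γ) : cf X x g ∈ X.A :=
  E_A X (mul_mem hx (su_mem X g))

theorem cf_sub (X : CrossedProduct Γ H) (x y : H →L[ℂ] H) (g : Γ) :
    cf X (x - y) g = cf X x g - cf X y g := by
  unfold cf; rw [sub_mul, map_sub]

theorem cf_left (X : CrossedProduct Γ H) {a x : H →L[ℂ] H} (ha : a ∈ X.A) (hx : x ∈ X.M) (g : Γ) :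
    cf X (a * x) g = a * cf X x g := by
  unfold cf; rw [mul_assoc, E_left X ha (mul_mem hx (su_mem X g))]

theorem cf_sum (X : CrossedProduct Γ H) {ι : Type} (s : Finset ι) (x : ι → H →L[ℂ] H) (g : Γ) :
    cf X (∑ i ∈ s, x i) g = ∑ i ∈ s, cf X (x i) g := by
  unfold cf; rw [Finset.sum_mul, map_sum]

theorem cf_A_ne (X : CrossedProduct Γ H) {a : H →L[ℂ] H} (ha : a ∈ X.A) {g : Γ} (hg : g ≠ 1) :
    cf X a g = 0 := by
  unfold cf
  rw [E_left X ha (su_mem X g), E_u_star X g hg, mul_zero]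

theorem cf_one (X : CrossedProduct Γ H) (x : H →L[ℂ] H) : cf X x 1 = X.EA.E x := by
  unfold cf; rw [X.u_one, star_one, mul_one]

theorem cf_u (X : CrossedProduct Γ H) (g h : Γ) : cf X (X.u g) h = if g = h then 1 else 0 := by
  unfold cf
  rw [X.u_star, X.u_mul]
  split_ifs with e
  · rw [e, mul_inv_cancel, X.u_one]; exact E_fix X (one_mem' (M := X.A))
  · exact X.EA_u _ (fun h' => e (mul_inv_eq_one.1 h'))

theorem cf_nt {X : CrossedProduct Γ H} {t : FT X.M} (hE : Pres X t) {x : H →L[ℂ] H}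
    (hx : x ∈ X.M) (g : Γ) : nt t (cf X x g) ≤ nt t x := by
  refine (E_contr hE (mul_mem hx (su_mem X g))).trans (le_of_eq ?_)
  unfold nt
  rw [star_mul, star_star, t.tracial _ (mul_mem (X.u_mem g) (star_mem hx)) _
    (mul_mem hx (su_mem X g))]
  have : x * star (X.u g) * (X.u g * star x) = x * (star (X.u g) * X.u g) * star x := by
    simp only [mul_assoc]
  rw [this, u_inv_mul, mul_one, t.tracial _ hx _ (star_mem hx)]

theorem nt_conj {X : CrossedProduct Γ H} (t : FT X.M) {x : H →L[ℂ] H}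
    (hx : x ∈ X.M) (g : Γ) : nt t (X.u g * x * star (X.u g)) = nt t x := by
  unfold nt
  have : star (X.u g * x * star (X.u g)) * (X.u g * x * star (X.u g)) =
      X.u g * (star x * (star (X.u g) * X.u g) * x * star (X.u g)) := by
    simp only [star_mul, star_star, mul_assoc]
  rw [this, u_inv_mul, mul_one, t.tracial _ (X.u_mem g) _
    (mul_mem (mul_mem (star_mem hx) hx) (su_mem X g)), mul_assoc, u_inv_mul, mul_one]

/-- conjugating coefficients -/
theorem cf_conj (X : CrossedProduct Γ H) {x : H →L[ℂ] H} (hx : x ∈ X.M) (γ g : Γ) :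
    cf X (X.u γ * x * star (X.u γ)) (γ * g * γ⁻¹) = X.u γ * cf X x g * star (X.u γ) := by
  unfold cf
  rw [← E_conj X γ (mul_mem hx (su_mem X g))]
  congr 1
  simp only [mul_assoc, X.u_star, X.u_mul]
  congr 3
  group

theorem mem_A_of_cf (X : CrossedProduct Γ H) {x : H →L[ℂ] H} (hx : x ∈ X.M)
    (h : ∀ g : Γ, g ≠ 1 → cf X x g = 0) : x ∈ X.A := by
  have h0 : x - X.EA.E x = 0 := by
    refine X.fourier_sep _ (sub_mem hx (E_M X hx)) fun g => ?_
    change cf X _ g = 0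
    rw [cf_sub]
    by_cases hg : g = 1
    · rw [hg, cf_one, cf_one, E_fix X (E_A X hx), sub_self]
    · rw [h g hg, cf_A_ne X (E_A X hx) hg, sub_zero]
  rw [sub_eq_zero.1 h0]
  exact E_A X hx

theorem bessel_step {X : CrossedProduct Γ H} {t : FT X.M} (hE : Pres X t) {z : H →L[ℂ] H}
    (hz : z ∈ X.M) (g : Γ) :
    (t.τ (star (z - cf X z g * X.u g) * (z - cf X z g * X.u g))).re +
      (t.τ (star (cf X z g) * cf X z g)).re = (t.τ (star z * z)).re := by
  have hc := cf_A X hz g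
  have hcM := A_M X hc
  have hu := X.u_mem g
  have e1 : t.τ (star (cf X z g * X.u g) * z) = t.τ (star (cf X z g) * cf X z g) := by
    rw [star_mul, mul_assoc, t.tracial _ (su_mem X g) _ (mul_mem (star_mem hcM) hz), mul_assoc,
      ← pres_left hE (star_mem hc) (mul_mem hz (su_mem X g))]
    rfl
  have e2 : t.τ (star z * (cf X z g * X.u g)) = t.τ (star (cf X z g) * cf X z g) := by
    have h := t.star_eq _ (mul_mem (star_mem (mul_mem hcM hu)) hz)
    rw [star_mul, star_star, e1, ← t.star_eq _ (mul_mem (star_mem hcM) hcM),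
      star_mul (star (cf X z g)), star_star] at h
    exact h
  have e4 : t.τ (star (cf X z g * X.u g) * (cf X z g * X.u g)) =
      t.τ (star (cf X z g) * cf X z g) := by
    rw [star_mul, mul_assoc, t.tracial _ (su_mem X g) _ (mul_mem (star_mem hcM) (mul_mem hcM hu))]
    simp only [mul_assoc]
    rw [u_mul_inv, mul_one]
  have e3 : star (z - cf X z g * X.u g) * (z - cf X z g * X.u g) =
      star z * z - star z * (cf X z g * X.u g) -
      (star (cf X z g * X.u g) * z - star (cf X z g * X.u g) * (cf X z g * X.u g)) := by
    rw [star_sub]; noncomm_ring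
  rw [e3, map_sub, map_sub, map_sub, e1, e2, e4, sub_self, sub_zero, Complex.sub_re]
  ring

theorem bessel {X : CrossedProduct Γ H} {t : FT X.M} (hE : Pres X t) {x : H →L[ℂ] H}
    (hx : x ∈ X.M) (F : Finset Γ) : ∃ z ∈ X.M, (∀ h, h ∉ F → cf X z h = cf X x h) ∧
      nt t z ^ 2 + ∑ g ∈ F, nt t (cf X x g) ^ 2 = nt t x ^ 2 := by
  induction F using Finset.induction_on with
  | empty => exact ⟨x, hx, fun _ _ => rfl, by simp⟩
  | insert g F hg ih =>
    obtain ⟨z, hz, h1, h2⟩ := ih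
    have hzc := A_M X (cf_A X hz g)
    have hm : z - cf X z g * X.u g ∈ X.M := sub_mem hz (mul_mem hzc (X.u_mem g))
    refine ⟨z - cf X z g * X.u g, hm, ?_, ?_⟩
    · intro h hh
      rw [Finset.mem_insert, not_or] at hh
      rw [cf_sub, cf_left X (cf_A X hz g) (X.u_mem g), cf_u, if_neg (fun e => hh.1 e.symm),
        mul_zero, sub_zero, h1 h hh.2]
    · have h3 := bessel_step hE hz g
      rw [← nt_sq t hm, ← nt_sq t hzc, ← nt_sq t hz, h1 g hg] at h3
      rw [Finset.sum_insert hg, h1 g hg, ← h2, ← h3]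
      ring

theorem finite_bad {X : CrossedProduct Γ H} {t : FT X.M} (hE : Pres X t) {x : H →L[ℂ] H}
    (hx : x ∈ X.M) {ε : ℝ} (hε : 0 < ε) : {g : Γ | ε ≤ nt t (cf X x g)}.Finite := by
  by_contra hinf
  obtain ⟨n, hn⟩ := exists_nat_gt (nt t x ^ 2 / ε ^ 2)
  obtain ⟨F, hF, hFn⟩ := Set.Infinite.exists_subset_card_eq hinf n
  obtain ⟨z, hz, -, h2⟩ := bessel hE hx F
  have h3 : ∑ g ∈ F, ε ^ 2 ≤ ∑ g ∈ F, nt t (cf X x g) ^ 2 :=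
    Finset.sum_le_sum fun g hg => pow_le_pow_left₀ hε.le (hF hg) 2
  rw [Finset.sum_const, hFn, nsmul_eq_mul] at h3
  rw [div_lt_iff₀ (by positivity)] at hn
  nlinarith [sq_nonneg (nt t z)]

theorem icc_avoid (hicc : IsICC Γ) {g : Γ} (hg : g ≠ 1) {B : Set Γ} (hB : B.Finite) :
    ∃ γ : Γ, γ * g * γ⁻¹ ∉ B := by
  by_contra! h
  refine hicc g hg (hB.subset ?_)
  rintro _ ⟨γ, rfl⟩
  exact h γ

theorem center_mem_A (hicc : IsICC Γ) (X : CrossedProduct Γ H) {d : H →L[ℂ] H} (hd : d ∈ X.M)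
    (hc : d ∈ X.M.commutant) : d ∈ X.A := by
  have hcc := VonNeumannAlgebra.mem_commutant_iff.1 hc
  refine mem_A_of_cf X hd fun g hg => ?_
  have hM := A_M X (cf_A X hd g)
  refine nt_eq_zero (tr0 X) hM ?_
  by_contra! hpos
  obtain ⟨γ, hγ⟩ := icc_avoid hicc hg (finite_bad (pres0 X) hd hpos)
  refine hγ ?_
  have h1 := cf_conj X hd γ g
  rw [hcc _ (X.u_mem γ), mul_assoc, u_mul_inv, mul_one] at h1
  change _ ≤ nt (tr0 X) _
  rw [h1, nt_conj _ hM]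

end CDP

namespace CDP

open CD

variable {H : Type} [NormedAddCommGroup H] [InnerProductSpace ℂ H] [CompleteSpace H]
variable {M : VonNeumannAlgebra H}
variable {Γ : Type} [Group Γ]

/-- `y` is the conditional expectation of `x` onto `N`. -/
def IsEN (t : FT M) (N : VonNeumannAlgebra H) (y x : H →L[ℂ] H) : Prop :=
  y ∈ N ∧ x ∈ M ∧ ∀ n ∈ N, t.τ (n * y) = t.τ (n * x)

theorem IsEN.uniq {t : FT M} {N : VonNeumannAlgebra H} (hN : ∀ n ∈ N, n ∈ M)
    {y y' x : H →L[ℂ] H} (h : IsEN t N y x) (h' : IsEN t N y' x) : y = y' := by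
  have hd := sub_mem h.1 h'.1
  refine sub_eq_zero.1 (t.faithful _ (hN _ hd) ?_)
  have : t.τ (star (y - y') * (y - y')) =
      t.τ (star (y - y') * y) - t.τ (star (y - y') * y') := by
    rw [← map_sub, ← mul_sub]
  rw [this, h.2.2 _ (star_mem hd), h'.2.2 _ (star_mem hd), sub_self]

theorem IsEN.sub {t : FT M} {N : VonNeumannAlgebra H} {y y' x x' : H →L[ℂ] H}
    (h : IsEN t N y x) (h' : IsEN t N y' x') : IsEN t N (y - y') (x - x') :=
  ⟨sub_mem h.1 h'.1, sub_mem h.2.1 h'.2.1, fun n hn => by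
    rw [mul_sub, mul_sub, map_sub, map_sub, h.2.2 n hn, h'.2.2 n hn]⟩

theorem IsEN.smul {t : FT M} {N : VonNeumannAlgebra H} {y x : H →L[ℂ] H}
    (h : IsEN t N y x) (c : ℂ) : IsEN t N (c • y) (c • x) :=
  ⟨smul_mem' c h.1, smul_mem' c h.2.1, fun n hn => by
    rw [mul_smul_comm, mul_smul_comm, map_smul, map_smul, h.2.2 n hn]⟩

theorem IsEN.sum {t : FT M} {N : VonNeumannAlgebra H} {ι : Type} {s : Finset ι}
    {y x : ι → H →L[ℂ] H} (h : ∀ i ∈ s, IsEN t N (y i) (x i)) :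
    IsEN t N (∑ i ∈ s, y i) (∑ i ∈ s, x i) :=
  ⟨sum_mem fun i hi => (h i hi).1, sum_mem fun i hi => (h i hi).2.1, fun n hn => by
    rw [Finset.mul_sum, Finset.mul_sum, map_sum, map_sum]
    exact Finset.sum_congr rfl fun i hi => (h i hi).2.2 n hn⟩

theorem IsEN.bimod {t : FT M} {N : VonNeumannAlgebra H} (hN : ∀ n ∈ N, n ∈ M)
    {y x a b : H →L[ℂ] H} (h : IsEN t N y x) (ha : a ∈ N) (hb : b ∈ N) :
    IsEN t N (a * y * b) (a * x * b) := by
  refine ⟨mul_mem (mul_mem ha h.1) hb, mul_mem (mul_mem (hN _ ha) h.2.1) (hN _ hb), ?_⟩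
  intro n hn
  have key : ∀ w ∈ M, t.τ (n * (a * w * b)) = t.τ (b * n * a * w) := by
    intro w hw
    have : n * (a * w * b) = (n * a * w) * b := by simp only [mul_assoc]
    rw [this, t.tracial _ (mul_mem (mul_mem (hN _ hn) (hN _ ha)) hw) _ (hN _ hb)]
    simp only [mul_assoc]
  rw [key y (hN _ h.1), key x h.2.1, h.2.2 _ (mul_mem (mul_mem hb hn) ha)]

theorem IsEN.left {t : FT M} {N : VonNeumannAlgebra H} (hN : ∀ n ∈ N, n ∈ M)
    {y x a : H →L[ℂ] H} (h : IsEN t N y x) (ha : a ∈ N) : IsEN t N (a * y) (a * x) := by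
  simpa using h.bimod hN ha (one_mem' (M := N))

section main

variable {X : CrossedProduct Γ H} {t : FT X.M} {N P₀ : VonNeumannAlgebra H} {D : ℝ}

theorem step_f (hicc : IsICC Γ) (hE : Pres X t) (hD : 0 ≤ D)
    (hDn : ∀ x ∈ X.M, nt t x ≤ D * X.tr.norm2 x) (hN : ∀ n ∈ N, n ∈ X.M)
    (hex : ∀ x ∈ X.M, ∃ y, IsEN t N y x) (hnt : ∀ x y, IsEN t N y x → nt t y ≤ nt t x)
    (huN : ∀ g, X.u g ∈ N) (hP : ∀ p ∈ P₀, p ∈ X.A) (hPN : ∀ p ∈ P₀, p ∈ N)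
    {f y : H →L[ℂ] H} (hfA : f ∈ X.A)
    (hf : ∀ ε : ℝ, 0 < ε → ∃ (n : ℕ) (ξ : Fin n → (H →L[ℂ] H)) (C : ℝ),
      (∀ i, ξ i ∈ X.A) ∧
      ∀ γ : Γ, ∃ κ : Fin n → (H →L[ℂ] H), (∀ i, κ i ∈ P₀) ∧ (∀ i, ‖κ i‖ ≤ C) ∧
        X.tr.norm2 (X.σ γ f - ∑ i, κ i * ξ i) ≤ ε)
    (hy : IsEN t N y f) : y ∈ X.A := by
  have hyM := hN _ hy.1
  refine mem_A_of_cf X hyM fun g hg => ?_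
  have hcM := A_M X (cf_A X hyM g)
  refine nt_eq_zero t hcM ?_
  by_contra! hpos
  set δ := nt t (cf X y g) with hδ
  obtain ⟨n, ξ, C, hξ, hκ⟩ := hf (δ / (4 * (D + 1))) (by positivity)
  choose w hw using fun i => hex (ξ i) (A_M X (hξ i))
  have hwM : ∀ i, w i ∈ X.M := fun i => hN _ (hw i).1
  have hη : 0 < δ / (4 * ((n + 1) * (|C| + 1))) := by positivity
  set η := δ / (4 * ((n + 1) * (|C| + 1))) with hηd
  have hB : (⋃ i, {h : Γ | η ≤ nt t (cf X (w i) h)}).Finite :=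
    Set.finite_iUnion fun i => finite_bad hE (hwM i) hη
  obtain ⟨γ, hγ⟩ := icc_avoid hicc hg hB
  set h := γ * g * γ⁻¹ with hh
  obtain ⟨κ, hκ0, hκC, hκε⟩ := hκ γ
  have hEN : IsEN t N (X.u γ * y * star (X.u γ) - ∑ i, κ i * w i) (X.σ γ f - ∑ i, κ i * ξ i) :=
    (hy.bimod hN (huN γ) (star_mem (huN γ))).sub
      (IsEN.sum fun i _ => (hw i).left hN (hPN _ (hκ0 i)))
  have h1 := (hnt _ _ hEN).trans (hDn _ hEN.2.1)
  have h2 := (cf_nt hE (hN _ hEN.1) h).trans h1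
  rw [cf_sub, hh, cf_conj X hyM γ g, cf_sum, ← hh] at h2
  have hkm : ∀ i, κ i * cf X (w i) h ∈ X.M := fun i =>
    mul_mem (A_M X (hP _ (hκ0 i))) (A_M X (cf_A X (hwM i) h))
  have e : ∑ i, cf X (κ i * w i) h = ∑ i, κ i * cf X (w i) h :=
    Finset.sum_congr rfl fun i _ => cf_left X (hP _ (hκ0 i)) (hwM i) h
  rw [e] at h2
  have hum : X.u γ * cf X y g * star (X.u γ) ∈ X.M := mul_mem (mul_mem (X.u_mem γ) hcM) (su_mem X γ)
  have hsm : ∑ i, κ i * cf X (w i) h ∈ X.M := sum_mem fun i _ => hkm i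
  have h3 := nt_add_le t (sub_mem hum hsm) hsm
  rw [sub_add_cancel, nt_conj t hcM, ← hδ] at h3
  have h4 : nt t (∑ i, κ i * cf X (w i) h) ≤ n * (|C| * η) := by
    refine (nt_sum_le t _ _ fun i _ => hkm i).trans ?_
    have : ∑ i : Fin n, nt t (κ i * cf X (w i) h) ≤ ∑ i : Fin n, |C| * η := by
      refine Finset.sum_le_sum fun i _ => ?_
      refine (nt_mul_le t (A_M X (hP _ (hκ0 i))) (A_M X (cf_A X (hwM i) h))).trans ?_
      refine mul_le_mul ((hκC i).trans (le_abs_self C)) ?_ (nt_nonneg _ _) (abs_nonneg C)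
      by_contra! hlt
      exact hγ (Set.mem_iUnion.2 ⟨i, hlt.le⟩)
    simpa using this
  have h5 : D * X.tr.norm2 (X.σ γ f - ∑ i, κ i * ξ i) ≤ δ / 4 := by
    calc _ ≤ D * (δ / (4 * (D + 1))) := mul_le_mul_of_nonneg_left hκε hD
      _ ≤ (D + 1) * (δ / (4 * (D + 1))) := mul_le_mul_of_nonneg_right (by linarith) (by positivity)
      _ = δ / 4 := by field_simp
  have h6 : (n : ℝ) * (|C| * η) ≤ δ / 4 := by
    calc (n : ℝ) * (|C| * η) ≤ (n + 1) * ((|C| + 1) * η) := by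
          have := abs_nonneg C
          gcongr <;> linarith
      _ = δ / 4 := by rw [hηd]; field_simp
  linarith

theorem step_A (hE : Pres X t) (hD : 0 ≤ D)
    (hDn : ∀ x ∈ X.M, nt t x ≤ D * X.tr.norm2 x) (hN : ∀ n ∈ N, n ∈ X.M)
    (hex : ∀ x ∈ X.M, ∃ y, IsEN t N y x) (hnt : ∀ x y, IsEN t N y x → nt t y ≤ nt t x)
    {F : Set (H →L[ℂ] H)} (hFA : F ⊆ X.A) (hF : ∀ f ∈ F, ∀ y, IsEN t N y f → y ∈ X.A)
    (hdense : ∀ p ∈ X.A, ∀ ε : ℝ, 0 < ε →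
      ∃ (n : ℕ) (c : Fin n → ℂ) (f : Fin n → (H →L[ℂ] H)),
      (∀ i, f i ∈ F) ∧ X.tr.norm2 (p - ∑ i, c i • f i) ≤ ε)
    {a b : H →L[ℂ] H} (ha : a ∈ X.A) (hb : IsEN t N b a) : b ∈ X.A := by
  have hbM := hN _ hb.1
  have h0 : b - X.EA.E b = 0 := by
    refine nt_eq_zero t (sub_mem hbM (E_M X hbM)) ?_
    by_contra! hpos
    set δ := nt t (b - X.EA.E b) with hδ
    obtain ⟨n, c, f, hf, hε⟩ := hdense a ha (δ / (4 * (D + 1))) (by positivity)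
    choose w hw using fun i => hex (f i) (A_M X (hFA (hf i)))
    have hwA : ∑ i, c i • w i ∈ X.A := sum_mem fun i _ => smul_mem' (c i) (hF _ (hf i) _ (hw i))
    have hEN : IsEN t N (b - ∑ i, c i • w i) (a - ∑ i, c i • f i) :=
      hb.sub (IsEN.sum fun i _ => (hw i).smul (c i))
    have hm := hN _ hEN.1
    have h1 := (hnt _ _ hEN).trans (hDn _ hEN.2.1)
    have h2 := nt_sub_le t hm (E_M X hm)
    have h3 := E_contr hE hm
    have e : b - ∑ i, c i • w i - X.EA.E (b - ∑ i, c i • w i) = b - X.EA.E b := by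
      rw [map_sub, E_fix X hwA]; abel
    rw [e, ← hδ] at h2
    have h5 : D * X.tr.norm2 (a - ∑ i, c i • f i) ≤ δ / 4 := by
      calc _ ≤ D * (δ / (4 * (D + 1))) := mul_le_mul_of_nonneg_left hε hD
        _ ≤ (D + 1) * (δ / (4 * (D + 1))) := mul_le_mul_of_nonneg_right (by linarith) (by positivity)
        _ = δ / 4 := by field_simp
    linarith
  rw [sub_eq_zero.1 h0]
  exact E_A X hbM

end main

/-- intersection of von Neumann algebras -/
def vnInf (N A : VonNeumannAlgebra H) : VonNeumannAlgebra H where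
  toStarSubalgebra := N.toStarSubalgebra ⊓ A.toStarSubalgebra
  centralizer_centralizer' := by
    refine Set.Subset.antisymm ?_ Set.subset_centralizer_centralizer
    intro x hx
    constructor
    · have : x ∈ Set.centralizer (Set.centralizer (N : Set (H →L[ℂ] H))) :=
        Set.centralizer_subset (Set.centralizer_subset fun y hy => hy.1) hx
      rwa [VonNeumannAlgebra.centralizer_centralizer] at this
    · have : x ∈ Set.centralizer (Set.centralizer (A : Set (H →L[ℂ] H))) :=
        Set.centralizer_subset (Set.centralizer_subset fun y hy => hy.2) hx
      rwa [VonNeumannAlgebra.centralizer_centralizer] at this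

theorem mem_vnInf {N A : VonNeumannAlgebra H} {x : H →L[ℂ] H} : x ∈ vnInf N A ↔ x ∈ N ∧ x ∈ A :=
  Iff.rfl

theorem main_thm (hicc : IsICC Γ) (X : CrossedProduct Γ H) (P₀ : VonNeumannAlgebra H)
    (hP₀ : (P₀ : Set (H →L[ℂ] H)) ⊆ (X.A : Set (H →L[ℂ] H)))
    (hcpt : IsCompactExt X (P₀ : Set (H →L[ℂ] H)) (X.A : Set (H →L[ℂ] H)))
    (N : VonNeumannAlgebra H)
    (hN₁ : midCP X (P₀ : Set (H →L[ℂ] H)) ⊆ (N : Set (H →L[ℂ] H)))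
    (hN₂ : (N : Set (H →L[ℂ] H)) ⊆ (X.M : Set (H →L[ℂ] H))) :
    ∃ Q : VonNeumannAlgebra H,
      (P₀ : Set (H →L[ℂ] H)) ⊆ (Q : Set (H →L[ℂ] H)) ∧
      (Q : Set (H →L[ℂ] H)) ⊆ (X.A : Set (H →L[ℂ] H)) ∧
      InvariantUnder X (Q : Set (H →L[ℂ] H)) ∧
      (N : Set (H →L[ℂ] H)) = midCP X (Q : Set (H →L[ℂ] H)) := by
  have hN : ∀ n ∈ N, n ∈ X.M := fun n hn => hN₂ hn
  have hP : ∀ p ∈ P₀, p ∈ X.A := fun p hp => hP₀ hp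
  have huN : ∀ g, X.u g ∈ N := by
    intro g
    refine hN₁ ⟨X.u_mem g, fun h => ?_⟩
    change cf X (X.u g) h ∈ P₀
    rw [cf_u]
    split_ifs
    · exact one_mem' (M := P₀)
    · exact zero_mem _
  have hPN : ∀ p ∈ P₀, p ∈ N := by
    intro p hp
    refine hN₁ ⟨A_M X (hP p hp), fun h => ?_⟩
    change cf X p h ∈ P₀
    by_cases hh : h = 1
    · rw [hh, cf_one, E_fix X (hP p hp)]; exact hp
    · rw [cf_A_ne X (hP p hp) hh]; exact zero_mem _
  obtain ⟨d, t, hdM, hdc, hds, htd, hEN⟩ := exists_normal (tr0 X)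
  have hdA := center_mem_A hicc X hdM hdc
  have hE : Pres X t := by
    intro x hx
    have hdd : d * d ∈ X.A := mul_mem hdA hdA
    rw [htd, htd, pres_left (pres0 X) hdd hx]
  have hDn : ∀ x ∈ X.M, nt t x ≤ ‖d‖ * X.tr.norm2 x := by
    intro x hx
    have h1 := nt_mul_le (tr0 X) hdM hx
    have h2 : nt t x = nt (tr0 X) (d * x) := by
      unfold nt
      rw [htd, dd_eq hdc hds hx]
    rw [h2]; exact h1
  have hex : ∀ x ∈ X.M, ∃ y, IsEN t N y x := fun x hx => by
    obtain ⟨y, hy, h1, -⟩ := hEN N hN x hx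
    exact ⟨y, hy, hx, h1⟩
  have hnt : ∀ x y, IsEN t N y x → nt t y ≤ nt t x := fun x y hxy => by
    obtain ⟨y', hy, h1, h2⟩ := hEN N hN x hxy.2.1
    rw [hxy.uniq hN ⟨hy, hxy.2.1, h1⟩]
    exact Real.sqrt_le_sqrt h2
  obtain ⟨F, hFA, hdense, hcomp⟩ := hcpt
  have hF : ∀ f ∈ F, ∀ y, IsEN t N y f → y ∈ X.A := fun f hf y hy =>
    step_f hicc hE (norm_nonneg d) hDn hN hex hnt huN hP hPN (hFA hf) (hcomp f hf) hy
  have hA : ∀ a b, a ∈ X.A → IsEN t N b a → b ∈ X.A := fun a b ha hb =>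
    step_A hE (norm_nonneg d) hDn hN hex hnt hFA hF hdense ha hb
  -- E maps N into N
  have hEN' : ∀ x ∈ N, X.EA.E x ∈ N := by
    intro x hx
    have hxM := hN x hx
    have haA := E_A X hxM
    obtain ⟨b, hb⟩ := hex _ (A_M X haA)
    have hbA := hA _ _ haA hb
    have hdA' : X.EA.E x - b ∈ X.A := sub_mem haA hbA
    have h0 : X.EA.E x - b = 0 := by
      refine t.faithful _ (A_M X hdA') ?_
      set z := X.EA.E x - b with hz
      -- z ⟂ N
      have k1 : ∀ n ∈ N, t.τ (n * z) = 0 := fun n hn => by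
        rw [hz, mul_sub, map_sub, hb.2.2 n hn, sub_self]
      have k2 : t.τ (star z * x) = 0 := by
        have h := t.star_eq _ (mul_mem (star_mem hxM) (A_M X hdA'))
        rw [k1 _ (star_mem hx), star_mul, star_star, map_zero] at h
        exact h
      have k3 : t.τ (star z * b) = 0 := by
        have h := t.star_eq _ (mul_mem (star_mem (hN _ hb.1)) (A_M X hdA'))
        rw [k1 _ (star_mem hb.1), star_mul, star_star, map_zero] at h
        exact h
      have k4 : star z * z = star z * X.EA.E x - star z * b := by rw [← mul_sub]
      rw [k4, map_sub, k3, pres_left hE (star_mem hdA') hxM, k2, sub_self]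
    rw [sub_eq_zero.1 h0]
    exact hb.1
  refine ⟨vnInf N X.A, fun p hp => ⟨hPN p hp, hP p hp⟩, fun q hq => hq.2, ?_, ?_⟩
  · rintro γ q ⟨hq1, hq2⟩
    exact ⟨mul_mem (mul_mem (huN γ) hq1) (star_mem (huN γ)), X.conj_mem γ q hq2⟩
  · refine Set.Subset.antisymm ?_ ?_
    · intro x hx
      exact ⟨hN x hx, fun γ => ⟨hEN' _ (mul_mem hx (star_mem (huN γ))), cf_A X (hN x hx) γ⟩⟩
    · rintro x ⟨hxM, hx⟩
      obtain ⟨y, hy⟩ := hex x hxM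
      have hyM := hN y hy.1
      have h0 : x - y = 0 := by
        refine X.fourier_sep _ (sub_mem hxM hyM) fun g => ?_
        change cf X (x - y) g = 0
        have heN : cf X (x - y) g ∈ N := by
          rw [cf_sub]
          exact sub_mem (hx g).1 (hEN' _ (mul_mem hy.1 (star_mem (huN g))))
        have heA := cf_A X (sub_mem hxM hyM) g
        set e := cf X (x - y) g with he
        refine t.faithful _ (A_M X heA) ?_
        have k1 : t.τ (star e * e) = t.τ (star e * ((x - y) * star (X.u g))) := by
          rw [← pres_left hE (star_mem heA) (mul_mem (sub_mem hxM hyM) (su_mem X g))]; rfl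
        have k2 : star e * ((x - y) * star (X.u g)) = star e * (x - y) * star (X.u g) := by
          rw [mul_assoc]
        rw [k1, k2, t.tracial _ (mul_mem (star_mem (A_M X heA)) (sub_mem hxM hyM)) _ (su_mem X g),
          ← mul_assoc, mul_sub, map_sub, hy.2.2 _ (mul_mem (star_mem (huN g)) (star_mem heN)),
          sub_self]
      have : x = y := sub_eq_zero.1 h0
      rw [this]
      exact hy.1

end CDP

open CD in
/-- Theorem `cptint`. Let `Γ` be an icc countable group and let
`Γ ↷ (P₀ ⊆ P)` be a compact extension of tracial von Neumann algebras. Then for any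
intermediate von Neumann subalgebra `P₀ ⋊ Γ ⊆ N ⊆ P ⋊ Γ` there exists a `Γ`-invariant
intermediate von Neumann subalgebra `P₀ ⊆ Q ⊆ P` such that `N = Q ⋊ Γ`. -/
theorem stmt2_compact_extension_intermediate_subalgebras
    (Γ : Type) [Group Γ] [Countable Γ] (hicc : IsICC Γ)
    (H : Type) [NormedAddCommGroup H] [InnerProductSpace ℂ H] [CompleteSpace H]
    -- the crossed product `P ⋊ Γ` of the trace-preserving action `Γ ↷ (P, τ)`,
    -- where `P = X.A`
    (X : CrossedProduct Γ H)
    -- a `Γ`-invariant von Neumann subalgebra `P₀ ⊆ P`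
    (P₀ : VonNeumannAlgebra H)
    (hP₀ : (P₀ : Set (H →L[ℂ] H)) ⊆ (X.A : Set (H →L[ℂ] H)))
    (hP₀inv : InvariantUnder X (P₀ : Set (H →L[ℂ] H)))
    -- the extension `Γ ↷ (P₀ ⊆ P)` is compact
    (hcpt : IsCompactExt X (P₀ : Set (H →L[ℂ] H)) (X.A : Set (H →L[ℂ] H)))
    -- an intermediate von Neumann subalgebra `P₀ ⋊ Γ ⊆ N ⊆ P ⋊ Γ`
    (N : VonNeumannAlgebra H)
    (hN₁ : midCP X (P₀ : Set (H →L[ℂ] H)) ⊆ (N : Set (H →L[ℂ] H)))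
    (hN₂ : (N : Set (H →L[ℂ] H)) ⊆ (X.M : Set (H →L[ℂ] H))) :
    ∃ Q : VonNeumannAlgebra H,
      (P₀ : Set (H →L[ℂ] H)) ⊆ (Q : Set (H →L[ℂ] H)) ∧
      (Q : Set (H →L[ℂ] H)) ⊆ (X.A : Set (H →L[ℂ] H)) ∧
      InvariantUnder X (Q : Set (H →L[ℂ] H)) ∧
      (N : Set (H →L[ℂ] H)) = midCP X (Q : Set (H →L[ℂ] H)) := by
  exact CDP.main_thm hicc X P₀ hP₀ hcpt N hN₁ hN₂
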